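/- Every MAD 𝔪 of the twisted affine Kac–Moody Lie algebra L̂(𝔤,σ) is conjugate to ℋ = 𝔥₀ ⊕ kc ⊕ kd under the automorphism group of L̂(𝔤,σ): there exists a k-Lie algebra automorphism φ of L̂(𝔤,σ) with φ(𝔪) = ℋ, where 𝔥₀ is a fixed Cartan subalgebra of the fixed-point subalgebra 𝔤₀ = {x ∈ 𝔤 : σ(x) = x}, viewed inside L(𝔤,σ) as 𝔥₀ ⊗ 1. In particular any two MADs of L̂(𝔤,σ) are conjugate. -/

import Mathlib

open LaurentPolynomial TensorProduct

noncomputable section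

/-- The weight space of a subalgebra `𝔪` of `M` attached to a linear functional
`α ∈ 𝔪*`: `M_α = {l ∈ M : ⁅z, l⁆ = α(z) • l for all z ∈ 𝔪}`. -/
def adWeightSpace {k M : Type} [Field k] [LieRing M] [LieAlgebra k M]
    (𝔪 : LieSubalgebra k M) (α : Module.Dual k ↥𝔪) : Submodule k M :=
  ⨅ z : ↥𝔪, LinearMap.ker
    ((LieAlgebra.ad k M (z : M)) - α z • (1 : Module.End k M))

/-- A subalgebra `𝔪` of a Lie algebra `M` over `k` is diagonalizable if
`M = ⊕_{α ∈ 𝔪*} M_α`. -/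
def IsDiagonalizableSubalgebra {k M : Type} [Field k] [LieRing M] [LieAlgebra k M]
    (𝔪 : LieSubalgebra k M) : Prop :=
  (⨆ α : Module.Dual k ↥𝔪, adWeightSpace 𝔪 α) = ⊤

/-- A MAD: a maximal (abelian) diagonalizable subalgebra. -/
def IsMAD {k M : Type} [Field k] [LieRing M] [LieAlgebra k M]
    (𝔪 : LieSubalgebra k M) : Prop :=
  IsDiagonalizableSubalgebra 𝔪 ∧
    ∀ 𝔪' : LieSubalgebra k M, IsDiagonalizableSubalgebra 𝔪' → 𝔪 ≤ 𝔪' → 𝔪' = 𝔪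

/-- The fixed point subalgebra `𝔤₀ = {x ∈ 𝔤 : σ(x) = x}` of an automorphism `σ`. -/
def gZero (k 𝔤 : Type) [Field k] [LieRing 𝔤] [LieAlgebra k 𝔤] (σ : 𝔤 ≃ₗ⁅k⁆ 𝔤) :
    LieSubalgebra k 𝔤 where
  carrier := {y | σ y = y}
  add_mem' := fun {a b} ha hb => by
    simp only [Set.mem_setOf_eq] at *
    rw [show σ (a + b) = σ a + σ b from σ.toLieHom.map_add a b, ha, hb]
  zero_mem' := by
    simp only [Set.mem_setOf_eq]
    exact σ.toLieHom.map_zero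
  smul_mem' := fun t y hy => by
    simp only [Set.mem_setOf_eq] at *
    rw [show σ (t • y) = t • σ y from σ.toLieHom.map_smul t y, hy]
  lie_mem' := fun {a b} ha hb => by
    simp only [Set.mem_setOf_eq] at *
    rw [show σ ⁅a, b⁆ = ⁅σ a, σ b⁆ from σ.toLieHom.map_lie a b, ha, hb]

set_option linter.unusedSectionVars false

section

section Decomposition

variable {k V W ι : Type*} [Field k] [AddCommGroup V] [Module k V] [AddCommGroup W] [Module k W]

/-- A family of subspaces decomposing the whole space as a direct sum. -/
def IsDec (A : ι → Submodule k V) : Prop := iSupIndep A ∧ ⨆ i, A i = ⊤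

theorem IsDec.exists_glue {A : ι → Submodule k V} (h : IsDec A) (f : ι → V →ₗ[k] W) :
    ∃ g : V →ₗ[k] W, ∀ i, ∀ v ∈ A i, g v = f i v := by
  classical
  have hI : DirectSum.IsInternal A :=
    (DirectSum.isInternal_submodule_iff_iSupIndep_and_iSup_eq_top A).2 h
  let e : (DirectSum ι fun i => A i) ≃ₗ[k] V := LinearEquiv.ofBijective (DirectSum.coeLinearMap A) hI
  refine ⟨(DirectSum.toModule k ι W fun i => (f i).comp (A i).subtype) ∘ₗ e.symm.toLinearMap, ?_⟩
  intro i v hv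
  have : e.symm v = DirectSum.lof k ι (fun i => A i) i ⟨v, hv⟩ := by
    rw [LinearEquiv.symm_apply_eq]
    exact (DirectSum.coeLinearMap_lof A i ⟨v, hv⟩).symm
  simp [this]

theorem ext_of_iSup {A : ι → Submodule k V} (h : ⨆ i, A i = ⊤) {f g : V →ₗ[k] W}
    (hfg : ∀ i, ∀ v ∈ A i, f v = g v) : f = g := by
  have : ⨆ i, A i ≤ LinearMap.eqLocus f g := iSup_le fun i v hv => hfg i v hv
  ext v
  exact this (h ▸ Submodule.mem_top : v ∈ ⨆ i, A i)

theorem map_mem_of_iSup {A : ι → Submodule k V} {f : V →ₗ[k] W} {S : Submodule k W}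
    (hf : ∀ i, ∀ v ∈ A i, f v ∈ S) {v : V} (hv : v ∈ ⨆ i, A i) : f v ∈ S := by
  have : ⨆ i, A i ≤ S.comap f := iSup_le fun i v hv => hf i v hv
  exact this hv

open Classical in
/-- The projection onto the `i`-th summand of a decomposition. -/
def decProj (A : ι → Submodule k V) (i : ι) : V →ₗ[k] V :=
  if h : IsDec A then (h.exists_glue (fun j => if j = i then LinearMap.id else 0)).choose else 0

variable {A : ι → Submodule k V} {B : ι → Submodule k W}

theorem decProj_same (h : IsDec A) {i : ι} {v : V} (hv : v ∈ A i) : decProj A i v = v := by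
  classical
  rw [decProj, dif_pos h,
    (h.exists_glue (fun j => if j = i then (LinearMap.id : V →ₗ[k] V) else 0)).choose_spec i v hv]
  simp

theorem decProj_ne (h : IsDec A) {i j : ι} (hij : i ≠ j) {v : V} (hv : v ∈ A i) :
    decProj A j v = 0 := by
  classical
  rw [decProj, dif_pos h,
    (h.exists_glue (fun l => if l = j then (LinearMap.id : V →ₗ[k] V) else 0)).choose_spec i v hv]
  simp [hij]

theorem decProj_mem (h : IsDec A) (i : ι) (v : V) : decProj A i v ∈ A i := by
  refine map_mem_of_iSup (A := A) (fun j w hw => ?_) (h.2 ▸ Submodule.mem_top : v ∈ ⨆ i, A i)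
  by_cases hij : j = i
  · subst hij; rwa [decProj_same h hw]
  · rw [decProj_ne h hij hw]; exact zero_mem _

theorem exists_sum_decProj (h : IsDec A) (v : V) :
    ∃ s : Finset ι, (∀ i ∉ s, decProj A i v = 0) ∧ v = ∑ i ∈ s, decProj A i v := by
  classical
  have hv : v ∈ ⨆ i, A i := h.2 ▸ Submodule.mem_top
  rw [Submodule.mem_iSup_iff_exists_finsupp] at hv
  obtain ⟨f, hf, rfl⟩ := hv
  have key : ∀ i, decProj A i (f.sum fun _ x => x) = f i := by
    intro i
    rw [Finsupp.sum, map_sum]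
    rw [Finset.sum_eq_single i]
    · exact decProj_same h (hf i)
    · intro j _ hj; exact decProj_ne h hj (hf j)
    · intro hi; simp [Finsupp.notMem_support_iff.1 hi]
  refine ⟨f.support, fun i hi => ?_, ?_⟩
  · rw [key]; exact Finsupp.notMem_support_iff.1 hi
  · simp only [key]; rfl

theorem eq_zero_of_decProj (h : IsDec A) {v : V} (hv : ∀ i, decProj A i v = 0) : v = 0 := by
  obtain ⟨s, -, hs⟩ := exists_sum_decProj h v
  rw [hs]; exact Finset.sum_eq_zero fun i _ => hv i

theorem decProj_map {κ : Type*} {B : κ → Submodule k W} (hA : IsDec A) (hB : IsDec B)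
    (g : V →ₗ[k] W) (e : ι → κ) (he : Function.Injective e)
    (hg : ∀ i, ∀ v ∈ A i, g v ∈ B (e i)) (i : ι) (v : V) :
    decProj B (e i) (g v) = g (decProj A i v) := by
  have : decProj B (e i) ∘ₗ g = g ∘ₗ decProj A i := by
    refine ext_of_iSup hA.2 fun j w hw => ?_
    simp only [LinearMap.comp_apply]
    by_cases hij : j = i
    · subst hij; rw [decProj_same hA hw, decProj_same hB (hg _ _ hw)]
    · rw [decProj_ne hA hij hw, decProj_ne hB (fun h => hij (he h)) (hg _ _ hw), map_zero]
  exact LinearMap.congr_fun this v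

end Decomposition

section IntDiag

variable {k V : Type*} [Field k] [AddCommGroup V] [Module k V]

/-- An endomorphism that is diagonalizable with integer eigenvalues. -/
def IntDiag (D : Module.End k V) : Prop := ⨆ i : ℤ, D.eigenspace (i : k) = ⊤

/-- The eigenspace for an integer eigenvalue. -/
abbrev zEig (D : Module.End k V) (i : ℤ) : Submodule k V := D.eigenspace (i : k)

/-- The projection onto the `i`-th eigenspace. -/
abbrev zPr (D : Module.End k V) (i : ℤ) : V →ₗ[k] V := decProj (zEig D) i

/-- The descending filtration attached to an endomorphism with integer eigenvalues. -/
def Fge (D : Module.End k V) (i : ℤ) : Submodule k V := ⨆ j : {j : ℤ // i ≤ j}, zEig D j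

theorem mem_zEig {D : Module.End k V} {i : ℤ} {v : V} : v ∈ zEig D i ↔ D v = (i : k) • v :=
  Module.End.mem_eigenspace_iff

theorem zEig_neg (D : Module.End k V) (i : ℤ) : zEig (-D) i = zEig D (-i) := by
  ext v
  rw [mem_zEig, mem_zEig]
  simp [neg_eq_iff_eq_neg]

theorem IntDiag.neg {D : Module.End k V} (h : IntDiag D) : IntDiag (-D) := by
  change ⨆ i : ℤ, zEig (-D) i = ⊤
  rw [← (Equiv.neg ℤ).iSup_comp]
  simp only [Equiv.neg_apply, zEig_neg, neg_neg]
  exact h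

theorem Fge_anti {D : Module.End k V} {i j : ℤ} (h : i ≤ j) : Fge D j ≤ Fge D i :=
  iSup_le fun l => le_iSup_of_le (⟨l, h.trans l.2⟩ : {j : ℤ // i ≤ j}) le_rfl

theorem zEig_le_Fge {D : Module.End k V} {i j : ℤ} (h : i ≤ j) : zEig D j ≤ Fge D i :=
  le_iSup_of_le (⟨j, h⟩ : {j : ℤ // i ≤ j}) le_rfl

theorem Fge_le {D : Module.End k V} {i : ℤ} {S : Submodule k V}
    (h : ∀ j, i ≤ j → zEig D j ≤ S) : Fge D i ≤ S := iSup_le fun j => h j.1 j.2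

theorem map_Fge {W : Type*} [AddCommGroup W] [Module k W]
    {D : Module.End k V} {i : ℤ} {f : V →ₗ[k] W} {S : Submodule k W}
    (hf : ∀ j, i ≤ j → ∀ v ∈ zEig D j, f v ∈ S) {v : V} (hv : v ∈ Fge D i) : f v ∈ S :=
  map_mem_of_iSup (fun j v hv => hf j.1 j.2 v hv) hv

variable [CharZero k]

theorem IntDiag.isDec {D : Module.End k V} (h : IntDiag D) : IsDec (zEig D) :=
  ⟨(Module.End.eigenspaces_iSupIndep D).comp Int.cast_injective, h⟩

variable {D : Module.End k V}

theorem mem_Fge_iff (h : IntDiag D) {i : ℤ} {v : V} :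
    v ∈ Fge D i ↔ ∀ j < i, zPr D j v = 0 := by
  constructor
  · intro hv j hj
    have := map_Fge (f := zPr D j) (S := ⊥) (fun l hl w hw => by
      rw [decProj_ne h.isDec (by omega : l ≠ j) hw]; exact zero_mem _) hv
    simpa using this
  · intro hv
    obtain ⟨s, -, hs⟩ := exists_sum_decProj h.isDec v
    rw [hs]
    refine Submodule.sum_mem _ fun j _ => ?_
    by_cases hj : j < i
    · rw [hv j hj]; exact zero_mem _
    · exact zEig_le_Fge (not_lt.1 hj) (decProj_mem h.isDec j v)

theorem exists_mem_Fge (h : IntDiag D) (v : V) : ∃ i, v ∈ Fge D i := by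
  obtain ⟨s, hs0, -⟩ := exists_sum_decProj h.isDec v
  obtain ⟨b, hb⟩ := s.bddBelow
  exact ⟨b, (mem_Fge_iff h).2 fun j hj => hs0 j fun hjs => by have := hb hjs; omega⟩

theorem eq_zero_of_mem_Fge (h : IntDiag D) {v : V} (hv : ∀ i, v ∈ Fge D i) : v = 0 :=
  eq_zero_of_decProj h.isDec fun j => (mem_Fge_iff h).1 (hv (j + 1)) j (by omega)

theorem sub_zPr_mem (h : IntDiag D) {i : ℤ} {v : V} (hv : v ∈ Fge D i) :
    v - zPr D i v ∈ Fge D (i + 1) := by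
  rw [mem_Fge_iff h] at hv ⊢
  intro j hj
  rw [map_sub]
  rcases eq_or_lt_of_le (Int.lt_add_one_iff.1 hj) with rfl | hj
  · rw [decProj_same h.isDec (decProj_mem h.isDec _ v), sub_self]
  · rw [hv j hj, decProj_ne h.isDec (by omega : i ≠ j) (decProj_mem h.isDec _ v), sub_self]

theorem zPr_eq_zero (h : IntDiag D) {i j : ℤ} (hij : j < i) {v : V} (hv : v ∈ Fge D i) :
    zPr D j v = 0 := (mem_Fge_iff h).1 hv j hij

theorem sub_smul_Fge (D : Module.End k V) {i : ℤ} {v : V} (hv : v ∈ Fge D i) :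
    D v - (i : k) • v ∈ Fge D (i + 1) := by
  refine map_Fge (f := D - (i : k) • LinearMap.id) (fun j hj w hw => ?_) hv
  have hw' := mem_zEig.1 hw
  rcases eq_or_lt_of_le hj with rfl | hj
  · simp [hw']
  · simp only [LinearMap.sub_apply, LinearMap.smul_apply, LinearMap.id_apply]
    exact sub_mem (hw' ▸ Submodule.smul_mem _ _ (zEig_le_Fge hj hw))
      (Submodule.smul_mem _ _ (zEig_le_Fge hj hw))

theorem self_Fge (D : Module.End k V) {i : ℤ} {v : V} (hv : v ∈ Fge D i) : D v ∈ Fge D i := by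
  have := add_mem (Fge_anti (by omega) (sub_smul_Fge D hv)) (Submodule.smul_mem _ (i : k) hv)
  simpa using this

/-- Subspaces stable under a diagonalizable operator are stable under its projections. -/
theorem zPr_mem_of_stable (h : IntDiag D) {W : Submodule k V} (hW : ∀ v ∈ W, D v ∈ W)
    {v : V} (hv : v ∈ W) (i : ℤ) : zPr D i v ∈ W := by
  classical
  suffices H : ∀ (s : Finset ℤ) (f : ℤ → V), (∀ i ∈ s, f i ∈ zEig D i) → ∑ i ∈ s, f i ∈ W →
      ∀ i ∈ s, f i ∈ W by
    obtain ⟨s, hs0, hs⟩ := exists_sum_decProj h.isDec v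
    by_cases hi : i ∈ s
    · exact H s (fun i => zPr D i v) (fun i _ => decProj_mem h.isDec i v) (hs ▸ hv) i hi
    · rw [show zPr D i v = 0 from hs0 i hi]; exact zero_mem _
  intro s
  induction s using Finset.induction_on with
  | empty => simp
  | insert a s ha ih =>
    intro f hf hsum
    have h1 : ∑ i ∈ s, ((i : k) - a) • f i ∈ W := by
      have := sub_mem (hW _ hsum) (Submodule.smul_mem _ (a : k) hsum)
      rw [map_sum, Finset.smul_sum, ← Finset.sum_sub_distrib, Finset.sum_insert ha] at this
      have e : ∀ i ∈ insert a s, D (f i) - (a : k) • f i = ((i : k) - a) • f i := fun i hi => by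
        rw [mem_zEig.1 (hf i hi), sub_smul]
      rw [e a (by simp), sub_self, zero_smul, zero_add] at this
      rwa [Finset.sum_congr rfl fun i hi => e i (Finset.mem_insert_of_mem hi)] at this
    have h2 := ih (fun i => ((i : k) - a) • f i)
      (fun i hi => Submodule.smul_mem _ _ (hf i (Finset.mem_insert_of_mem hi))) h1
    have h3 : ∀ i ∈ s, f i ∈ W := fun i hi => by
      have hne : ((i : k) - a) ≠ 0 := by
        rw [sub_ne_zero]; exact_mod_cast fun h : i = a => ha (h ▸ hi)
      have := Submodule.smul_mem W (((i : k) - a)⁻¹) (h2 i hi)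
      rwa [smul_smul, inv_mul_cancel₀ hne, one_smul] at this
    intro i hi
    rcases Finset.mem_insert.1 hi with rfl | hi
    · rw [Finset.sum_insert ha] at hsum
      simpa using sub_mem hsum (Submodule.sum_mem _ h3)
    · exact h3 i hi

theorem zPr_comm (h : IntDiag D) {D' : Module.End k V} (h' : IntDiag D') {g : V →ₗ[k] V}
    {s : ℤ} (hg : ∀ i, ∀ v ∈ zEig D i, g v ∈ zEig D' (i + s)) (i : ℤ) (v : V) :
    zPr D' (i + s) (g v) = g (zPr D i v) :=
  decProj_map h.isDec h'.isDec g (· + s) (add_left_injective s) hg i v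

end IntDiag

end

section

section Twisted

variable {k L : Type*} [Field k] [AddCommGroup L] [Module k L]
  [Module k[T;T⁻¹] L] [IsScalarTower k k[T;T⁻¹] L]

theorem C_smul_eq (a : k) (x : L) : (C a : k[T;T⁻¹]) • x = a • x := by
  rw [C_eq_algebraMap, algebraMap_smul]

theorem T_smul_comm (n : ℤ) (a : k) (x : L) :
    (T n : k[T;T⁻¹]) • a • x = a • (T n : k[T;T⁻¹]) • x := smul_comm _ _ _

theorem T_smul_T_smul (m n : ℤ) (x : L) :
    (T m : k[T;T⁻¹]) • (T n : k[T;T⁻¹]) • x = (T (m + n) : k[T;T⁻¹]) • x := by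
  rw [smul_smul, ← T_add]

theorem T_zero_smul (x : L) : (T 0 : k[T;T⁻¹]) • x = x := by rw [T_zero, one_smul]

variable (k L) in
/-- Multiplication by `T n` as a `k`-linear map. -/
def tsm (n : ℤ) : L →ₗ[k] L where
  toFun x := (T n : k[T;T⁻¹]) • x
  map_add' := smul_add _
  map_smul' a x := T_smul_comm n a x

@[simp] theorem tsm_apply (n : ℤ) (x : L) : tsm k L n x = (T n : k[T;T⁻¹]) • x := rfl

/-- A `k`-linear map whose commutator with `T 1` is `a * T 1`. -/
def TwLin (a : k) (θ : Module.End k L) : Prop :=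
  ∀ x, θ ((T 1 : k[T;T⁻¹]) • x) = (T 1 : k[T;T⁻¹]) • θ x + a • (T 1 : k[T;T⁻¹]) • x

theorem TwLin.T_smul {a : k} {θ : Module.End k L} (h : TwLin a θ) (n : ℤ) (x : L) :
    θ ((T n : k[T;T⁻¹]) • x) = (T n : k[T;T⁻¹]) • θ x + ((n : k) * a) • (T n : k[T;T⁻¹]) • x := by
  have step : ∀ (n : ℤ) (x : L), θ ((T (n + 1) : k[T;T⁻¹]) • x) =
      (T 1 : k[T;T⁻¹]) • θ ((T n : k[T;T⁻¹]) • x) + a • (T (n + 1) : k[T;T⁻¹]) • x := by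
    intro n x
    rw [add_comm n 1, ← T_smul_T_smul, h]
  induction n using Int.induction_on with
  | zero => simp
  | succ n ih =>
    rw [step, ih, smul_add, T_smul_T_smul, T_smul_comm, T_smul_T_smul, add_comm (1 : ℤ)]
    push_cast
    module
  | pred n ih =>
    have := step (-(n : ℤ) - 1) x
    rw [sub_add_cancel, ih] at this
    have h2 := congrArg (fun y => (T (-1) : k[T;T⁻¹]) • y) this
    simp only [smul_add, T_smul_T_smul, T_smul_comm, neg_add_cancel, T_zero_smul] at h2
    rw [show (-1 : ℤ) + -(n : ℤ) = -n - 1 by ring] at h2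
    rw [eq_comm, ← sub_eq_iff_eq_add] at h2
    rw [← h2]
    push_cast
    module

theorem TwLin.neg {a : k} {θ : Module.End k L} (h : TwLin a θ) : TwLin (-a) (-θ) := by
  intro x
  simp only [LinearMap.neg_apply, h x]
  module

theorem TwLin.add {a b : k} {θ η : Module.End k L} (h : TwLin a θ) (h' : TwLin b η) :
    TwLin (a + b) (θ + η) := by
  intro x
  simp only [LinearMap.add_apply, h x, h' x, smul_add]
  module

theorem TwLin.smul {a : k} {θ : Module.End k L} (h : TwLin a θ) (c : k) :
    TwLin (c * a) (c • θ) := by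
  intro x
  simp only [LinearMap.smul_apply, h x, smul_add, T_smul_comm]
  module

/-- A `k`-linear map commuting with `T 1` is linear over Laurent polynomials. -/
def TwLin.toLin {θ : Module.End k L} (h : TwLin 0 θ) : L →ₗ[k[T;T⁻¹]] L where
  toFun := θ
  map_add' := map_add θ
  map_smul' r x := by
    induction r using LaurentPolynomial.induction_on' with
    | add p q hp hq => simp only [RingHom.id_apply] at *; rw [add_smul, add_smul, map_add, hp, hq]
    | C_mul_T n a =>
      simp only [RingHom.id_apply]
      rw [mul_smul, mul_smul, C_smul_eq, C_smul_eq, map_smul, h.T_smul]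
      simp

@[simp] theorem TwLin.toLin_apply {θ : Module.End k L} (h : TwLin 0 θ) (x : L) :
    h.toLin x = θ x := rfl

variable {D : Module.End k L} {M : ℤ}

theorem TwLin.zEig (h : TwLin (M : k) D) {i : ℤ} {v : L} (hv : v ∈ zEig D i) (n : ℤ) :
    (T n : k[T;T⁻¹]) • v ∈ zEig D (i + n * M) := by
  rw [mem_zEig] at *
  rw [h.T_smul, hv, T_smul_comm]
  push_cast
  module

theorem TwLin.Fge (h : TwLin (M : k) D) {i : ℤ} {v : L} (hv : v ∈ Fge D i) (n : ℤ) :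
    (T n : k[T;T⁻¹]) • v ∈ Fge D (i + n * M) :=
  map_Fge (f := tsm k L n) (fun j hj w hw =>
    zEig_le_Fge (by omega : i + n * M ≤ j + n * M) (h.zEig hw n)) hv

variable [CharZero k]

theorem zPr_smul_hom (h : TwLin (M : k) D) (hD : IntDiag D) (hM : M ≠ 0) {d : ℤ} {b : L}
    (hb : b ∈ zEig D d) (n : ℤ) (r : k[T;T⁻¹]) :
    zPr D (d + n * M) (r • b) = r.coeff n • (T n : k[T;T⁻¹]) • b := by
  induction r using LaurentPolynomial.induction_on' with
  | add p q hp hq => rw [add_smul, map_add, hp, hq, AddMonoidAlgebra.coeff_add, Finsupp.add_apply, add_smul]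
  | C_mul_T l a =>
    rw [mul_smul, C_smul_eq, map_smul]
    have hc : (C a * T l : k[T;T⁻¹]).coeff n = if l = n then a else 0 := by
      rw [← smul_eq_C_mul]
      simp
    by_cases hl : l = n
    · subst hl
      rw [decProj_same hD.isDec (h.zEig hb l), hc, if_pos rfl]
    · rw [decProj_ne hD.isDec (i := d + l * M) _ (h.zEig hb l), hc, if_neg hl]
      · simp
      · intro he
        exact hl (mul_right_cancel₀ hM (add_left_cancel he))

theorem zPr_smul_hom_ne (h : TwLin (M : k) D) (hD : IntDiag D) {d : ℤ} {b : L}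
    (hb : b ∈ zEig D d) {e : ℤ} (he : ∀ n, e ≠ d + n * M) (r : k[T;T⁻¹]) :
    zPr D e (r • b) = 0 := by
  induction r using LaurentPolynomial.induction_on' with
  | add p q hp hq => rw [add_smul, map_add, hp, hq, add_zero]
  | C_mul_T l a =>
    rw [mul_smul, C_smul_eq, map_smul, decProj_ne hD.isDec (he l).symm (h.zEig hb l), smul_zero]

/-- A `k`-independent homogeneous family with degrees in one period is independent over Laurent
polynomials. -/
theorem linearIndependent_of_hom (h : TwLin (M : k) D) (hD : IntDiag D) (hM : M ≠ 0)
    {ι : Type*} (b : ι → L) (deg : ι → ℤ) (hb : ∀ j, b j ∈ zEig D (deg j))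
    (hdeg : ∀ j, 0 ≤ deg j ∧ deg j < |M|) (hli : LinearIndependent k b) :
    LinearIndependent k[T;T⁻¹] b := by
  classical
  rw [linearIndependent_iff'] at *
  intro s g hg j hj
  refine LaurentPolynomial.ext fun n => ?_
  have key : ∀ i, zPr D (deg j + n * M) (g i • b i) =
      (T n : k[T;T⁻¹]) • (if deg i = deg j then (g i).coeff n else 0) • b i := by
    intro i
    split_ifs with hij
    · rw [T_smul_comm, ← zPr_smul_hom h hD hM (hb i), hij]
    · rw [zPr_smul_hom_ne h hD (hb i), zero_smul, smul_zero]
      intro l hl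
      apply hij
      have e : (deg j - deg i) = M * (l - n) := by linear_combination hl
      have := Int.eq_zero_of_abs_lt_dvd ((abs_dvd M _).2 ⟨_, e⟩) (by
        rw [abs_lt]; have := hdeg i; have := hdeg j; omega)
      omega
  have h0 := congrArg (zPr D (deg j + n * M)) hg
  rw [map_sum, map_zero, Finset.sum_congr rfl fun i _ => key i, ← Finset.smul_sum] at h0
  have h1 := congrArg (fun y => (T (-n) : k[T;T⁻¹]) • y) h0
  simp only [T_smul_T_smul, neg_add_cancel, T_zero_smul, smul_zero] at h1
  simpa using hli s _ h1 j hj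

/-- A finite basis over Laurent polynomials consisting of eigenvectors. -/
theorem exists_homBasis [Module.Finite k[T;T⁻¹] L] (h : TwLin (M : k) D) (hD : IntDiag D)
    (hM : M ≠ 0) : ∃ (N : ℕ) (b : Module.Basis (Fin N) k[T;T⁻¹] L) (deg : Fin N → ℤ),
      ∀ j, b j ∈ zEig D (deg j) := by
  classical
  have hI : DirectSum.IsInternal (_root_.zEig D) :=
    (DirectSum.isInternal_submodule_iff_iSupIndep_and_iSup_eq_top _).2 hD.isDec
  let bb := fun i => Module.Basis.ofVectorSpace k (_root_.zEig D i)
  let B := hI.collectedBasis bb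
  have hB : ∀ x, B x = (bb x.1 x.2 : L) := fun x => by
    simp only [B, DirectSum.IsInternal.collectedBasis_coe]
  let J := {x : Σ i : ℤ, Module.Basis.ofVectorSpaceIndex k (_root_.zEig D i) // 0 ≤ x.1 ∧ x.1 < |M|}
  let b : J → L := fun j => B j.1
  have hb : ∀ j : J, b j ∈ _root_.zEig D j.1.1 := fun j => by
    simp only [b, hB]; exact Subtype.mem _
  have hli : LinearIndependent k[T;T⁻¹] b :=
    linearIndependent_of_hom h hD hM b (fun j => j.1.1) hb (fun j => j.2)
      (B.linearIndependent.comp _ Subtype.val_injective)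
  have hsp : ⊤ ≤ Submodule.span k[T;T⁻¹] (Set.range b) := by
    have h0 : ∀ d, 0 ≤ d → d < |M| → ∀ v ∈ _root_.zEig D d,
        v ∈ Submodule.span k[T;T⁻¹] (Set.range b) := by
      intro d h1 h2 v hv
      have : v = ∑ x ∈ ((bb d).repr ⟨v, hv⟩).support, ((bb d).repr ⟨v, hv⟩) x • (bb d x : L) := by
        have := congrArg Subtype.val ((bb d).linearCombination_repr ⟨v, hv⟩)
        rw [Finsupp.linearCombination_apply, Finsupp.sum] at this
        simpa using this.symm
      rw [this]
      refine Submodule.sum_mem _ fun x _ => ?_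
      rw [← C_smul_eq]
      refine Submodule.smul_mem _ _ (Submodule.subset_span ⟨⟨⟨d, x⟩, h1, h2⟩, ?_⟩)
      simp only [b, hB]
    intro v _
    have hv : v ∈ ⨆ i, _root_.zEig D i := (hD : ⨆ i, _root_.zEig D i = ⊤) ▸ Submodule.mem_top
    refine map_mem_of_iSup (A := _root_.zEig D) (f := LinearMap.id)
      (S := (Submodule.span k[T;T⁻¹] (Set.range b)).restrictScalars k) (fun i w hw => ?_) hv
    have h3 := h0 (i % M) (Int.emod_nonneg i hM) (Int.emod_lt_abs i hM)
      ((T (-(i / M)) : k[T;T⁻¹]) • w) (by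
        have := h.zEig hw (-(i / M))
        rwa [show i + -(i / M) * M = i % M by have := Int.emod_add_ediv_mul i M; linarith] at this)
    have h4 := Submodule.smul_mem _ (T (i / M) : k[T;T⁻¹]) h3
    rwa [T_smul_T_smul, add_neg_cancel, T_zero_smul] at h4
  let bas := Module.Basis.mk hli hsp
  have : Finite J := Module.Finite.finite_basis bas
  let e := Finite.equivFin J
  refine ⟨_, bas.reindex e, fun j => (e.symm j).1.1, fun j => ?_⟩
  rw [Module.Basis.reindex_apply, Module.Basis.mk_apply]
  exact hb _

theorem map_mem_of_homBasis {W : Type*} [AddCommGroup W] [Module k W] {ι : Type*} [Fintype ι]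
    (b : Module.Basis ι k[T;T⁻¹] L) {f : L →ₗ[k] W} {S : Submodule k W}
    (hf : ∀ j n, f ((T n : k[T;T⁻¹]) • b j) ∈ S) (v : L) : f v ∈ S := by
  rw [← b.sum_repr v, map_sum]
  refine Submodule.sum_mem _ fun j _ => ?_
  induction b.repr v j using LaurentPolynomial.induction_on' with
  | add p q hp hq => rw [add_smul, map_add]; exact add_mem hp hq
  | C_mul_T n a => rw [mul_smul, C_smul_eq, map_smul]; exact S.smul_mem _ (hf j n)

/-- The constant coefficient of a Laurent polynomial. -/
def ct : k[T;T⁻¹] →ₗ[k] k where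
  toFun r := r.coeff 0
  map_add' p q := by simp
  map_smul' a p := by simp

theorem ct_apply (r : k[T;T⁻¹]) : ct r = r.coeff 0 := rfl

theorem ct_T (n : ℤ) : ct (T n : k[T;T⁻¹]) = if n = 0 then 1 else 0 := by simp [ct_apply]

theorem ct_trace_eq_zero [Module.Finite k[T;T⁻¹] L] (h : TwLin (M : k) D) (hD : IntDiag D)
    (hM : M ≠ 0) (A : L →ₗ[k[T;T⁻¹]] L) (hA : ∀ i, ∀ v ∈ zEig D i, zPr D i (A v) = 0) :
    ct (LinearMap.trace k[T;T⁻¹] L A) = 0 := by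
  classical
  obtain ⟨N, b, deg, hb⟩ := exists_homBasis h hD hM
  rw [LinearMap.trace_eq_matrix_trace _ b, Matrix.trace, map_sum]
  refine Finset.sum_eq_zero fun j _ => ?_
  rw [Matrix.diag_apply, LinearMap.toMatrix_apply]
  let f : L →ₗ[k] k := ct ∘ₗ ((b.coord j).restrictScalars k)
  have key : ∀ v, (f - f ∘ₗ zPr D (deg j)) v ∈ (⊥ : Submodule k k) := by
    refine map_mem_of_homBasis b fun l n => ?_
    rw [Submodule.mem_bot, LinearMap.sub_apply, sub_eq_zero, LinearMap.comp_apply (f := f)]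
    by_cases hd : deg l + n * M = deg j
    · rw [← hd, decProj_same hD.isDec (h.zEig (hb l) n)]
    · rw [decProj_ne hD.isDec hd (h.zEig (hb l) n), map_zero]
      simp only [f, LinearMap.comp_apply, LinearMap.restrictScalars_apply, map_smul,
        Module.Basis.coord_apply, Module.Basis.repr_self, smul_eq_mul]
      by_cases hl : l = j
      · subst hl
        simp only [Finsupp.single_eq_same, mul_one, ct_T]
        rw [if_neg]
        rintro rfl
        simp at hd
      · simp [hl]
  have := key (A (b j))
  rw [Submodule.mem_bot, LinearMap.sub_apply, sub_eq_zero, LinearMap.comp_apply (f := f),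
    hA _ _ (hb j), map_zero] at this
  exact this

theorem exists_cmp [Module.Finite k[T;T⁻¹] L] {D' : Module.End k L}
    (h : TwLin (M : k) D) (hD : IntDiag D) (hM : M ≠ 0)
    (h' : TwLin (M : k) D') (hD' : IntDiag D') (A : Module.End k L) (hA : TwLin 0 A) :
    ∃ C : ℤ, ∀ i, ∀ v ∈ Fge D i, A v ∈ Fge D' (i - C) := by
  classical
  obtain ⟨N, b, deg, hb⟩ := exists_homBasis h hD hM
  choose c hc using fun j => exists_mem_Fge hD' (A (b j))
  obtain ⟨K, hK⟩ := (Finset.univ.image fun j => deg j - c j).bddAbove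
  have hK' : ∀ j, deg j - c j ≤ K := fun j => hK (by simp)
  refine ⟨K, fun i v hv => map_Fge (f := A) (fun l hl w hw => ?_) hv⟩
  have key : ∀ w, (A ∘ₗ zPr D l) w ∈ _root_.Fge D' (i - K) := by
    refine map_mem_of_homBasis b fun j n => ?_
    rw [LinearMap.comp_apply]
    by_cases hd : deg j + n * M = l
    · rw [← hd, decProj_same hD.isDec (h.zEig (hb j) n), hA.T_smul]
      simp only [mul_zero, zero_smul, add_zero]
      refine Fge_anti ?_ (h'.Fge (hc j) n)
      have := hK' j
      omega
    · rw [decProj_ne hD.isDec hd (h.zEig (hb j) n), map_zero]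
      exact zero_mem _
  have := key w
  rwa [LinearMap.comp_apply, decProj_same hD.isDec hw] at this

theorem Fge_inf_neg (hD : IntDiag D) {i j : ℤ} (hij : 0 < i + j) {v : L} (hv : v ∈ Fge D i)
    (hv' : v ∈ Fge (-D) j) : v = 0 := by
  refine eq_zero_of_decProj hD.isDec fun l => ?_
  by_cases hl : l < i
  · exact zPr_eq_zero hD hl hv
  · refine map_Fge (f := zPr D l) (S := ⊥) (fun n hn w hw => ?_) hv'
    rw [zEig_neg] at hw
    rw [decProj_ne hD.isDec (by omega : -n ≠ l) hw]
    exact zero_mem _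

theorem exists_bound [Module.Finite k[T;T⁻¹] L] {D'' : Module.End k L}
    (h : TwLin (M : k) D) (hD : IntDiag D) (hM : M ≠ 0)
    (h' : TwLin (-(M : k)) D'') (hD' : IntDiag D'') :
    ∃ C : ℤ, ∀ i j, C < i + j → ∀ v ∈ Fge D i, v ∈ Fge D'' j → v = 0 := by
  obtain ⟨K, hK⟩ := exists_cmp (D' := -D'') h hD hM (by simpa using h'.neg) hD'.neg
    LinearMap.id (by intro x; simp)
  refine ⟨K, fun i j hij v hv hv' => Fge_inf_neg hD'.neg (i := i - K) (j := j) (by omega)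
    (hK i v hv) (by rwa [neg_neg])⟩

end Twisted

end

section

section LieExt

variable {k L ι : Type*} [Field k] [LieRing L] [LieAlgebra k L] {A : ι → Submodule k L}

theorem map_lie_of_iSup (hA : ⨆ i, A i = ⊤) {g : L →ₗ[k] L}
    (h : ∀ i j, ∀ v ∈ A i, ∀ w ∈ A j, g ⁅v, w⁆ = ⁅g v, g w⁆) (v w : L) :
    g ⁅v, w⁆ = ⁅g v, g w⁆ := by
  have hw : w ∈ ⨆ i, A i := hA ▸ Submodule.mem_top
  have hv : v ∈ ⨆ i, A i := hA ▸ Submodule.mem_top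
  induction hv using Submodule.iSup_induction' with
  | zero => simp
  | add x y _ _ hx hy => simp only [add_lie, map_add, hx, hy]
  | mem i x hx =>
    induction hw using Submodule.iSup_induction' with
    | zero => simp
    | add y z _ _ hy hz => simp only [lie_add, map_add, hy, hz]
    | mem j y hy => exact h i j x hx y hy

theorem leibniz_of_iSup (hA : ⨆ i, A i = ⊤) {g : L →ₗ[k] L}
    (h : ∀ i j, ∀ v ∈ A i, ∀ w ∈ A j, g ⁅v, w⁆ = ⁅g v, w⁆ + ⁅v, g w⁆) (v w : L) :
    g ⁅v, w⁆ = ⁅g v, w⁆ + ⁅v, g w⁆ := by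
  have hw : w ∈ ⨆ i, A i := hA ▸ Submodule.mem_top
  have hv : v ∈ ⨆ i, A i := hA ▸ Submodule.mem_top
  induction hv using Submodule.iSup_induction' with
  | zero => simp
  | add x y _ _ hx hy => simp only [add_lie, map_add, hx, hy]; abel
  | mem i x hx =>
    induction hw using Submodule.iSup_induction' with
    | zero => simp
    | add y z _ _ hy hz => simp only [lie_add, map_add, hy, hz]; abel
    | mem j y hy => exact h i j x hx y hy

end LieExt

section TwistedDerivation

variable {k L : Type*} [Field k] [LieRing L] [LieAlgebra k[T;T⁻¹] L] [LieAlgebra k L]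
  [IsScalarTower k k[T;T⁻¹] L]

/-- A `k`-linear derivation acting on Laurent polynomials as `a` times the Euler derivation. -/
structure TwDer (a : k) (E : Module.End k L) : Prop where
  twLin : TwLin a E
  leibniz : ∀ x y, E ⁅x, y⁆ = ⁅E x, y⁆ + ⁅x, E y⁆

theorem TwDer.neg {a : k} {E : Module.End k L} (h : TwDer a E) : TwDer (-a) (-E) :=
  ⟨h.twLin.neg, fun x y => by simp only [LinearMap.neg_apply, h.leibniz, neg_lie, lie_neg]; abel⟩

theorem TwDer.add {a b : k} {E F : Module.End k L} (h : TwDer a E) (h' : TwDer b F) :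
    TwDer (a + b) (E + F) :=
  ⟨h.twLin.add h'.twLin, fun x y => by
    simp only [LinearMap.add_apply, h.leibniz, h'.leibniz, add_lie, lie_add]; abel⟩

theorem TwDer.smul {a : k} {E : Module.End k L} (h : TwDer a E) (c : k) :
    TwDer (c * a) (c • E) :=
  ⟨h.twLin.smul c, fun x y => by
    simp only [LinearMap.smul_apply, h.leibniz, smul_lie, lie_smul, smul_add]⟩

theorem twDer_ad (p : L) : TwDer (0 : k) (LieAlgebra.ad k L p) :=
  ⟨fun x => by simp, fun x y => by simp⟩

theorem TwDer.conj {a : k} {E : Module.End k L} (h : TwDer a E) (g : L ≃ₗ⁅k[T;T⁻¹]⁆ L)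
    {E' : Module.End k L} (hE : ∀ x, E' (g x) = g (E x)) : TwDer a E' := by
  have key : ∀ x, E' x = g (E (g.symm x)) := fun x => by
    rw [← hE, LieEquiv.apply_symm_apply]
  have hT : ∀ (n : ℤ) x, g ((T n : k[T;T⁻¹]) • x) = (T n : k[T;T⁻¹]) • g x := fun n x =>
    g.toLieHom.map_smul _ _
  have hT' : ∀ (n : ℤ) x, g.symm ((T n : k[T;T⁻¹]) • x) = (T n : k[T;T⁻¹]) • g.symm x := fun n x =>
    g.symm.toLieHom.map_smul _ _
  have hk : ∀ (c : k) x, g (c • x) = c • g x := fun c x => by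
    rw [← C_smul_eq, ← C_smul_eq]; exact g.toLieHom.map_smul _ _
  have ha : ∀ x y, g (x + y) = g x + g y := g.toLieHom.map_add
  refine ⟨fun x => ?_, fun x y => ?_⟩
  · rw [key, hT', h.twLin, ha, hT, hk, hT, LieEquiv.apply_symm_apply, ← key]
  · rw [key, key x, key y, LieEquiv.map_lie, h.leibniz, ha, LieEquiv.map_lie, LieEquiv.map_lie,
      LieEquiv.apply_symm_apply, LieEquiv.apply_symm_apply]

theorem exists_lieEquiv {g h : Module.End k L} (hg : TwLin 0 g)
    (hbr : ∀ x y, g ⁅x, y⁆ = ⁅g x, g y⁆) (hgh : ∀ x, g (h x) = x) (hhg : ∀ x, h (g x) = x) :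
    ∃ φ : L ≃ₗ⁅k[T;T⁻¹]⁆ L, ∀ x, φ x = g x :=
  ⟨{ hg.toLin with
      map_lie' := fun {x y} => hbr x y
      invFun := h
      left_inv := hhg
      right_inv := hgh }, fun _ => rfl⟩

section

variable {D : Module.End k L} {a : k}

theorem TwDer.lie_zEig (hD : TwDer a D) {i j : ℤ} {v w : L} (hv : v ∈ zEig D i)
    (hw : w ∈ zEig D j) : ⁅v, w⁆ ∈ zEig D (i + j) := by
  rw [mem_zEig] at *
  rw [hD.leibniz, hv, hw, smul_lie, lie_smul]
  push_cast
  module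

theorem TwDer.lie_Fge (hD : TwDer a D) {i j : ℤ} {v w : L} (hv : v ∈ Fge D i)
    (hw : w ∈ Fge D j) : ⁅v, w⁆ ∈ Fge D (i + j) := by
  refine map_Fge (f := LieAlgebra.ad k L v) (fun l hl w hw => ?_) hw
  have : ⁅w, v⁆ ∈ Fge D (i + j) :=
    map_Fge (f := LieAlgebra.ad k L w) (fun n hn v hv =>
      zEig_le_Fge (by omega : i + j ≤ l + n) (hD.lie_zEig hw hv)) hv
  rw [LieAlgebra.ad_apply, ← lie_skew]
  exact neg_mem this

end

variable [CharZero k]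

section Killing

open LinearMap in
/-- `p` represents the functional `y ↦ tr (A ∘ ad y)` with respect to the Killing form. -/
def KRep (A : Module.End k L) (hA : TwLin 0 A) (p : L) : Prop :=
  ∀ y, killingForm k[T;T⁻¹] L p y = trace k[T;T⁻¹] L (hA.toLin ∘ₗ (LieAlgebra.ad k[T;T⁻¹] L y))

theorem exists_kRep (hκ : Function.Surjective (killingForm k[T;T⁻¹] L)) (A : Module.End k L)
    (hA : TwLin 0 A) : ∃ p, KRep A hA p := by
  obtain ⟨p, hp⟩ := hκ
    { toFun := fun y => LinearMap.trace k[T;T⁻¹] L (hA.toLin ∘ₗ (LieAlgebra.ad k[T;T⁻¹] L y))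
      map_add' := fun x y => by rw [map_add, LinearMap.comp_add, map_add]
      map_smul' := fun r x => by rw [map_smul, LinearMap.comp_smul, map_smul, RingHom.id_apply] }
  exact ⟨p, fun y => by rw [hp]; rfl⟩

theorem KRep.add {A B : Module.End k L} {hA : TwLin 0 A} {hB : TwLin 0 B} {p q : L}
    (hp : KRep A hA p) (hq : KRep B hB q) (hAB : TwLin 0 (A + B)) : KRep (A + B) hAB (p + q) := by
  intro y
  rw [map_add, LinearMap.add_apply, hp y, hq y, ← map_add, ← LinearMap.add_comp]
  rfl

theorem TwDer.eq_lie (hκ : Function.Injective (killingForm k[T;T⁻¹] L)) {δ : Module.End k L}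
    (hδ : TwDer 0 δ) {p : L} (hp : KRep δ hδ.twLin p) (x : L) : δ x = ⁅p, x⁆ := by
  let ad := LieAlgebra.ad k[T;T⁻¹] L
  let ε : L →ₗ[k[T;T⁻¹]] L := hδ.twLin.toLin - ad p
  have hε : ∀ y, ε y = δ y - ⁅p, y⁆ := fun y => rfl
  have hbr : ∀ a, ad (ε a) = ε ∘ₗ ad a - ad a ∘ₗ ε := by
    intro a
    ext y
    simp only [ad, LieAlgebra.ad_apply, LinearMap.sub_apply, LinearMap.comp_apply, hε, hδ.leibniz,
      sub_lie, lie_sub, lie_lie]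
    abel
  rw [← sub_eq_zero, ← hε]
  apply hκ
  rw [map_zero]
  ext1 y
  rw [LinearMap.zero_apply, killingForm_apply_apply]
  change LinearMap.trace _ _ (ad (ε x) ∘ₗ ad y) = 0
  have h1 : LinearMap.trace k[T;T⁻¹] L (ε ∘ₗ ad ⁅x, y⁆) = 0 := by
    rw [LinearMap.sub_comp, map_sub, ← hp, killingForm_apply_apply, sub_self]
  have h2 : (ad ⁅x, y⁆ : L →ₗ[k[T;T⁻¹]] L) = ad x ∘ₗ ad y - ad y ∘ₗ ad x := by
    ext z; simp [ad]
  rw [h2, LinearMap.comp_sub, map_sub, sub_eq_zero] at h1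
  rw [hbr, LinearMap.sub_comp, map_sub, sub_eq_zero, LinearMap.comp_assoc, h1,
    LinearMap.comp_assoc]
  exact LinearMap.trace_mul_comm _ (ε ∘ₗ ad y) (ad x)

theorem TwDer.exists_lie (hκ : Function.Bijective (killingForm k[T;T⁻¹] L)) {δ : Module.End k L}
    (hδ : TwDer 0 δ) : ∃ p : L, ∀ x, δ x = ⁅p, x⁆ := by
  obtain ⟨p, hp⟩ := exists_kRep hκ.2 δ hδ.twLin
  exact ⟨p, hδ.eq_lie hκ.1 hp⟩

variable [Module.Finite k[T;T⁻¹] L] {D : Module.End k L} {M : ℤ}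

theorem ct_trace_comp_eq_zero (hD : TwDer (M : k) D) (hi : IntDiag D) (hM : M ≠ 0)
    (A : L →ₗ[k[T;T⁻¹]] L) (s : ℤ) (hA : ∀ i, ∀ v ∈ Fge D i, A v ∈ Fge D (i + s)) {j : ℤ}
    (hj : 0 < j + s) {y : L} (hy : y ∈ zEig D j) :
    ct (LinearMap.trace k[T;T⁻¹] L (A ∘ₗ LieAlgebra.ad k[T;T⁻¹] L y)) = 0 := by
  refine ct_trace_eq_zero hD.twLin hi hM _ fun i v hv => ?_
  exact zPr_eq_zero hi (by omega : i < j + i + s) (hA _ _ (zEig_le_Fge le_rfl (hD.lie_zEig hy hv)))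

theorem ct_killing_eq_zero (hD : TwDer (M : k) D) (hi : IntDiag D) (hM : M ≠ 0) {i j : ℤ}
    (hij : i + j ≠ 0) {x y : L} (hx : x ∈ zEig D i) (hy : y ∈ zEig D j) :
    ct (killingForm k[T;T⁻¹] L x y) = 0 := by
  rw [killingForm_apply_apply]
  refine ct_trace_eq_zero hD.twLin hi hM _ fun l v hv => ?_
  exact decProj_ne hi.isDec (by omega : i + (j + l) ≠ l) (hD.lie_zEig hx (hD.lie_zEig hy hv))

theorem eq_zero_of_ct_killing (hκ : Function.Injective (killingForm k[T;T⁻¹] L)) {x : L}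
    (hx : ∀ y, ct (killingForm k[T;T⁻¹] L x y) = 0) : x = 0 := by
  apply hκ
  rw [map_zero]
  ext1 y
  refine LaurentPolynomial.ext fun n => ?_
  have := hx ((T (-n) : k[T;T⁻¹]) • y)
  rw [map_smul, smul_eq_mul, ct_apply] at this
  rw [LinearMap.zero_apply]
  generalize killingForm k[T;T⁻¹] L x y = r at *
  rw [T, AddMonoidAlgebra.coeff_single_mul_apply] at this
  simpa using this

theorem ct_killing_zPr (hD : TwDer (M : k) D) (hi : IntDiag D) (hM : M ≠ 0) (j : ℤ) (p : L) {y : L}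
    (hy : y ∈ zEig D (-j)) :
    ct (killingForm k[T;T⁻¹] L (zPr D j p) y) = ct (killingForm k[T;T⁻¹] L p y) := by
  let f : L →ₗ[k] k := ct ∘ₗ ((killingForm k[T;T⁻¹] L).flip y).restrictScalars k
  have : f ∘ₗ zPr D j = f := by
    refine ext_of_iSup hi fun i v hv => ?_
    rw [LinearMap.comp_apply]
    by_cases hij : i = j
    · subst hij; rw [decProj_same hi.isDec hv]
    · rw [decProj_ne hi.isDec hij hv, map_zero]
      exact (ct_killing_eq_zero hD hi hM (by omega) hv hy).symm
  exact LinearMap.congr_fun this p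

theorem KRep.mem_Fge (hκ : Function.Injective (killingForm k[T;T⁻¹] L))
    (hD : TwDer (M : k) D) (hi : IntDiag D) (hM : M ≠ 0) {A : Module.End k L} {hA : TwLin 0 A}
    {p : L} (hp : KRep A hA p) (s : ℤ) (hs : ∀ i, ∀ v ∈ Fge D i, A v ∈ Fge D (i + s)) :
    p ∈ Fge D s := by
  rw [mem_Fge_iff hi]
  intro j hj
  refine eq_zero_of_ct_killing hκ fun y => ?_
  let f : L →ₗ[k] k := ct ∘ₗ ((killingForm k[T;T⁻¹] L) (zPr D j p)).restrictScalars k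
  have : f = 0 := by
    refine ext_of_iSup hi fun l y hy => ?_
    change ct (killingForm k[T;T⁻¹] L (zPr D j p) y) = 0
    by_cases hl : l = -j
    · subst hl
      rw [ct_killing_zPr hD hi hM j p hy, hp y]
      exact ct_trace_comp_eq_zero hD hi hM _ s hs (by omega) hy
    · exact ct_killing_eq_zero hD hi hM (by omega) (decProj_mem hi.isDec j p) hy
  exact LinearMap.congr_fun this y

end Killing

section GrTrick

variable {D D₁ : Module.End k L}

theorem zEig_le_Fge_of_gr (hi : IntDiag D)
    (hgr : ∀ i, ∀ v ∈ Fge D i, D₁ v - (i : k) • v ∈ Fge D (i + 1)) (j : ℤ) :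
    zEig D₁ j ≤ Fge D j := by
  intro v hv
  obtain ⟨i, hvi⟩ := exists_mem_Fge hi v
  have climb : ∀ n : ℕ, v ∈ Fge D (min (i + n) j) := by
    intro n
    induction n with
    | zero => exact Fge_anti (by simp) hvi
    | succ n ih =>
      by_cases h : j ≤ i + n
      · rw [min_eq_right h] at ih; exact Fge_anti (min_le_right _ _) ih
      · rw [min_eq_left (by omega)] at ih
        have := hgr _ _ ih
        rw [mem_zEig.1 hv, ← sub_smul, Submodule.smul_mem_iff] at this
        · exact Fge_anti (by push_cast; omega) this
        · rw [sub_ne_zero]; norm_cast; omega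
  have := climb (j - i).toNat
  rwa [min_eq_right (by omega)] at this

theorem Fge_stable_of_gr (hgr : ∀ i, ∀ v ∈ Fge D i, D₁ v - (i : k) • v ∈ Fge D (i + 1)) {i : ℤ}
    {v : L} (hv : v ∈ Fge D i) : D₁ v ∈ Fge D i := by
  have := add_mem (Fge_anti (by omega) (hgr i v hv)) (Submodule.smul_mem _ (i : k) hv)
  simpa using this

theorem Fge_eq_of_gr (hi : IntDiag D) (hi₁ : IntDiag D₁)
    (hgr : ∀ i, ∀ v ∈ Fge D i, D₁ v - (i : k) • v ∈ Fge D (i + 1)) (i : ℤ) :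
    Fge D₁ i = Fge D i := by
  refine le_antisymm (Fge_le fun j hj => (zEig_le_Fge_of_gr hi hgr j).trans (Fge_anti hj)) ?_
  intro v hv
  rw [mem_Fge_iff hi₁]
  intro j hj
  have hw := zPr_mem_of_stable hi₁ (fun v hv => Fge_stable_of_gr hgr hv) hv j
  have hw' := mem_zEig.1 (decProj_mem hi₁.isDec j v)
  refine eq_zero_of_mem_Fge hi fun n => ?_
  have climb : ∀ n : ℕ, zPr D₁ j v ∈ Fge D (i + n) := by
    intro n
    induction n with
    | zero => simpa using hw
    | succ n ih =>
      have := hgr _ _ ih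
      rw [hw', ← sub_smul, Submodule.smul_mem_iff] at this
      · exact Fge_anti (by push_cast; omega) this
      · rw [sub_ne_zero]; norm_cast; omega
  exact Fge_anti (by omega) (climb (n - i).toNat)

theorem exists_gr_equiv {M : ℤ} (hD : TwDer (M : k) D) (hi : IntDiag D) (hD₁ : TwDer (M : k) D₁)
    (hi₁ : IntDiag D₁) (hgr : ∀ i, ∀ v ∈ Fge D i, D₁ v - (i : k) • v ∈ Fge D (i + 1)) :
    ∃ g : L ≃ₗ⁅k[T;T⁻¹]⁆ L, ∀ x, g (D x) = D₁ (g x) := by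
  have hF := Fge_eq_of_gr hi hi₁ hgr
  obtain ⟨g, hg⟩ := hi.isDec.exists_glue (zPr D₁)
  obtain ⟨h, hh⟩ := hi₁.isDec.exists_glue (zPr D)
  have inv : ∀ {A B : Module.End k L} (hA : IntDiag A) (hB : IntDiag B)
      (hAB : ∀ i, Fge A i = Fge B i) {i : ℤ} {v : L} (_ : v ∈ zEig A i),
      zPr A i (zPr B i v) = v := by
    intro A B hA hB hAB i v hv
    have h1 := sub_zPr_mem hB (i := i) (v := v) (hAB i ▸ zEig_le_Fge le_rfl hv)
    rw [← hAB] at h1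
    have h2 := zPr_eq_zero hA (j := i) (by omega) h1
    rw [map_sub, decProj_same hA.isDec hv, sub_eq_zero] at h2
    exact h2.symm
  have hhg : h ∘ₗ g = LinearMap.id := ext_of_iSup hi fun i v hv => by
    rw [LinearMap.comp_apply, hg i v hv, hh i _ (decProj_mem hi₁.isDec i v), LinearMap.id_apply,
      inv hi hi₁ (fun i => (hF i).symm) hv]
  have hgh : g ∘ₗ h = LinearMap.id := ext_of_iSup hi₁ fun i v hv => by
    rw [LinearMap.comp_apply, hh i v hv, hg i _ (decProj_mem hi.isDec i v), LinearMap.id_apply,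
      inv hi₁ hi hF hv]
  have hT : TwLin 0 g := by
    have : g ∘ₗ tsm k L 1 = tsm k L 1 ∘ₗ g := ext_of_iSup hi fun i v hv => by
      simp only [LinearMap.comp_apply, tsm_apply]
      rw [hg i v hv, hg _ _ (hD.twLin.zEig hv 1)]
      exact zPr_comm hi₁ hi₁ (g := tsm k L 1) (fun i v hv => hD₁.twLin.zEig hv 1) i v
    intro x
    have := LinearMap.congr_fun this x
    simpa using this
  obtain ⟨φ, hφ⟩ := exists_lieEquiv hT (map_lie_of_iSup hi fun i j v hv w hw => by
      rw [hg i v hv, hg j w hw, hg _ _ (hD.lie_zEig hv hw)]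
      have hv1 := sub_zPr_mem hi₁ (hF i ▸ zEig_le_Fge le_rfl hv : v ∈ Fge D₁ i)
      have hw0 := (hF j ▸ zEig_le_Fge le_rfl hw : w ∈ Fge D₁ j)
      have hw1 := sub_zPr_mem hi₁ hw0
      have hv' := decProj_mem hi₁.isDec i v
      have hw' := decProj_mem hi₁.isDec j w
      have h3 := add_mem (Fge_anti (by omega : i + j + 1 ≤ i + 1 + j) (hD₁.lie_Fge hv1 hw0))
        (Fge_anti (by omega : i + j + 1 ≤ i + (j + 1))
          (hD₁.lie_Fge (zEig_le_Fge le_rfl hv') hw1))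
      have h4 := zPr_eq_zero hi₁ (by omega : i + j < i + j + 1) h3
      rw [show ⁅v - zPr D₁ i v, w⁆ + ⁅zPr D₁ i v, w - zPr D₁ j w⁆ =
        ⁅v, w⁆ - ⁅zPr D₁ i v, zPr D₁ j w⁆ by rw [sub_lie, lie_sub]; abel, map_sub,
        decProj_same hi₁.isDec (hD₁.lie_zEig hv' hw'), sub_eq_zero] at h4
      exact h4) (LinearMap.congr_fun hgh) (LinearMap.congr_fun hhg)
  refine ⟨φ, fun x => ?_⟩
  rw [hφ, hφ]
  have : g ∘ₗ D = D₁ ∘ₗ g := ext_of_iSup hi fun i v hv => by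
    simp only [LinearMap.comp_apply]
    rw [mem_zEig.1 hv, map_smul, hg i v hv, mem_zEig.1 (decProj_mem hi₁.isDec i v)]
  exact LinearMap.congr_fun this x

theorem exists_zero_component {B : Module.End k L} {N : ℤ} {a : k} (hB : TwDer (N : k) B)
    (hiB : IntDiag B) (hBF : ∀ i, ∀ v ∈ Fge D i, B v ∈ Fge D i) (hD : TwDer a D) :
    ∃ E : Module.End k L, TwDer a E ∧ (∀ x, E (B x) = B (E x)) ∧
      ∀ i, ∀ v ∈ Fge D i, E v - (i : k) • v ∈ Fge D (i + 1) := by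
  classical
  obtain ⟨E, hE⟩ := hiB.isDec.exists_glue (fun i => zPr B i ∘ₗ D)
  simp only [LinearMap.comp_apply] at hE
  have hlie : ∀ (i j : ℤ) (u w : L), w ∈ zEig B j → zPr B (i + j) ⁅u, w⁆ = ⁅zPr B i u, w⁆ := by
    intro i j u w hw
    have := zPr_comm hiB hiB (g := -LieAlgebra.ad k L w) (s := j) (fun i v hv => by
      simp only [LinearMap.neg_apply, LieAlgebra.ad_apply, lie_skew]
      exact hB.lie_zEig hv hw) i u
    simpa only [LinearMap.neg_apply, LieAlgebra.ad_apply, lie_skew] using this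
  refine ⟨E, ⟨?_, leibniz_of_iSup hiB fun i j v hv w hw => ?_⟩, ?_, ?_⟩
  · have : E ∘ₗ tsm k L 1 = tsm k L 1 ∘ₗ E + a • tsm k L 1 := ext_of_iSup hiB fun i v hv => by
      simp only [LinearMap.comp_apply, LinearMap.add_apply, LinearMap.smul_apply, tsm_apply]
      have h1 := hB.twLin.zEig hv 1
      rw [hE i v hv, hE _ _ h1, hD.twLin, map_add, LinearMap.map_smul (zPr B (i + 1 * N)) a, decProj_same hiB.isDec h1]
      congr 1
      exact zPr_comm hiB hiB (g := tsm k L 1) (fun i v hv => hB.twLin.zEig hv 1) i (D v)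
    exact fun x => LinearMap.congr_fun this x
  · rw [hE i v hv, hE j w hw, hE _ _ (hB.lie_zEig hv hw), hD.leibniz, map_add, hlie _ _ _ _ hw,
      ← lie_skew v (D w), map_neg, add_comm i j, hlie _ _ _ _ hv, lie_skew]
  · have : E ∘ₗ B = B ∘ₗ E := ext_of_iSup hiB fun i v hv => by
      simp only [LinearMap.comp_apply]
      rw [mem_zEig.1 hv, map_smul, hE i v hv, mem_zEig.1 (decProj_mem hiB.isDec i _)]
    exact LinearMap.congr_fun this
  · intro i v hv
    obtain ⟨s, -, hs⟩ := exists_sum_decProj hiB.isDec v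
    rw [hs, map_sum, Finset.smul_sum, ← Finset.sum_sub_distrib]
    refine Submodule.sum_mem _ fun l _ => ?_
    have hl := zPr_mem_of_stable hiB (hBF i) hv l
    have hl' := decProj_mem hiB.isDec l v
    have := zPr_mem_of_stable hiB (hBF (i + 1)) (sub_smul_Fge D hl) l
    rwa [map_sub, map_smul, decProj_same hiB.isDec hl', ← hE l _ hl'] at this

theorem intDiag_of_gr {E : Module.End k L} (hi : IntDiag D)
    (hgr : ∀ i, ∀ v ∈ Fge D i, E v - (i : k) • v ∈ Fge D (i + 1)) {κ : Type*}
    (W : κ → Submodule k L) (hW : ⨆ l, W l = ⊤) (hWE : ∀ l, ∀ v ∈ W l, E v ∈ W l)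
    (hWb : ∀ l, ∃ N : ℤ, ∀ v ∈ W l, v ∈ Fge D N → v = 0) : IntDiag E := by
  have surj : ∀ i j : ℤ, i < j → ∀ v ∈ Fge E j, ∃ u ∈ Fge E j, E u - (i : k) • u = v := by
    intro i j hij v hv
    have : Fge E j ≤ (Fge E j).map (E - (i : k) • LinearMap.id) := by
      refine Fge_le fun l hl w hw => ⟨((l : k) - i)⁻¹ • w,
        Submodule.smul_mem _ _ (zEig_le_Fge hl hw), ?_⟩
      have hne : (l : k) - i ≠ 0 := by rw [sub_ne_zero]; norm_cast; omega
      rw [map_smul, LinearMap.sub_apply, mem_zEig.1 hw, LinearMap.smul_apply, LinearMap.id_apply,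
        ← sub_smul, smul_smul, inv_mul_cancel₀ hne, one_smul]
    exact this hv
  have main : ∀ (l : κ) (N : ℤ), (∀ v ∈ W l, v ∈ Fge D N → v = 0) → ∀ (n : ℕ) (i : ℤ),
      N ≤ i + n → ∀ v ∈ W l, v ∈ Fge D i → v ∈ Fge E i := by
    intro l N hN n
    induction n with
    | zero =>
      intro i hn v hv hvi
      rw [hN v hv (Fge_anti (by simpa using hn) hvi)]
      exact zero_mem _
    | succ n ih =>
      intro i hn v hv hvi
      have h1 := ih (i + 1) (by push_cast at hn; omega) (E v - (i : k) • v)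
        (sub_mem (hWE l v hv) (Submodule.smul_mem _ _ hv)) (hgr i v hvi)
      obtain ⟨u, hu, he⟩ := surj i (i + 1) (by omega) _ h1
      have h2 : v - u ∈ zEig E i := by
        rw [mem_zEig, map_sub, smul_sub, ← sub_eq_zero]
        rw [← sub_eq_zero] at he
        rw [← neg_eq_zero, ← he]
        abel
      have := add_mem (zEig_le_Fge le_rfl h2) (Fge_anti (by omega : i ≤ i + 1) hu)
      simpa using this
  unfold IntDiag
  rw [eq_top_iff, ← hW]
  refine iSup_le fun l v hv => ?_
  obtain ⟨N, hN⟩ := hWb l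
  obtain ⟨i, hvi⟩ := exists_mem_Fge hi v
  have := main l N hN (N - i).toNat i (by omega) v hv hvi
  exact Fge_le (S := ⨆ i : ℤ, zEig E i) (fun j _ => le_iSup (fun i : ℤ => zEig E i) j) this

end GrTrick

end TwistedDerivation

end

section

section Splitting

variable {k L : Type*} [Field k] [CharZero k] [AddCommGroup L] [Module k L]
  [Module k[T;T⁻¹] L] [IsScalarTower k k[T;T⁻¹] L]

/-- Two opposite periodic filtrations have a common splitting of the first one. -/
theorem exists_splitting [Module.Finite k[T;T⁻¹] L] {D D'' : Module.End k L} {M : ℤ}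
    (hM : 0 < M) (hD : TwLin (M : k) D) (hi : IntDiag D) (hD'' : TwLin (-(M : k)) D'')
    (hi'' : IntDiag D'') :
    ∃ θ : Module.End k L, TwLin (M : k) θ ∧
      (∀ i, ∀ v ∈ Fge D i, θ v - (i : k) • v ∈ Fge D (i + 1)) ∧
      ∀ j, ∀ v ∈ Fge D'' j, θ v ∈ Fge D'' j := by
  classical
  have hT'' : ∀ {j : ℤ} {v : L} (_ : v ∈ Fge D'' j) (n : ℤ),
      (T n : k[T;T⁻¹]) • v ∈ Fge D'' (j - n * M) := by
    intro j v hv n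
    have := TwLin.Fge (M := -M) (D := D'') (by push_cast; exact hD'') hv n
    rwa [mul_neg, ← sub_eq_add_neg] at this
  let B : ℤ → ℤ → Submodule k L := fun i j => Fge D i ⊓ Fge D'' j
  let A : ℤ → ℤ → Submodule k L := fun i j => B (i + 1) j ⊔ B i (j + 1)
  have hBanti : ∀ {i i' j j' : ℤ}, i ≤ i' → j ≤ j' → B i' j' ≤ B i j := fun h h' =>
    inf_le_inf (Fge_anti h) (Fge_anti h')
  have hAB : ∀ i j, A i j ≤ B i j := fun i j =>
    sup_le (hBanti (by omega) le_rfl) (hBanti le_rfl (by omega))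
  have hBT : ∀ {i j : ℤ} {v : L} (_ : v ∈ B i j) (n : ℤ),
      (T n : k[T;T⁻¹]) • v ∈ B (i + n * M) (j - n * M) := fun hv n =>
    ⟨hD.Fge hv.1 n, hT'' hv.2 n⟩
  have hAT : ∀ {i j : ℤ} {v : L} (_ : v ∈ A i j) (n : ℤ),
      (T n : k[T;T⁻¹]) • v ∈ A (i + n * M) (j - n * M) := by
    intro i j v hv n
    obtain ⟨a, ha, b, hb, rfl⟩ := Submodule.mem_sup.1 hv
    rw [smul_add]
    refine add_mem (Submodule.mem_sup_left ?_) (Submodule.mem_sup_right ?_)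
    · have := hBT ha n; rwa [add_right_comm] at this
    · have := hBT hb n; rwa [add_sub_right_comm] at this
  choose C' hC' using fun i j => Submodule.exists_isCompl (A i j)
  let Cc : ℤ → ℤ → Submodule k L := fun i j => C' i j ⊓ B i j
  have hdis : ∀ i j v, v ∈ Cc i j → v ∈ A i j → v = 0 := fun i j v h1 h2 =>
    Submodule.disjoint_def.1 (hC' i j).disjoint v h2 h1.1
  have hsup : ∀ i j v, v ∈ B i j → ∃ a ∈ A i j, ∃ c ∈ Cc i j, v = a + c := by
    intro i j v hv
    have : v ∈ A i j ⊔ C' i j := (hC' i j).sup_eq_top ▸ Submodule.mem_top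
    obtain ⟨a, ha, c, hc, rfl⟩ := Submodule.mem_sup.1 this
    exact ⟨a, ha, c, ⟨hc, by simpa using sub_mem hv (hAB i j ha)⟩, rfl⟩
  let V : ℤ × ℤ → Submodule k L := fun p =>
    (Cc (p.1 + p.2 / M * M) (p.2 % M)).comap (tsm k L (p.2 / M))
  have hmodM : ∀ j, j - j / M * M = j % M := fun j => by
    have := Int.emod_add_ediv_mul j M; linarith
  have hback : ∀ (j : ℤ) (v : L), (T (-(j / M)) : k[T;T⁻¹]) • (T (j / M) : k[T;T⁻¹]) • v = v :=
    fun j v => by rw [T_smul_T_smul, neg_add_cancel, T_zero_smul]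
  have hVB : ∀ p, V p ≤ B p.1 p.2 := by
    rintro ⟨i, j⟩ v hv
    have := hBT (show _ ∈ B _ _ from hv.2) (-(j / M))
    have e1 : i + j / M * M + -(j / M) * M = i := by ring
    have e2 : j % M - -(j / M) * M = j := by rw [← hmodM]; ring
    dsimp only at this
    rw [tsm_apply, hback, e1, e2] at this
    exact this
  have hVA : ∀ p v, v ∈ V p → v ∈ A p.1 p.2 → v = 0 := by
    rintro ⟨i, j⟩ v hv ha
    have h1 := hAT ha (j / M)
    rw [hmodM] at h1
    have h2 := hdis _ _ _ hv h1
    rw [← hback j v, ← tsm_apply (k := k) (j / M), h2, smul_zero]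
  have hVsup : ∀ i j v, v ∈ B i j → ∃ a ∈ A i j, ∃ c ∈ V (i, j), v = a + c := by
    intro i j v hv
    have h1 := hBT hv (j / M)
    rw [hmodM] at h1
    obtain ⟨a, ha, c, hc, he⟩ := hsup _ _ _ h1
    refine ⟨(T (-(j / M)) : k[T;T⁻¹]) • a, ?_, (T (-(j / M)) : k[T;T⁻¹]) • c, ?_, ?_⟩
    · have := hAT ha (-(j / M))
      have e1 : i + j / M * M + -(j / M) * M = i := by ring
      have e2 : j % M - -(j / M) * M = j := by rw [← hmodM]; ring
      rwa [e1, e2] at this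
    · change (T (j / M) : k[T;T⁻¹]) • _ ∈ Cc _ _
      rwa [T_smul_T_smul, add_neg_cancel, T_zero_smul]
    · rw [← smul_add, ← he, hback]
  have hVT : ∀ i j v, v ∈ V (i, j) → (T 1 : k[T;T⁻¹]) • v ∈ V (i + M, j - M) := by
    intro i j v hv
    change (T ((j - M) / M) : k[T;T⁻¹]) • (T 1 : k[T;T⁻¹]) • v ∈
      Cc (i + M + (j - M) / M * M) ((j - M) % M)
    have e : (j - M) / M = j / M - 1 := by
      rw [sub_eq_add_neg, Int.add_ediv_of_dvd_right ⟨-1, by ring⟩, Int.neg_ediv_of_dvd (dvd_refl M),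
        Int.ediv_self hM.ne']
      ring
    have e2 : i + M + (j / M - 1) * M = i + j / M * M := by ring
    rw [T_smul_T_smul, e, Int.sub_emod_right, sub_add_cancel, e2]
    exact hv
  have hind : iSupIndep V := by
    rw [iSupIndep_iff_finsetSum_eq_zero_imp_eq_zero]
    intro s v hv hsum
    by_contra! hne
    set s' := s.filter (fun p => v p ≠ 0) with hs'
    have hs'ne : s'.Nonempty := by
      obtain ⟨p, hp, hp0⟩ := hne
      exact ⟨p, by simp [hs', hp, hp0]⟩
    have hsum' : ∑ p ∈ s', v p = 0 := by rw [hs', Finset.sum_filter_ne_zero, hsum]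
    obtain ⟨p₀, hp₀, hmin⟩ := Finset.exists_min_image s' (fun p => toLex p) hs'ne
    have hmem : ∀ p ∈ s', v p ∈ B p.1 p.2 := fun p hp => hVB p (hv p (Finset.mem_filter.1 hp).1)
    have hlt : ∀ p ∈ s', p ≠ p₀ → p₀.1 < p.1 ∨ p₀.1 = p.1 ∧ p₀.2 < p.2 := by
      intro p hp hpp
      have := lt_of_le_of_ne (hmin p hp) (fun h => hpp (toLex_inj.1 h).symm)
      simpa [Prod.Lex.toLex_lt_toLex] using this
    have hp0 := (Finset.mem_filter.1 hp₀)
    refine hp0.2 (hVA p₀ _ (hv p₀ hp0.1) ?_)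
    set s1 := s'.filter (fun p => p.1 = p₀.1) with hs1
    set s2 := s'.filter (fun p => ¬ p.1 = p₀.1) with hs2
    have hsplit : ∑ p ∈ s1, v p + ∑ p ∈ s2, v p = 0 := by
      rw [hs1, hs2, Finset.sum_filter_add_sum_filter_not, hsum']
    have hp1 : p₀ ∈ s1 := by simp [hs1, hp₀]
    have h1 : ∑ p ∈ s1, v p ∈ Fge D'' p₀.2 := Submodule.sum_mem _ fun p hp => by
      obtain ⟨hp, hpe⟩ := Finset.mem_filter.1 hp
      refine Fge_anti ?_ (hmem p hp).2
      by_cases h : p = p₀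
      · rw [h]
      · have := hlt p hp h; omega
    have h2 : ∑ p ∈ s2, v p ∈ Fge D (p₀.1 + 1) := Submodule.sum_mem _ fun p hp => by
      obtain ⟨hp, hpe⟩ := Finset.mem_filter.1 hp
      refine Fge_anti ?_ (hmem p hp).1
      have := hlt p hp (fun h => hpe (by rw [h])); omega
    have h3 : ∑ p ∈ s2, v p ∈ B (p₀.1 + 1) p₀.2 :=
      ⟨h2, by rw [← neg_eq_of_add_eq_zero_right hsplit]; exact neg_mem h1⟩
    have h4 : ∑ p ∈ s1.erase p₀, v p ∈ B p₀.1 (p₀.2 + 1) := Submodule.sum_mem _ fun p hp => by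
      obtain ⟨hpne, hp⟩ := Finset.mem_erase.1 hp
      obtain ⟨hp, hpe⟩ := Finset.mem_filter.1 hp
      have := hlt p hp hpne
      exact hBanti (by omega) (by omega) (hmem p hp)
    have h5 : v p₀ = -(∑ p ∈ s2, v p + ∑ p ∈ s1.erase p₀, v p) := by
      rw [← Finset.add_sum_erase _ _ hp1] at hsplit
      rw [eq_neg_iff_add_eq_zero, ← hsplit]
      abel
    rw [h5]
    exact neg_mem (add_mem (Submodule.mem_sup_left h3) (Submodule.mem_sup_right h4))
  obtain ⟨K, hK⟩ := exists_bound hD hi hM.ne' hD'' hi''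
  let U : ℤ → ℤ → Submodule k L := fun i j => ⨆ p : {p : ℤ × ℤ // i ≤ p.1 ∧ j ≤ p.2}, V p
  have hU : ∀ n : ℕ, ∀ i j : ℤ, K < i + j + n → B i j ≤ U i j := by
    intro n
    induction n with
    | zero =>
      intro i j hij v hv
      rw [hK i j (by simpa using hij) v hv.1 hv.2]
      exact zero_mem _
    | succ n ih =>
      have hUm : ∀ {i j i' j' : ℤ}, i ≤ i' → j ≤ j' → U i' j' ≤ U i j := fun h h' =>
        iSup_le fun p => le_iSup_of_le
          (⟨p.1, h.trans p.2.1, h'.trans p.2.2⟩ : {p : ℤ × ℤ // _ ≤ p.1 ∧ _ ≤ p.2}) le_rfl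
      intro i j hij v hv
      obtain ⟨a, ha, c, hc, rfl⟩ := hVsup i j v hv
      refine add_mem ?_ ((le_iSup (fun p : {p : ℤ × ℤ // i ≤ p.1 ∧ j ≤ p.2} => V p.1)
        ⟨(i, j), le_rfl, le_rfl⟩) hc)
      have : A i j ≤ U i j := sup_le
        ((ih (i + 1) j (by push_cast at hij; omega)).trans (hUm (by omega) le_rfl))
        ((ih i (j + 1) (by push_cast at hij; omega)).trans (hUm le_rfl (by omega)))
      exact this ha
  have hBU : ∀ i j, B i j ≤ U i j := fun i j => hU (K + 1 - (i + j)).toNat i j (by omega)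
  have hdec : IsDec V := by
    refine ⟨hind, eq_top_iff.2 fun v _ => ?_⟩
    obtain ⟨i, h1⟩ := exists_mem_Fge hi v
    obtain ⟨j, h2⟩ := exists_mem_Fge hi'' v
    have := hBU i j ⟨h1, h2⟩
    exact (iSup_le fun p => le_iSup V p.1 : U i j ≤ ⨆ p, V p) this
  obtain ⟨θ, hθ⟩ := hdec.exists_glue (fun p => (p.1 : k) • LinearMap.id)
  have hθ' : ∀ i j v, v ∈ V (i, j) → θ v = (i : k) • v := fun i j v hv => hθ (i, j) v hv
  refine ⟨θ, ?_, ?_, ?_⟩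
  · have : θ ∘ₗ tsm k L 1 = tsm k L 1 ∘ₗ θ + (M : k) • tsm k L 1 :=
      ext_of_iSup hdec.2 fun p v hv => by
        obtain ⟨i, j⟩ := p
        simp only [LinearMap.comp_apply, LinearMap.add_apply, LinearMap.smul_apply, tsm_apply]
        rw [hθ' _ _ _ (hVT i j v hv), hθ' i j v hv, T_smul_comm]
        push_cast
        module
    exact fun x => LinearMap.congr_fun this x
  · intro i v hv
    obtain ⟨j, h2⟩ := exists_mem_Fge hi'' v
    refine map_mem_of_iSup (f := θ - (i : k) • LinearMap.id) (fun p w hw => ?_)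
      (hBU i j ⟨hv, h2⟩)
    obtain ⟨⟨i', j'⟩, h⟩ := p
    simp only [LinearMap.sub_apply, LinearMap.smul_apply, LinearMap.id_apply]
    rw [hθ' i' j' w hw, ← sub_smul]
    by_cases he : i' = i
    · rw [he, sub_self, zero_smul]; exact zero_mem _
    · have : i ≤ i' := h.1
      exact Submodule.smul_mem _ _ (Fge_anti (show i + 1 ≤ i' by omega) (hVB _ hw).1)
  · intro j v hv
    obtain ⟨i, h2⟩ := exists_mem_Fge hi v
    refine map_mem_of_iSup (f := θ) (fun p w hw => ?_) (hBU i j ⟨h2, hv⟩)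
    obtain ⟨⟨i', j'⟩, h⟩ := p
    rw [hθ' i' j' w hw]
    exact Submodule.smul_mem _ _ (Fge_anti h.2 (hVB _ hw).2)

end Splitting

section Conjugacy

variable {k L : Type*} [Field k] [CharZero k] [LieRing L] [LieAlgebra k[T;T⁻¹] L] [LieAlgebra k L]
  [IsScalarTower k k[T;T⁻¹] L] [Module.Finite k[T;T⁻¹] L]

/-- An algebraic Birkhoff factorisation for opposite gradings of a twisted loop algebra. -/
theorem exists_birkhoff (hκ : Function.Bijective (killingForm k[T;T⁻¹] L))
    {D D'' : Module.End k L} {M : ℤ} (hM : 0 < M) (hD : TwDer (M : k) D) (hi : IntDiag D)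
    (hD'' : TwDer (-(M : k)) D'') (hi'' : IntDiag D'') :
    ∃ E : Module.End k L, TwDer (M : k) E ∧ IntDiag E ∧
      (∀ i, ∀ v ∈ Fge D i, E v - (i : k) • v ∈ Fge D (i + 1)) ∧
      ∀ j, ∀ v ∈ Fge D'' j, E v ∈ Fge D'' j := by
  obtain ⟨θ, hθ, hθD, hθD''⟩ := exists_splitting hM hD.twLin hi hD''.twLin hi''
  have h0 : TwLin (0 : k) (θ - D) := by
    have := hθ.add hD.twLin.neg
    rwa [add_neg_cancel, ← sub_eq_add_neg] at this
  have h1 : TwDer (0 : k) (D + D'') := by simpa using hD.add hD''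
  have h2 : TwLin (0 : k) ((D + D'') + (θ - D)) := by simpa using h1.twLin.add h0
  obtain ⟨p, hp⟩ := exists_kRep hκ.2 _ h0
  obtain ⟨q, hq⟩ := exists_kRep hκ.2 _ h1.twLin
  have hpF : p ∈ Fge D 1 := hp.mem_Fge hκ.1 hD hi hM.ne' 1 fun i v hv => by
    have := sub_mem (hθD i v hv) (sub_smul_Fge D hv)
    simpa using this
  have hqG : q + p ∈ Fge D'' 0 := by
    refine (hq.add hp h2).mem_Fge (M := -M) hκ.1 (by push_cast; exact hD'') hi'' (by omega) 0
      fun i v hv => ?_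
    have := add_mem (hθD'' i v hv) (self_Fge D'' hv)
    rw [add_zero]
    convert this using 1
    simp only [LinearMap.add_apply, LinearMap.sub_apply]
    abel
  have hE : TwDer (M : k) (D + LieAlgebra.ad k L p) := by simpa using hD.add (twDer_ad p)
  have hgr : ∀ i, ∀ v ∈ Fge D i,
      (D + LieAlgebra.ad k L p) v - (i : k) • v ∈ Fge D (i + 1) := fun i v hv => by
    have := add_mem (sub_smul_Fge D hv) (Fge_anti (by omega : i + 1 ≤ 1 + i) (hD.lie_Fge hpF hv))
    convert this using 1
    simp only [LinearMap.add_apply, LieAlgebra.ad_apply]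
    abel
  have hG : ∀ j, ∀ v ∈ Fge D'' j, (D + LieAlgebra.ad k L p) v ∈ Fge D'' j := fun j v hv => by
    have h3 := hD''.lie_Fge hqG hv
    rw [zero_add] at h3
    have := sub_mem h3 (self_Fge D'' hv)
    convert this using 1
    have h4 := h1.eq_lie hκ.1 hq v
    simp only [LinearMap.add_apply, LieAlgebra.ad_apply, add_lie] at h4 ⊢
    rw [← h4]
    abel
  refine ⟨_, hE, ?_, hgr, hG⟩
  obtain ⟨K, hK⟩ := exists_bound hD.twLin hi hM.ne' hD''.twLin hi''
  refine intDiag_of_gr hi hgr (Fge D'') (eq_top_iff.2 fun v _ => ?_) hG fun j =>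
    ⟨K - j + 1, fun v hv hv' => hK _ j (by omega) v hv' hv⟩
  obtain ⟨j, hj⟩ := exists_mem_Fge hi'' v
  exact le_iSup (Fge D'') j hj

theorem IntDiag.conj {D E : Module.End k L} (hi : IntDiag D) (g : L ≃ₗ⁅k[T;T⁻¹]⁆ L)
    (h : ∀ x, g (D x) = E (g x)) : IntDiag E := by
  let gk : L →ₗ[k] L := (g.toLieHom : L →ₗ[k[T;T⁻¹]] L).restrictScalars k
  refine eq_top_iff.2 fun v _ => ?_
  have := map_mem_of_iSup (f := gk) (S := ⨆ i : ℤ, zEig E i) (fun i w hw =>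
    le_iSup (fun i : ℤ => zEig E i) i (mem_zEig.2 (by
      change E (g w) = _
      rw [← h, mem_zEig.1 hw]
      exact gk.map_smul _ _))) (hi ▸ Submodule.mem_top : g.symm v ∈ ⨆ i : ℤ, zEig D i)
  change g (g.symm v) ∈ _ at this
  rwa [LieEquiv.apply_symm_apply] at this

theorem IntDiag.smul {D : Module.End k L} (hi : IntDiag D) (n : ℤ) : IntDiag ((n : k) • D) := by
  refine eq_top_iff.2 (hi ▸ iSup_le fun i v hv => ?_)
  refine le_iSup (fun i : ℤ => zEig ((n : k) • D) i) (n * i) (mem_zEig.2 ?_)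
  rw [LinearMap.smul_apply, mem_zEig.1 hv, smul_smul]
  push_cast
  rfl

theorem exists_commuting_conj_aux (hκ : Function.Bijective (killingForm k[T;T⁻¹] L))
    {D D'' : Module.End k L} {M : ℤ} (hM : 0 < M) (hD : TwDer (M : k) D) (hi : IntDiag D)
    (hD'' : TwDer (-(M : k)) D'') (hi'' : IntDiag D'') :
    ∃ (g g' : L ≃ₗ⁅k[T;T⁻¹]⁆ L) (E E' : Module.End k L), (∀ x, g (D x) = E (g x)) ∧
      (∀ x, g' (D'' x) = E' (g' x)) ∧ ∀ x, E (E' x) = E' (E x) := by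
  obtain ⟨E, hE, hiE, hgr, hG⟩ := exists_birkhoff hκ hM hD hi hD'' hi''
  obtain ⟨g, hg⟩ := exists_gr_equiv hD hi hE hiE hgr
  obtain ⟨E', hE', hcomm, hgr'⟩ := exists_zero_component hE hiE hG hD''
  obtain ⟨K, hK⟩ := exists_bound hD.twLin hi hM.ne' hD''.twLin hi''
  have hiE' : IntDiag E' := by
    refine intDiag_of_gr hi'' hgr' (zEig E) hiE (fun l v hv => ?_) fun l => ⟨K - l + 1, ?_⟩
    · rw [mem_zEig] at *
      rw [← hcomm, hv, map_smul]
    · intro v hv hv'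
      have := Fge_eq_of_gr hi hiE hgr l ▸ zEig_le_Fge le_rfl hv
      exact hK l _ (by omega) v this hv'
  obtain ⟨g', hg'⟩ := exists_gr_equiv (M := -M) (by push_cast; exact hD'') hi''
    (by push_cast; exact hE') hiE' hgr'
  exact ⟨g, g', E, E', hg, hg', fun x => (hcomm x).symm⟩

/-- Any two gradings compatible with the grading of Laurent polynomials become commuting after
conjugation by automorphisms. -/
theorem exists_commuting_conj (hκ : Function.Bijective (killingForm k[T;T⁻¹] L))
    {D D' : Module.End k L} {M M' : ℤ} (hM : 0 < M) (hM' : 0 < M') (hD : TwDer (M : k) D)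
    (hi : IntDiag D) (hD' : TwDer (M' : k) D') (hi' : IntDiag D') :
    ∃ (g g' : L ≃ₗ⁅k[T;T⁻¹]⁆ L) (E E' : Module.End k L), (∀ x, g (D x) = E (g x)) ∧
      (∀ x, g' (D' x) = E' (g' x)) ∧ ∀ x, E (E' x) = E' (E x) := by
  have h1 : TwDer ((M' * M : ℤ) : k) ((M' : k) • D) := by push_cast; exact hD.smul _
  have h2 : TwDer (-((M' * M : ℤ) : k)) (((-M : ℤ) : k) • D') := by
    have := hD'.smul ((-M : ℤ) : k)
    convert this using 1
    push_cast
    ring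
  obtain ⟨g, g', E, E', hg, hg', hc⟩ := exists_commuting_conj_aux hκ (by positivity) h1
    (hi.smul M') h2 (hi'.smul (-M))
  have hs : ∀ (g : L ≃ₗ⁅k[T;T⁻¹]⁆ L) (a : k) x, g (a • x) = a • g x := fun g a x => by
    rw [← C_smul_eq, ← C_smul_eq]; exact g.toLieHom.map_smul _ _
  have hM0 : ((-M : ℤ) : k) ≠ 0 := by norm_cast; omega
  have hM0' : (M' : k) ≠ 0 := by norm_cast; omega
  refine ⟨g, g', (M' : k)⁻¹ • E, ((-M : ℤ) : k)⁻¹ • E', fun x => ?_, fun x => ?_, fun x => ?_⟩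
  · rw [LinearMap.smul_apply, ← hg, LinearMap.smul_apply, hs, smul_smul, inv_mul_cancel₀ hM0',
      one_smul]
  · rw [LinearMap.smul_apply, ← hg', LinearMap.smul_apply, hs, smul_smul, inv_mul_cancel₀ hM0,
      one_smul]
  · simp only [LinearMap.smul_apply, map_smul, hc]
    rw [smul_comm]

theorem TwLin.zPr_zero {x : Module.End k L} (hx : TwLin (0 : k) x) (hi : IntDiag x) (i : ℤ) :
    TwLin (0 : k) (zPr x i) := fun y => by
  have := zPr_comm hi hi (g := tsm k L 1) (s := 0) (fun i v hv => by
    simpa using TwLin.zEig (M := 0) (by simpa using hx) hv 1) i y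
  simpa using this

theorem exists_zPr_support {x : Module.End k L} (hx : TwLin (0 : k) x) (hi : IntDiag x) :
    ∃ S : Finset ℤ, ∀ i ∉ S, ∀ v, zPr x i v = 0 := by
  classical
  obtain ⟨G, hG⟩ := Module.Finite.fg_top (R := k[T;T⁻¹]) (M := L)
  choose s hs _ using exists_sum_decProj hi.isDec
  refine ⟨G.biUnion s, fun i hiS v => ?_⟩
  have hv : v ∈ Submodule.span k[T;T⁻¹] (G : Set L) := hG ▸ Submodule.mem_top
  have hT := hx.zPr_zero hi i
  induction hv using Submodule.span_induction with
  | mem w hw => exact hs w i fun h => hiS (Finset.mem_biUnion.2 ⟨w, hw, h⟩)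
  | zero => simp
  | add u w _ _ hu hw => rw [map_add, hu, hw, add_zero]
  | smul r u _ hu =>
    have := hT.toLin.map_smul r u
    rw [TwLin.toLin_apply, TwLin.toLin_apply, hu, smul_zero] at this
    exact this

theorem exists_cmp_zPr {x D : Module.End k L} {M : ℤ} (hM : M ≠ 0) (hx : TwLin (0 : k) x)
    (hi : IntDiag x) (hD : TwLin (M : k) D) (hiD : IntDiag D) :
    ∃ K : ℤ, ∀ K' ≥ K, ∀ i r, ∀ v ∈ Fge D r, zPr x i v ∈ Fge D (r - K') := by
  classical
  obtain ⟨S, hS⟩ := exists_zPr_support hx hi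
  choose c hc using fun i => exists_cmp hD hiD hM hD hiD (zPr x i) (hx.zPr_zero hi i)
  obtain ⟨K, hK⟩ := (S.image c).bddAbove
  refine ⟨K, fun K' hK' i r v hv => ?_⟩
  by_cases hiS : i ∈ S
  · have : c i ≤ K := hK (by simpa using ⟨i, hiS, rfl⟩)
    exact Fge_anti (by omega) (hc i r v hv)
  · rw [hS i hiS v]; exact zero_mem _

/-- The automorphism scaling the `i`-th eigenspace of a derivation by `T (i * N)`. -/
theorem exists_scaling {x : Module.End k L} (hx : TwDer (0 : k) x) (hi : IntDiag x) (N : ℤ) :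
    ∃ g : L ≃ₗ⁅k[T;T⁻¹]⁆ L, ∀ i, ∀ v ∈ zEig x i, g v = (T (i * N) : k[T;T⁻¹]) • v ∧
      g.symm v = (T (-(i * N)) : k[T;T⁻¹]) • v := by
  have hT : ∀ {i : ℤ} {v : L} (_ : v ∈ zEig x i) (n : ℤ), (T n : k[T;T⁻¹]) • v ∈ zEig x i :=
    fun hv n => by simpa using TwLin.zEig (M := 0) (by simpa using hx.twLin) hv n
  obtain ⟨g, hg⟩ := hi.isDec.exists_glue (fun i => tsm k L (i * N))
  obtain ⟨h, hh⟩ := hi.isDec.exists_glue (fun i => tsm k L (-(i * N)))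
  simp only [tsm_apply] at hg hh
  have hgT : TwLin (0 : k) g := by
    have : g ∘ₗ tsm k L 1 = tsm k L 1 ∘ₗ g := ext_of_iSup hi fun i v hv => by
      simp only [LinearMap.comp_apply, tsm_apply]
      rw [hg i v hv, hg i _ (hT hv 1), T_smul_T_smul, T_smul_T_smul, add_comm]
    intro y
    simpa using LinearMap.congr_fun this y
  have hgh : g ∘ₗ h = LinearMap.id := ext_of_iSup hi fun i v hv => by
    rw [LinearMap.comp_apply, hh i v hv, hg i _ (hT hv _), T_smul_T_smul, add_neg_cancel,
      T_zero_smul, LinearMap.id_apply]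
  have hhg : h ∘ₗ g = LinearMap.id := ext_of_iSup hi fun i v hv => by
    rw [LinearMap.comp_apply, hg i v hv, hh i _ (hT hv _), T_smul_T_smul, neg_add_cancel,
      T_zero_smul, LinearMap.id_apply]
  obtain ⟨φ, hφ⟩ := exists_lieEquiv hgT (map_lie_of_iSup hi fun i j v hv w hw => by
    rw [hg i v hv, hg j w hw, hg _ _ (hx.lie_zEig hv hw), smul_lie, lie_smul, T_smul_T_smul,
      add_mul]) (LinearMap.congr_fun hgh) (LinearMap.congr_fun hhg)
  refine ⟨φ, fun i v hv => ⟨by rw [hφ, hg i v hv], ?_⟩⟩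
  rw [← hh i v hv]
  apply φ.injective
  change φ (φ.symm v) = φ (h v)
  rw [LieEquiv.apply_symm_apply, hφ]
  exact (LinearMap.congr_fun hgh v).symm

end Conjugacy

end

section

section Descent

variable {k L : Type*} [Field k] [CharZero k] [LieRing L] [LieAlgebra k[T;T⁻¹] L] [LieAlgebra k L]
  [IsScalarTower k k[T;T⁻¹] L] [Module.Finite k[T;T⁻¹] L]

theorem exists_filtered (hκ : Function.Bijective (killingForm k[T;T⁻¹] L))
    {x D : Module.End k L} {M : ℤ} (hM : 0 < M) (hx : TwDer (0 : k) x) (hix : IntDiag x)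
    (hD : TwDer (M : k) D) (hi : IntDiag D) :
    ∃ E : Module.End k L, TwDer (M : k) E ∧ IntDiag E ∧ ∀ i, ∀ v ∈ Fge x i, E v ∈ Fge x i := by
  have hDn : TwDer ((-M : ℤ) : k) (-D) := by push_cast; exact hD.neg
  obtain ⟨K₁, hK₁⟩ := exists_cmp_zPr hM.ne' hx.twLin hix hD.twLin hi
  obtain ⟨K₂, hK₂⟩ := exists_cmp_zPr (neg_ne_zero.2 hM.ne') hx.twLin hix hDn.twLin hi.neg
  obtain ⟨C, hC0, hC1, hC2⟩ : ∃ C : ℤ, 0 ≤ C ∧ K₁ ≤ C ∧ K₂ ≤ C :=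
    ⟨|K₁| + |K₂|, by positivity, by have := le_abs_self K₁; have := abs_nonneg K₂; omega,
      by have := le_abs_self K₂; have := abs_nonneg K₁; omega⟩
  set N : ℤ := 4 * C + 1 with hN
  obtain ⟨g, hg⟩ := exists_scaling hx hix N
  let gk : L →ₗ[k] L := (g.toLieHom : L →ₗ[k[T;T⁻¹]] L).restrictScalars k
  let gs : L →ₗ[k] L := (g.symm.toLieHom : L →ₗ[k[T;T⁻¹]] L).restrictScalars k
  have hgk : ∀ y, gk y = g y := fun _ => rfl
  have hgs : ∀ y, gs y = g.symm y := fun _ => rfl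
  let D' : Module.End k L := gk ∘ₗ D ∘ₗ gs
  have hD'g : ∀ y, g (D y) = D' (g y) := fun y => by
    change g (D y) = g (D (g.symm (g y)))
    rw [LieEquiv.symm_apply_apply]
  have hD'gs : ∀ y, gs (D' y) = D (gs y) := fun y => g.symm_apply_apply _
  have hD' : TwDer (M : k) D' := hD.conj g fun y => (hD'g y).symm
  have hD'n : TwDer ((-M : ℤ) : k) (-D') := by push_cast; exact hD'.neg
  have hi' : IntDiag D' := hi.conj g hD'g
  obtain ⟨E, hE, hiE, hgr, hG⟩ := exists_birkhoff hκ hM hD hi hD'.neg hi'.neg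
  have hgF : ∀ {r v}, v ∈ Fge (-D) r → gk v ∈ Fge (-D') r := fun hv =>
    map_Fge (f := gk) (fun l hl w hw => zEig_le_Fge hl (by
      rw [mem_zEig, LinearMap.neg_apply] at *
      rw [hgk, ← hD'g, ← hgk, ← hgk, ← map_neg, hw, map_smul])) hv
  have hgsF : ∀ {r v}, v ∈ Fge (-D') r → gs v ∈ Fge (-D) r := fun hv =>
    map_Fge (f := gs) (fun l hl w hw => zEig_le_Fge hl (by
      rw [mem_zEig, LinearMap.neg_apply] at *
      rw [← hD'gs, ← map_neg, hw, map_smul])) hv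
  have hvan : ∀ i j, j < i → ∀ v ∈ zEig x i, zPr x j (E v) = 0 := by
    intro i j hij
    have key : zPr x j ∘ₗ E ∘ₗ zPr x i = 0 := ext_of_iSup hi fun r w hw => by
      simp only [LinearMap.comp_apply, LinearMap.zero_apply]
      have hv := decProj_mem hix.isDec i w
      have h1 : zPr x j (E (zPr x i w)) ∈ Fge D (r - C - C) :=
        hK₁ C hC1 _ _ _ (Fge_stable_of_gr hgr (hK₁ C hC1 _ _ _ (zEig_le_Fge le_rfl hw)))
      have h2 : zPr x i w ∈ Fge (-D) (-r - C) :=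
        hK₂ C hC2 _ _ _ (zEig_le_Fge le_rfl (by rwa [zEig_neg, neg_neg]))
      have h3 := hD'n.twLin.Fge (hgF h2) (-(i * N))
      rw [hgk, (hg i _ hv).1, T_smul_T_smul, neg_add_cancel, T_zero_smul] at h3
      have h4 := hgsF (hG _ _ h3)
      have h5 := hDn.twLin.Fge (hK₂ C hC2 j _ _ h4) (j * N)
      have h6 : ∀ y, zPr x j (gs y) = (T (-(j * N)) : k[T;T⁻¹]) • zPr x j y := fun y => by
        have := zPr_comm hix hix (g := gs) (s := 0) (fun l u hu => by
          rw [hgs, (hg l u hu).2, add_zero]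
          simpa using TwLin.zEig (M := 0) (by simpa using hx.twLin) hu (-(l * N))) j y
        rw [add_zero] at this
        rw [this, hgs, (hg j _ (decProj_mem hix.isDec j y)).2]
      rw [h6, T_smul_T_smul, add_neg_cancel, T_zero_smul] at h5
      refine Fge_inf_neg hi ?_ h1 h5
      have : 1 * (N * M) ≤ (i - j) * (N * M) :=
        mul_le_mul_of_nonneg_right (by omega) (by positivity)
      have h7 : N * 1 ≤ N * M := mul_le_mul_of_nonneg_left (by omega) (by omega)
      have h8 : (r - C - C) + (-r - C + -(i * N) * -M - C + j * N * -M) =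
        -4 * C + (i - j) * (N * M) := by ring
      rw [h8]
      omega
    intro v hv
    have := LinearMap.congr_fun key v
    rw [LinearMap.comp_apply, LinearMap.comp_apply, decProj_same hix.isDec hv] at this
    exact this
  refine ⟨E, hE, hiE, fun i v hv => map_Fge (f := E) (fun l hl w hw => ?_) hv⟩
  exact (mem_Fge_iff hix).2 fun j hj => hvan l j (by omega) w hw

/-- A diagonalizable derivation linear over Laurent polynomials commutes with a grading. -/
theorem exists_commuting_grading (hκ : Function.Bijective (killingForm k[T;T⁻¹] L))
    {x D : Module.End k L} {M : ℤ} (hM : 0 < M) (hx : TwDer (0 : k) x) (hix : IntDiag x)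
    (hD : TwDer (M : k) D) (hi : IntDiag D) :
    ∃ E : Module.End k L, TwDer (M : k) E ∧ IntDiag E ∧ ∀ y, E (x y) = x (E y) := by
  obtain ⟨E, hE, hiE, hF⟩ := exists_filtered hκ hM hx hix hD hi
  obtain ⟨x₁, hx₁, hc, hgr⟩ := exists_zero_component hE hiE hF hx
  obtain ⟨S, hS⟩ := exists_zPr_support hx.twLin hix
  obtain ⟨K, hK⟩ := S.bddAbove
  have hi₁ : IntDiag x₁ := intDiag_of_gr hix hgr (fun _ : Unit => ⊤) (by simp)
    (fun _ _ _ => Submodule.mem_top) fun _ => ⟨K + 1, fun v _ hv =>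
      eq_zero_of_decProj hix.isDec fun j => by
        by_cases hj : j < K + 1
        · exact zPr_eq_zero hix hj hv
        · exact hS j (fun h => by have := hK h; omega) v⟩
  obtain ⟨g, hg⟩ := exists_gr_equiv (M := 0) (by simpa using hx) hix (by simpa using hx₁) hi₁ hgr
  let gk : L →ₗ[k] L := (g.toLieHom : L →ₗ[k[T;T⁻¹]] L).restrictScalars k
  let gs : L →ₗ[k] L := (g.symm.toLieHom : L →ₗ[k[T;T⁻¹]] L).restrictScalars k
  let E' : Module.End k L := gs ∘ₗ E ∘ₗ gk
  have hE' : ∀ y, E' (g.symm y) = g.symm (E y) := fun y => by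
    change g.symm (E (g (g.symm y))) = _
    rw [LieEquiv.apply_symm_apply]
  refine ⟨E', hE.conj g.symm hE', hiE.conj g.symm fun y => (hE' y).symm, fun y => ?_⟩
  apply g.injective
  change g (g.symm (E (g (x y)))) = g (x (g.symm (E (g y))))
  rw [hg, hg, LieEquiv.apply_symm_apply, LieEquiv.apply_symm_apply, hc]

end Descent

end

section

section DiagonalizableSubalgebras

variable {k M : Type} [Field k] [LieRing M] [LieAlgebra k M]

/-- The adjoint action of `z` is diagonalizable. -/
def AdDiag (k : Type) {M : Type} [Field k] [LieRing M] [LieAlgebra k M] (z : M) : Prop :=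
  ⨆ a : k, (LieAlgebra.ad k M z).eigenspace a = ⊤

theorem mem_adWeightSpace {𝔪 : LieSubalgebra k M} {α : Module.Dual k 𝔪} {v : M} :
    v ∈ adWeightSpace 𝔪 α ↔ ∀ z : 𝔪, ⁅(z : M), v⁆ = α z • v := by
  simp [adWeightSpace, Submodule.mem_iInf, sub_eq_zero]

theorem isDiagonalizableSubalgebra_of_span {𝔪 : LieSubalgebra k M}
    (h : Submodule.span k {v : M | ∀ z ∈ 𝔪, ∃ a : k, ⁅z, v⁆ = a • v} = ⊤) :
    IsDiagonalizableSubalgebra 𝔪 := by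
  refine eq_top_iff.2 (h ▸ Submodule.span_le.2 fun v hv => ?_)
  by_cases hv0 : v = 0
  · rw [hv0]; exact zero_mem _
  choose a ha using fun z : 𝔪 => hv z z.2
  have hinj : ∀ {s t : k}, s • v = t • v → s = t := fun h => smul_left_injective k hv0 h
  refine Submodule.mem_iSup_of_mem
    { toFun := a
      map_add' := fun x y => hinj (by
        rw [add_smul, ← ha, ← ha, ← ha, ← add_lie]; rfl)
      map_smul' := fun t x => hinj (by
        rw [RingHom.id_apply, smul_eq_mul, mul_smul, ← ha, ← ha, ← smul_lie]; rfl) }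
    (mem_adWeightSpace.2 ha)

variable {𝔪 𝔪' : LieSubalgebra k M}

theorem IsDiagonalizableSubalgebra.adDiag (h : IsDiagonalizableSubalgebra 𝔪) {z : M}
    (hz : z ∈ 𝔪) : AdDiag k z := by
  refine eq_top_iff.2 (h ▸ iSup_le fun α v hv => ?_)
  refine Submodule.mem_iSup_of_mem (α ⟨z, hz⟩) (Module.End.mem_eigenspace_iff.2 ?_)
  exact mem_adWeightSpace.1 hv ⟨z, hz⟩

theorem AdDiag.isDec {z : M} (hz : AdDiag k z) :
    IsDec (fun a : k => (LieAlgebra.ad k M z).eigenspace a) :=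
  ⟨Module.End.eigenspaces_iSupIndep _, hz⟩

theorem AdDiag.lie_decProj {z w : M} (hz : AdDiag k z) (hzw : ⁅z, w⁆ = 0) (a : k) (v : M) :
    decProj (fun a : k => (LieAlgebra.ad k M z).eigenspace a) a ⁅w, v⁆ =
      ⁅w, decProj (fun a : k => (LieAlgebra.ad k M z).eigenspace a) a v⁆ :=
  decProj_map hz.isDec hz.isDec (LieAlgebra.ad k M w) id Function.injective_id (fun b u hu => by
    rw [Module.End.mem_eigenspace_iff, LieAlgebra.ad_apply] at *
    rw [id, LieAlgebra.ad_apply, leibniz_lie, hzw, zero_lie, zero_add, hu, lie_smul]) a v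

theorem AdDiag.lie_eq_zero {z w : M} (hz : AdDiag k z) (h : ⁅z, ⁅z, w⁆⁆ = 0) : ⁅z, w⁆ = 0 := by
  refine eq_zero_of_decProj hz.isDec fun a => ?_
  have h1 := decProj_mem hz.isDec a w
  rw [Module.End.mem_eigenspace_iff, LieAlgebra.ad_apply] at h1
  have h2 := hz.lie_decProj (lie_self z) a ⁅z, w⁆
  rw [h, map_zero, hz.lie_decProj (lie_self z), h1, lie_smul, h1] at h2
  rw [hz.lie_decProj (lie_self z), h1]
  rcases smul_eq_zero.1 h2.symm with h3 | h3
  · rw [h3, zero_smul]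
  · exact h3

theorem IsDiagonalizableSubalgebra.lie_eq_zero (h : IsDiagonalizableSubalgebra 𝔪) {z w : M}
    (hz : z ∈ 𝔪) (hw : w ∈ 𝔪) : ⁅z, w⁆ = 0 := by
  have hcen : LieAlgebra.ad k M ⁅z, w⁆ = 0 := ext_of_iSup h fun α v hv => by
    have h1 := mem_adWeightSpace.1 hv ⟨z, hz⟩
    have h2 := mem_adWeightSpace.1 hv ⟨w, hw⟩
    dsimp only at h1 h2
    rw [LieAlgebra.ad_apply, lie_lie, h1, h2, lie_smul, lie_smul, h1, h2, smul_comm, sub_self,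
      LinearMap.zero_apply]
  refine (h.adDiag hz).lie_eq_zero ?_
  rw [← lie_skew, ← LieAlgebra.ad_apply k, hcen, LinearMap.zero_apply, neg_zero]

/-- A subspace on which the bracket vanishes, as a subalgebra. -/
def LieSubalgebra.ofAbelian (S : Submodule k M) (hS : ∀ x ∈ S, ∀ y ∈ S, ⁅x, y⁆ = 0) :
    LieSubalgebra k M :=
  { S with
    lie_mem' := fun {x y} hx hy => by
      rw [hS x hx y hy]; exact S.zero_mem }

theorem IsMAD.mem_of_commute (h : IsMAD 𝔪) {e : M} (he : AdDiag k e)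
    (hc : ∀ z ∈ 𝔪, ⁅z, e⁆ = 0) : e ∈ 𝔪 := by
  have hc' : ∀ z ∈ 𝔪, ⁅e, z⁆ = 0 := fun z hz => by rw [← lie_skew, hc z hz, neg_zero]
  let S : Submodule k M := 𝔪.toSubmodule ⊔ k ∙ e
  have hmem : ∀ x ∈ S, ∃ z ∈ 𝔪, ∃ t : k, x = z + t • e := fun x hx => by
    obtain ⟨z, hz, y, hy, rfl⟩ := Submodule.mem_sup.1 hx
    obtain ⟨t, rfl⟩ := Submodule.mem_span_singleton.1 hy
    exact ⟨z, hz, t, rfl⟩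
  have hS : ∀ x ∈ S, ∀ y ∈ S, ⁅x, y⁆ = 0 := by
    intro x hx y hy
    obtain ⟨z, hz, t, rfl⟩ := hmem x hx
    obtain ⟨w, hw, s, rfl⟩ := hmem y hy
    simp [h.1.lie_eq_zero hz hw, hc z hz, hc' w hw]
  have hd : IsDiagonalizableSubalgebra (LieSubalgebra.ofAbelian S hS) := by
    refine isDiagonalizableSubalgebra_of_span (eq_top_iff.2 (h.1 ▸ iSup_le fun α v hv => ?_))
    obtain ⟨s, -, hs⟩ := exists_sum_decProj he.isDec v
    rw [hs]
    refine Submodule.sum_mem _ fun a _ => Submodule.subset_span fun x hx => ?_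
    obtain ⟨z, hz, t, rfl⟩ := hmem x hx
    have h1 := decProj_mem he.isDec a v
    rw [Module.End.mem_eigenspace_iff, LieAlgebra.ad_apply] at h1
    have h2 := mem_adWeightSpace.1 hv ⟨z, hz⟩
    dsimp only at h2
    refine ⟨α ⟨z, hz⟩ + t * a, ?_⟩
    rw [add_lie, smul_lie, ← he.lie_decProj (hc' z hz), h2, h1, map_smul, smul_smul, add_smul]
  have := h.2 _ hd fun z hz => Submodule.mem_sup_left hz
  rw [← this]
  exact Submodule.mem_sup_right (Submodule.mem_span_singleton_self e)

theorem IsDiagonalizableSubalgebra.map (h : IsDiagonalizableSubalgebra 𝔪) (φ : M ≃ₗ⁅k⁆ M) :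
    IsDiagonalizableSubalgebra (𝔪.map φ.toLieHom) := by
  refine isDiagonalizableSubalgebra_of_span (eq_top_iff.2 fun v _ => ?_)
  have := map_mem_of_iSup (f := (φ.toLieHom : M →ₗ[k] M)) (S := Submodule.span k
    {v : M | ∀ z ∈ 𝔪.map φ.toLieHom, ∃ a : k, ⁅z, v⁆ = a • v}) (fun α w hw =>
      Submodule.subset_span (by
        rintro _ ⟨z, hz, rfl⟩
        refine ⟨α ⟨z, hz⟩, ?_⟩
        have h1 := mem_adWeightSpace.1 hw ⟨z, hz⟩
        change ⁅φ.toLieHom z, φ.toLieHom w⁆ = _ • φ.toLieHom w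
        rw [← LieHom.map_lie]
        exact (congrArg φ.toLieHom h1).trans (φ.toLieHom.map_smul _ _))) (h ▸ Submodule.mem_top : φ.symm v ∈ ⨆ α, adWeightSpace 𝔪 α)
  change φ (φ.symm v) ∈ _ at this
  rwa [LieEquiv.apply_symm_apply] at this

theorem IsMAD.map (h : IsMAD 𝔪) (φ : M ≃ₗ⁅k⁆ M) : IsMAD (𝔪.map φ.toLieHom) := by
  refine ⟨h.1.map φ, fun 𝔫 h𝔫 hle => le_antisymm (fun x hx => ?_) hle⟩
  have h1 := h.2 _ (h𝔫.map φ.symm) fun z hz =>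
    ⟨φ z, hle ⟨z, hz, rfl⟩, φ.symm_apply_apply z⟩
  exact ⟨φ.symm x, h1 ▸ ⟨x, hx, rfl⟩, φ.apply_symm_apply x⟩

/-- An element of a subalgebra with the smallest possible centralizer. -/
def IsRegularIn (𝔪 : LieSubalgebra k M) (z : M) : Prop :=
  z ∈ 𝔪 ∧ ∀ v : M, ⁅z, v⁆ = 0 → ∀ y ∈ 𝔪, ⁅y, v⁆ = 0

theorem IsRegularIn.map {z : M} (h : IsRegularIn 𝔪 z) (φ : M ≃ₗ⁅k⁆ M) :
    IsRegularIn (𝔪.map φ.toLieHom) (φ z) := by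
  refine ⟨⟨z, h.1, rfl⟩, ?_⟩
  rintro v hv _ ⟨y, hy, rfl⟩
  change ⁅φ y, v⁆ = 0
  rw [← φ.apply_symm_apply v, ← LieEquiv.map_lie] at *
  rw [h.2 _ (φ.injective (hv.trans (φ.toLieHom.map_zero).symm)) y hy]
  exact φ.toLieHom.map_zero

theorem IsMAD.eq_of_regular (h : IsMAD 𝔪) (h' : IsMAD 𝔪') {z z' : M} (hz : IsRegularIn 𝔪 z)
    (hz' : IsRegularIn 𝔪' z') (hc : ⁅z, z'⁆ = 0) : 𝔪 = 𝔪' := by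
  have h1 : z' ∈ 𝔪 := h.mem_of_commute (h'.1.adDiag hz'.1) (hz.2 _ hc)
  refine (h.2 _ h'.1 fun y hy => h'.mem_of_commute (h.1.adDiag hy) ?_).symm
  exact hz'.2 y (h.1.lie_eq_zero h1 hy)

end DiagonalizableSubalgebras

end

section

section ConstantTermForm

variable (k L : Type) [Field k] [LieRing L] [LieAlgebra k[T;T⁻¹] L] [LieAlgebra k L]
  [IsScalarTower k k[T;T⁻¹] L]

/-- The constant term of the Killing form over Laurent polynomials. -/
def ctKilling : L →ₗ[k] L →ₗ[k] k :=
  LinearMap.mk₂ k (fun x y => ct (killingForm k[T;T⁻¹] L x y))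
    (fun x y z => by simp) (fun a x y => by
      rw [← C_smul_eq, map_smul, LinearMap.smul_apply, smul_eq_mul, ← LaurentPolynomial.smul_eq_C_mul,
        map_smul])
    (fun x y z => by simp) (fun a x y => by
      rw [← C_smul_eq, map_smul, smul_eq_mul, ← LaurentPolynomial.smul_eq_C_mul, map_smul])

variable {k L}

theorem ctKilling_apply (x y : L) : ctKilling k L x y = ct (killingForm k[T;T⁻¹] L x y) := rfl

theorem ctKilling_comm (x y : L) : ctKilling k L x y = ctKilling k L y x := by
  rw [ctKilling_apply, ctKilling_apply, LieModule.traceForm_comm]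

theorem ctKilling_lie (x y z : L) : ctKilling k L ⁅x, y⁆ z = ctKilling k L x ⁅y, z⁆ := by
  rw [ctKilling_apply, ctKilling_apply, LieModule.traceForm_apply_lie_apply]

theorem ctKilling_equiv (g : L ≃ₗ⁅k[T;T⁻¹]⁆ L) (x y : L) :
    ctKilling k L (g x) (g y) = ctKilling k L x y := by
  rw [ctKilling_apply, ctKilling_apply, LieAlgebra.killingForm_of_equiv_apply]

theorem ctKilling_skew [CharZero k] [Module.Finite k[T;T⁻¹] L] {D : Module.End k L} {M : ℤ}
    (hD : TwDer (M : k) D) (hi : IntDiag D) (hM : M ≠ 0) (x y : L) :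
    ctKilling k L (D x) y = - ctKilling k L x (D y) := by
  have : (ctKilling k L) ∘ₗ D = -((ctKilling k L).compl₂ D) := ext_of_iSup hi fun i v hv =>
    ext_of_iSup hi fun j w hw => by
      rw [mem_zEig] at hv hw
      simp only [LinearMap.comp_apply, LinearMap.neg_apply, LinearMap.compl₂_apply, hv, hw,
        map_smul, LinearMap.smul_apply, smul_eq_mul]
      by_cases h : i + j = 0
      · rw [show j = -i by omega]; push_cast; ring
      · rw [ctKilling_apply, ct_killing_eq_zero hD hi hM h (mem_zEig.2 hv) (mem_zEig.2 hw)]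
        ring
  exact LinearMap.congr_fun (LinearMap.congr_fun this x) y

end ConstantTermForm

/-- A realization of `H` as an affine algebra over a twisted loop algebra `L`. -/
structure AffineRealization (k L H : Type) [Field k] [LieRing L] [LieAlgebra k[T;T⁻¹] L]
    [LieAlgebra k L] [IsScalarTower k k[T;T⁻¹] L] [LieRing H] [LieAlgebra k H] where
  M : ℤ
  M_pos : 0 < M
  D : Module.End k L
  twDer : TwDer (M : k) D
  intDiag : IntDiag D
  killing : Function.Bijective (killingForm k[T;T⁻¹] L)
  c : H
  d : H
  ι : L →ₗ[k] H
  c_lie : ∀ z : H, ⁅c, z⁆ = 0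
  d_lie : ∀ x, ⁅d, ι x⁆ = ι (D x)
  lie_ι : ∀ x y, ⁅ι x, ι y⁆ = ι ⁅x, y⁆ + ctKilling k L (D x) y • c
  exists_eq : ∀ z : H, ∃ (l : L) (a b : k), z = ι l + a • c + b • d
  eq_zero : ∀ (l : L) (a b : k), ι l + a • c + b • d = 0 → l = 0 ∧ a = 0 ∧ b = 0

namespace AffineRealization

variable {k L H : Type} [Field k] [LieRing L] [LieAlgebra k[T;T⁻¹] L]
    [LieAlgebra k L] [IsScalarTower k k[T;T⁻¹] L] [LieRing H] [LieAlgebra k H]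
    (A : AffineRealization k L H)

/-- The linear coordinates on an affine algebra. -/
def coord : (L × k × k) ≃ₗ[k] H :=
  LinearEquiv.ofBijective
    (A.ι ∘ₗ LinearMap.fst k L (k × k) +
      ((LinearMap.fst k k k ∘ₗ LinearMap.snd k L (k × k)).smulRight A.c +
      (LinearMap.snd k k k ∘ₗ LinearMap.snd k L (k × k)).smulRight A.d)) <| by
    constructor
    · rw [← LinearMap.ker_eq_bot, LinearMap.ker_eq_bot']
      rintro ⟨l, a, b⟩ h
      obtain ⟨h1, h2, h3⟩ := A.eq_zero l a b (by simpa [add_assoc] using h)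
      rw [h1, h2, h3]; rfl
    · intro z
      obtain ⟨l, a, b, rfl⟩ := A.exists_eq z
      exact ⟨(l, a, b), by simp [add_assoc]⟩

/-- The element with given coordinates. -/
def elt (l : L) (a b : k) : H := A.ι l + a • A.c + b • A.d

theorem coord_apply (l : L) (a b : k) : A.coord (l, a, b) = A.elt l a b := by
  change A.ι l + (a • A.c + b • A.d) = _
  rw [elt, add_assoc]

/-- The loop component. -/
def pr : H →ₗ[k] L := LinearMap.fst k L (k × k) ∘ₗ A.coord.symm.toLinearMap

/-- The coefficient of the central element. -/
def cc : H →ₗ[k] k := LinearMap.fst k k k ∘ₗ LinearMap.snd k L (k × k) ∘ₗ A.coord.symm.toLinearMap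

/-- The coefficient of the degree derivation. -/
def dc : H →ₗ[k] k := LinearMap.snd k k k ∘ₗ LinearMap.snd k L (k × k) ∘ₗ A.coord.symm.toLinearMap

theorem pr_elt (l : L) (a b : k) : A.pr (A.elt l a b) = l := by simp [pr, ← coord_apply]
theorem cc_elt (l : L) (a b : k) : A.cc (A.elt l a b) = a := by simp [cc, ← coord_apply]
theorem dc_elt (l : L) (a b : k) : A.dc (A.elt l a b) = b := by simp [dc, ← coord_apply]

theorem elt_eta (z : H) : A.elt (A.pr z) (A.cc z) (A.dc z) = z := by
  rw [← coord_apply]; exact A.coord.apply_symm_apply z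

theorem ι_eq (l : L) : A.ι l = A.elt l 0 0 := by simp [elt]
theorem pr_ι (l : L) : A.pr (A.ι l) = l := by rw [ι_eq, pr_elt]
theorem dc_ι (l : L) : A.dc (A.ι l) = 0 := by rw [ι_eq, dc_elt]

theorem lie_c (z : H) : ⁅z, A.c⁆ = 0 := by rw [← lie_skew, A.c_lie, neg_zero]

theorem lie_elt (l l' : L) (a a' b b' : k) : ⁅A.elt l a b, A.elt l' a' b'⁆ =
    A.elt (⁅l, l'⁆ + b • A.D l' - b' • A.D l) (ctKilling k L (A.D l) l') 0 := by
  have h : ⁅A.ι l, A.d⁆ = - A.ι (A.D l) := by rw [← lie_skew, A.d_lie]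
  simp only [elt, add_lie, lie_add, smul_lie, lie_smul, A.c_lie, A.lie_c, A.d_lie, A.lie_ι, h,
    lie_self, map_add, map_sub, map_smul]
  module

theorem pr_lie (z w : H) : A.pr ⁅z, w⁆ =
    ⁅A.pr z, A.pr w⁆ + A.dc z • A.D (A.pr w) - A.dc w • A.D (A.pr z) := by
  rw [← A.elt_eta z, ← A.elt_eta w, lie_elt]
  simp only [pr_elt, dc_elt]

theorem dc_lie (z w : H) : A.dc ⁅z, w⁆ = 0 := by
  rw [← A.elt_eta z, ← A.elt_eta w, lie_elt, dc_elt]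

/-- The derivation of the loop algebra induced by an element of the affine algebra. -/
def op (z : H) : Module.End k L := LieAlgebra.ad k L (A.pr z) + A.dc z • A.D

theorem op_apply (z : H) (x : L) : A.op z x = ⁅A.pr z, x⁆ + A.dc z • A.D x := rfl

theorem op_add (z w : H) : A.op (z + w) = A.op z + A.op w := by
  simp only [op, map_add, add_smul]; abel

theorem op_ι (l : L) : A.op (A.ι l) = LieAlgebra.ad k L l := by
  simp [op, pr_ι, dc_ι]

theorem twDer_op (z : H) : TwDer ((A.M : k) * A.dc z) (A.op z) := by
  have := (twDer_ad (A.pr z)).add (A.twDer.smul (A.dc z))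
  rwa [zero_add, mul_comm] at this

theorem op_lie (z w : H) (x : L) :
    A.op ⁅z, w⁆ x = A.op z (A.op w x) - A.op w (A.op z x) := by
  have h1 := A.twDer.leibniz (A.pr z) x
  have h2 := A.twDer.leibniz (A.pr w) x
  simp only [op_apply, dc_lie, pr_lie, zero_smul, add_zero, map_add, map_smul, h1, h2, smul_add, add_lie, sub_lie, smul_lie, lie_lie]
  module

theorem pr_lie_eq (z w : H) : A.pr ⁅z, w⁆ = A.op z (A.pr w) - A.dc w • A.D (A.pr z) := by
  rw [pr_lie, op_apply]

theorem exists_op_eq [CharZero k] {E : Module.End k L} {b : k} (hE : TwDer ((A.M : k) * b) E) :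
    ∃ z, A.op z = E ∧ A.dc z = b := by
  have h0 : TwDer (0 : k) (E + (-b) • A.D) := by
    have := hE.add (A.twDer.smul (-b))
    convert this using 1
    ring
  obtain ⟨p, hp⟩ := h0.exists_lie A.killing
  refine ⟨A.elt p 0 b, ?_, A.dc_elt _ _ _⟩
  ext x
  rw [op_apply, pr_elt, dc_elt, ← hp]
  simp

theorem op_eq_zero [Nontrivial L] [CharZero k] {z : H} (h : A.op z = 0) :
    z = A.cc z • A.c := by
  obtain ⟨y, hy⟩ := exists_ne (0 : L)
  have h1 := (A.twDer_op z).twLin y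
  have hM : (A.M : k) ≠ 0 := by exact_mod_cast A.M_pos.ne'
  have hTy : (T 1 : k[T;T⁻¹]) • y ≠ 0 := fun h => hy (by
    rw [← T_zero_smul (k := k) y, ← neg_add_cancel (1 : ℤ), ← T_smul_T_smul, h, smul_zero])
  have hb : A.dc z = 0 := by
    rw [h, LinearMap.zero_apply, LinearMap.zero_apply, smul_zero, zero_add] at h1
    rcases smul_eq_zero.1 h1.symm with h2 | h2
    · exact (mul_eq_zero.1 h2).resolve_left hM
    · exact absurd h2 hTy
  have hp : A.pr z = 0 := by
    refine A.killing.1 ?_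
    rw [map_zero]
    ext1 y
    have : LieAlgebra.ad k[T;T⁻¹] L (A.pr z) = 0 := by
      ext x
      have := LinearMap.congr_fun h x
      rwa [op_apply, hb, zero_smul, add_zero] at this
    rw [killingForm_apply_apply, this, LinearMap.zero_comp, map_zero, LinearMap.zero_apply]
  conv_lhs => rw [← A.elt_eta z, hp, hb]
  simp [elt]

variable [CharZero k] [Module.Finite k[T;T⁻¹] L]

theorem adDiag_of_intDiag {z : H} (hb : A.dc z ≠ 0) (hi : IntDiag (A.op z)) : AdDiag k z := by
  set S : Submodule k H := ⨆ a : k, (LieAlgebra.ad k H z).eigenspace a with hS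
  have hmem : ∀ (a : k) (w : H), ⁅z, w⁆ = a • w → w ∈ S := fun a w h =>
    Submodule.mem_iSup_of_mem a (Module.End.mem_eigenspace_iff.2 h)
  have hc : A.c ∈ S := hmem 0 _ (by rw [A.lie_c, zero_smul])
  have hz : z ∈ S := hmem 0 _ (by rw [lie_self, zero_smul])
  have hι : ∀ l, A.ι l ∈ S := fun l => map_mem_of_iSup (f := A.ι) (fun i v hv => by
    have hlie : ⁅z, A.ι v⁆ = A.ι (A.op z v) + ctKilling k L (A.D (A.pr z)) v • A.c := by
      conv_lhs => rw [← A.elt_eta z, A.ι_eq, lie_elt]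
      simp [elt, op_apply]
    rw [mem_zEig.1 hv] at hlie
    by_cases hi0 : (i : k) = 0
    · have h1 := mem_zEig.1 hv
      rw [hi0, zero_smul, op_apply] at h1
      have h2 : A.D v = -(A.dc z)⁻¹ • ⁅A.pr z, v⁆ := by
        rw [eq_neg_of_add_eq_zero_left h1, neg_smul_neg, smul_smul, inv_mul_cancel₀ hb, one_smul]
      rw [ctKilling_skew A.twDer A.intDiag A.M_pos.ne', h2, hi0, zero_smul, map_zero,
        zero_add, map_smul, ← ctKilling_lie, lie_self, map_zero, LinearMap.zero_apply, smul_zero,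
        neg_zero, zero_smul] at hlie
      exact hmem 0 _ (by rw [hlie, zero_smul])
    · set t := ctKilling k L (A.D (A.pr z)) v with ht
      have h3 : A.ι v + ((i : k)⁻¹ * t) • A.c ∈ S := hmem i _ (by
        rw [lie_add, lie_smul, A.lie_c, smul_zero, add_zero, hlie, map_smul, smul_add, smul_smul,
          mul_inv_cancel_left₀ hi0])
      simpa using sub_mem h3 (S.smul_mem ((i : k)⁻¹ * t) hc)) (hi ▸ Submodule.mem_top)
  refine eq_top_iff.2 fun w _ => ?_
  have : w = (A.ι (A.pr w - (A.dc w * (A.dc z)⁻¹) • A.pr z)) +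
      (A.cc w - A.dc w * (A.dc z)⁻¹ * A.cc z) • A.c + (A.dc w * (A.dc z)⁻¹) • z := by
    have key : ∀ (p p' : L) (a a' b b' : k), b ≠ 0 → A.elt p' a' b' =
        A.ι (p' - (b' * b⁻¹) • p) + (a' - b' * b⁻¹ * a) • A.c + (b' * b⁻¹) • A.elt p a b := by
      intro p p' a a' b b' hb
      have : b' = b' * b⁻¹ * b := by field_simp
      simp only [elt, map_sub, map_smul, smul_add, smul_smul, ← this]
      module
    have := key (A.pr z) (A.pr w) (A.cc z) (A.cc w) (A.dc z) (A.dc w) hb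
    rwa [A.elt_eta, A.elt_eta] at this
  rw [this]
  exact add_mem (add_mem (hι _) (S.smul_mem _ hc)) (S.smul_mem _ hz)

theorem lie_eq_zero_of_op [Nontrivial L] {z w : H} (hz : AdDiag k z)
    (h : ∀ x, A.op z (A.op w x) = A.op w (A.op z x)) : ⁅z, w⁆ = 0 := by
  refine hz.lie_eq_zero ?_
  have h0 : A.op ⁅z, w⁆ = 0 := by
    ext x
    rw [op_lie, h, sub_self, LinearMap.zero_apply]
  rw [A.op_eq_zero h0, lie_smul, A.lie_c, smul_zero]

end AffineRealization

end

section

namespace AffineRealization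

variable {k L H : Type} [Field k] [LieRing L] [LieAlgebra k[T;T⁻¹] L]
    [LieAlgebra k L] [IsScalarTower k k[T;T⁻¹] L] [LieRing H] [LieAlgebra k H]
    (A : AffineRealization k L H) [CharZero k] [Module.Finite k[T;T⁻¹] L]

/-- Automorphisms of the loop algebra lift to the affine algebra. -/
theorem exists_lift (g : L ≃ₗ⁅k[T;T⁻¹]⁆ L) :
    ∃ φ : H ≃ₗ⁅k⁆ H, ∀ z x, A.op (φ z) (g x) = g (A.op z x) := by
  let gk : L →ₗ[k] L := (g.toLieHom : L →ₗ[k[T;T⁻¹]] L).restrictScalars k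
  let gs : L →ₗ[k] L := (g.symm.toLieHom : L →ₗ[k[T;T⁻¹]] L).restrictScalars k
  have hgs : ∀ x, gk (gs x) = x := fun x => g.apply_symm_apply x
  have hgl : ∀ x y, gk ⁅x, y⁆ = ⁅gk x, gk y⁆ := fun x y => g.map_lie x y
  have hgi : Function.Injective gk := g.injective
  have hD : TwDer (A.M * 1 : k) (gk ∘ₗ A.D ∘ₗ gs) := by
    rw [mul_one]
    refine A.twDer.conj g fun x => ?_
    change g (A.D (g.symm (g x))) = _
    rw [LieEquiv.symm_apply_apply]
  obtain ⟨w, hw, hw1⟩ := A.exists_op_eq hD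
  set p := A.pr w
  have hp : ∀ x, gk (A.D x) = ⁅p, gk x⁆ + A.D (gk x) := fun x => by
    have := LinearMap.congr_fun hw (gk x)
    rw [op_apply, hw1, one_smul] at this
    rw [this]
    change _ = g (A.D (g.symm (g x)))
    rw [LieEquiv.symm_apply_apply]
    rfl
  let κ := ctKilling k L
  have hκg : ∀ x y, κ (gk x) (gk y) = κ x y := ctKilling_equiv g
  let φ₀ : H →ₗ[k] H := A.coord.toLinearMap ∘ₗ
    ((gk ∘ₗ A.pr + A.dc.smulRight p).prod ((A.cc - κ p ∘ₗ gk ∘ₗ A.pr).prod A.dc))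
  have hφ₀ : ∀ l a b, φ₀ (A.elt l a b) = A.elt (gk l + b • p) (a - κ p (gk l)) b := fun l a b => by
    change A.coord (gk (A.pr (A.elt l a b)) + A.dc (A.elt l a b) • p,
      A.cc (A.elt l a b) - κ p (gk (A.pr (A.elt l a b))), A.dc (A.elt l a b)) = _
    rw [coord_apply, pr_elt, cc_elt, dc_elt]
  have hlie : ∀ x y, φ₀ ⁅x, y⁆ = ⁅φ₀ x, φ₀ y⁆ := by
    intro x y
    rw [← A.elt_eta x, ← A.elt_eta y]
    generalize A.pr x = l, A.cc x = a, A.dc x = b, A.pr y = l', A.cc y = a', A.dc y = b'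
    have h1 := ctKilling_skew A.twDer A.intDiag A.M_pos.ne'
    have h3 : κ (A.D l) l' = κ (A.D (gk l)) (gk l') + κ p ⁅gk l, gk l'⁆ := by
      rw [← hκg, hp, map_add, LinearMap.add_apply, add_comm]
      exact congrArg₂ _ rfl (ctKilling_lie _ _ _)
    have h4 : ∀ y, κ p ⁅p, y⁆ = 0 := fun y => by
      rw [← ctKilling_lie, lie_self, map_zero, LinearMap.zero_apply]
    have h5 : ∀ y, κ (A.D p) y = - κ p (A.D y) := h1 p
    have h6 : κ (A.D (gk l)) p = κ p (A.D (gk l)) := ctKilling_comm _ _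
    have h7 : κ p (A.D p) = 0 := by
      have h8 := h5 p
      rw [show κ (A.D p) p = κ p (A.D p) from ctKilling_comm _ _] at h8
      exact self_eq_neg.1 h8
    rw [lie_elt, hφ₀, hφ₀, hφ₀, lie_elt]
    congr 1
    · simp only [map_add, map_sub, map_smul, hgl, hp, add_lie, lie_add, smul_lie, lie_smul, lie_self,
        smul_add, ← lie_skew p]
      module
    · change κ (A.D l) l' - _ = κ _ _
      simp only [map_add, map_sub, map_smul, hgl, hp, LinearMap.add_apply, LinearMap.smul_apply, h3,
        h4, h5, h6, h7, smul_eq_mul]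
      ring
  have hbij : Function.Bijective φ₀ := by
    constructor
    · rw [← LinearMap.ker_eq_bot, LinearMap.ker_eq_bot']
      intro z hz
      rw [← A.elt_eta z, hφ₀] at hz
      obtain ⟨h1, h2, h3⟩ := A.eq_zero _ _ _ hz
      rw [h3, zero_smul, add_zero] at h1
      rw [h1, map_zero, sub_zero] at h2
      rw [← A.elt_eta z, h3, h2, hgi (h1.trans (map_zero gk).symm)]
      simp [elt]
    · intro z
      refine ⟨A.elt (gs (A.pr z - A.dc z • p)) (A.cc z + κ p (A.pr z - A.dc z • p)) (A.dc z), ?_⟩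
      rw [hφ₀, hgs, sub_add_cancel, add_sub_cancel_right, elt_eta]
  refine ⟨LieEquiv.ofBijective { φ₀ with map_lie' := fun {x y} => hlie x y } hbij, fun z x => ?_⟩
  change A.op (φ₀ z) (gk x) = gk (A.op z x)
  rw [← A.elt_eta z, hφ₀]
  simp only [op_apply, pr_elt, dc_elt, map_add, map_smul, hgl, hp, add_lie, smul_lie, smul_add]
  abel

end AffineRealization

end

section

section IntegerFunctionals

theorem Int.mul_add_ne_zero_of_abs_lt {a b N : ℤ} (ha : a ≠ 0) (hb : |b| < N) : N * a + b ≠ 0 := by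
  intro h
  have h1 : b = -(N * a) := by linarith
  have h2 : 0 < N := (abs_nonneg b).trans_lt hb
  rw [h1, abs_neg, abs_mul, abs_of_pos h2] at hb
  have h3 : N * 1 ≤ N * |a| := mul_le_mul_of_nonneg_left (Int.one_le_abs ha) h2.le
  omega

theorem exists_forall_abs_lt {ι : Type*} (s : Finset ι) (g : ι → ℤ) : ∃ N : ℤ, 0 < N ∧ ∀ i ∈ s, |g i| < N :=
  ⟨1 + ∑ i ∈ s, |g i|, by have := Finset.sum_nonneg fun i (_ : i ∈ s) => abs_nonneg (g i); omega,
    fun i hi => by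
      have := Finset.single_le_sum (f := fun i => |g i|) (fun j _ => abs_nonneg (g j)) hi
      omega⟩

variable {Γ : Type*} [AddCommGroup Γ] [Module.Free ℤ Γ]

theorem exists_intDual_ne_zero (s : Finset Γ) (hs : ∀ v ∈ s, v ≠ 0) :
    ∃ f : Γ →ₗ[ℤ] ℤ, ∀ v ∈ s, f v ≠ 0 := by
  classical
  induction s using Finset.induction_on with
  | empty => exact ⟨0, by simp⟩
  | insert v s _ ih =>
    obtain ⟨f, hf⟩ := ih fun w hw => hs w (Finset.mem_insert_of_mem hw)
    by_cases hfv : f v = 0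
    · let b := Module.Free.chooseBasis ℤ Γ
      obtain ⟨i, hi⟩ : ∃ i, b.coord i v ≠ 0 := by
        by_contra! h
        exact hs v (Finset.mem_insert_self v s) (b.forall_coord_eq_zero_iff.1 h)
      obtain ⟨N, _, hN⟩ := exists_forall_abs_lt s (b.coord i)
      refine ⟨N • f + b.coord i, fun w hw => ?_⟩
      rw [LinearMap.add_apply, LinearMap.smul_apply, smul_eq_mul]
      rcases Finset.mem_insert.1 hw with rfl | hw
      · rwa [hfv, mul_zero, zero_add]
      · exact Int.mul_add_ne_zero_of_abs_lt (hf w hw) (hN w hw)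
    · refine ⟨f, fun w hw => ?_⟩
      rcases Finset.mem_insert.1 hw with rfl | hw
      · exact hfv
      · exact hf w hw

theorem exists_intDual_periodic (F : Finset Γ) (e : Γ) : ∃ f : Γ →ₗ[ℤ] ℤ, (e ≠ 0 → 0 < f e) ∧
    ∀ φ ∈ F, ∀ n : ℤ, f (φ + n • e) = 0 → φ + n • e = 0 := by
  classical
  by_cases he : e = 0
  · obtain ⟨f, hf⟩ := exists_intDual_ne_zero (F.filter (· ≠ 0)) (by simp)
    refine ⟨f, fun h => absurd he h, fun φ hφ n h => ?_⟩
    rw [he, smul_zero, add_zero] at *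
    by_contra h0
    exact hf φ (by simp [hφ, h0]) h
  · obtain ⟨g, hg⟩ : ∃ g : Γ →ₗ[ℤ] ℤ, 0 < g e := by
      obtain ⟨g, hg⟩ := exists_intDual_ne_zero {e} (by simpa using he)
      rcases lt_or_gt_of_ne (hg e (by simp)) with h | h
      · exact ⟨-g, by simpa using h⟩
      · exact ⟨g, h⟩
    let β : Γ →ₗ[ℤ] Γ := g e • LinearMap.id - g.smulRight e
    have hβ : ∀ γ, β γ = g e • γ - g γ • e := fun γ => rfl
    have hβe : β e = 0 := by rw [hβ, sub_self]
    obtain ⟨h, hh⟩ := exists_intDual_ne_zero ((F.image β).filter (· ≠ 0)) (by simp)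
    obtain ⟨N, hN0, hN⟩ := exists_forall_abs_lt F fun φ => h (β φ)
    refine ⟨N • g + h ∘ₗ β, fun _ => ?_, fun φ hφ n h0 => ?_⟩
    · simp [hβe, hN0, hg]
    · have h1 : N * (g φ + n * g e) + h (β φ) = 0 := by
        simpa [hβe] using h0
      have h2 : g φ + n * g e = 0 := by
        by_contra h3
        exact Int.mul_add_ne_zero_of_abs_lt h3 (hN φ hφ) h1
      rw [h2, mul_zero, zero_add] at h1
      have h4 : β φ = 0 := by
        by_contra h5
        exact hh (β φ) (by simp [h5]; exact ⟨φ, hφ, rfl⟩) h1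
      rw [hβ] at h4
      have h6 : g e • (φ + n • e) = 0 := by
        have : g φ = -(n * g e) := by linarith
        rw [this] at h4
        rw [← h4]
        module
      exact (smul_eq_zero.1 h6).resolve_left hg.ne'

end IntegerFunctionals

end

section

theorem exists_degree {k V : Type*} [Field k] [CharZero k] [AddCommGroup V] [Module k V]
    (F : Finset V) (e : V) : ∃ (S : Submodule ℤ V) (f : V → ℤ),
      (∀ φ ∈ F, ∀ n : ℤ, φ + n • e ∈ S) ∧ e ∈ S ∧
      (∀ x ∈ S, ∀ y ∈ S, f (x + y) = f x + f y) ∧ (e ≠ 0 → 0 < f e) ∧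
      ∀ φ ∈ F, ∀ n : ℤ, f (φ + n • e) = 0 → φ + n • e = 0 := by
  classical
  have : IsAddTorsionFree V := IsAddTorsionFree.of_isTorsionFree k V
  obtain ⟨S, hF, he, hfin⟩ : ∃ S : Submodule ℤ V, (∀ φ ∈ F, φ ∈ S) ∧ e ∈ S ∧ Module.Finite ℤ S :=
    ⟨Submodule.span ℤ (↑(insert e F) : Set V), fun φ h => Submodule.subset_span (by simp [h]),
      Submodule.subset_span (by simp), Module.Finite.span_finset ℤ _⟩
  have hFe : ∀ φ ∈ F, ∀ n : ℤ, φ + n • e ∈ S := fun φ h n => add_mem (hF φ h) (S.smul_mem n he)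
  have : Module.Free ℤ S := Module.free_of_finite_type_torsion_free'
  obtain ⟨f, hf1, hf2⟩ := exists_intDual_periodic
    (F.attach.image fun φ : {x // x ∈ F} => (⟨φ.1, hF φ.1 φ.2⟩ : S)) ⟨e, he⟩
  have hext : ∀ x (hx : x ∈ S), (if h : x ∈ S then f ⟨x, h⟩ else 0) = f ⟨x, hx⟩ :=
    fun x hx => dif_pos hx
  refine ⟨S, fun x => if h : x ∈ S then f ⟨x, h⟩ else 0, hFe, he, fun x hx y hy => ?_, fun h => ?_,
    fun φ hφ n h => ?_⟩
  · simp only [hext _ hx, hext _ hy, hext _ (add_mem hx hy), ← map_add]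
    rfl
  · simp only [hext _ he]
    exact hf1 fun h0 => h (congrArg Subtype.val h0)
  · simp only [hext _ (hFe φ hφ n)] at h
    exact congrArg Subtype.val (hf2 ⟨φ, hF φ hφ⟩ (by simpa using hφ) n h)

namespace AffineRealization

variable {k L H : Type} [Field k] [LieRing L] [LieAlgebra k[T;T⁻¹] L]
    [LieAlgebra k L] [IsScalarTower k k[T;T⁻¹] L] [LieRing H] [LieAlgebra k H]
    (A : AffineRealization k L H) (𝔪 : LieSubalgebra k H)

/-- The weight space of the loop algebra for a functional on a subalgebra. -/
def wt (α : Module.Dual k 𝔪) : Submodule k L := ⨅ z : 𝔪, (A.op z).eigenspace (α z)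

/-- The weight of multiplication by `T 1`. -/
def wtT : Module.Dual k 𝔪 := (A.M : k) • A.dc ∘ₗ 𝔪.toSubmodule.subtype

variable {𝔪}

theorem wtT_apply (z : 𝔪) : A.wtT 𝔪 z = (A.M : k) * A.dc z := rfl

theorem mem_wt {α : Module.Dual k 𝔪} {v : L} : v ∈ A.wt 𝔪 α ↔ ∀ z : 𝔪, A.op z v = α z • v := by
  simp only [wt, Submodule.mem_iInf, Module.End.mem_eigenspace_iff]

theorem T_smul_mem_wt {α : Module.Dual k 𝔪} {v : L} (hv : v ∈ A.wt 𝔪 α) (n : ℤ) :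
    (T n : k[T;T⁻¹]) • v ∈ A.wt 𝔪 (α + n • A.wtT 𝔪) := by
  rw [mem_wt] at *
  intro z
  rw [(A.twDer_op (z : H)).twLin.T_smul, hv z, T_smul_comm, LinearMap.add_apply,
    LinearMap.smul_apply, wtT_apply, zsmul_eq_mul]
  module

theorem lie_mem_wt {α β : Module.Dual k 𝔪} {v w : L} (hv : v ∈ A.wt 𝔪 α) (hw : w ∈ A.wt 𝔪 β) :
    ⁅v, w⁆ ∈ A.wt 𝔪 (α + β) := by
  rw [mem_wt] at *
  intro z
  rw [(A.twDer_op (z : H)).leibniz, hv z, hw z, smul_lie, lie_smul, LinearMap.add_apply, add_smul]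

theorem op_zero : A.op 0 = 0 := by simp [op]

theorem op_commute_of_lie {z w : H} (h : ⁅z, w⁆ = 0) (x : L) :
    A.op z (A.op w x) = A.op w (A.op z x) := by
  have := A.op_lie z w x
  rw [h, op_zero] at this
  exact sub_eq_zero.1 this.symm

theorem isDec_wt (h : IsDiagonalizableSubalgebra 𝔪) : IsDec (A.wt 𝔪) := by
  constructor
  · have h1 := Module.End.independent_iInf_maxGenEigenspace_of_forall_mapsTo
      (fun z : 𝔪 => A.op (z : H)) (fun z w φ => Module.End.mapsTo_maxGenEigenspace_of_comm
        (LinearMap.ext fun x => A.op_commute_of_lie (h.lie_eq_zero w.2 z.2) x) φ)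
    refine (h1.comp (f := fun α : Module.Dual k 𝔪 => (α : 𝔪 → k)) DFunLike.coe_injective).mono
      fun α => ?_
    exact iInf_mono fun z => Module.End.eigenspace_le_maxGenEigenspace
  · refine eq_top_iff.2 fun l _ => ?_
    have hl : A.ι l ∈ ⨆ α, adWeightSpace 𝔪 α := by
      rw [show (⨆ α, adWeightSpace 𝔪 α) = ⊤ from h]; trivial
    rw [Submodule.mem_iSup_iff_exists_finsupp] at hl
    obtain ⟨f, hf, hl⟩ := hl
    have hdc : ∀ α ≠ 0, A.dc (f α) = 0 := by
      intro α hα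
      obtain ⟨z, hz⟩ : ∃ z, α z ≠ 0 := by
        by_contra! h0; exact hα (LinearMap.ext h0)
      have := A.dc_lie z (f α)
      rw [mem_adWeightSpace.1 (hf α) z, map_smul, smul_eq_mul] at this
      exact (mul_eq_zero.1 this).resolve_left hz
    have hdc0 : A.dc (f 0) = 0 := by
      have h2 := congrArg A.dc hl
      rw [A.dc_ι, Finsupp.sum, map_sum, Finset.sum_eq_single 0 (fun α _ hα => hdc α hα)
        (fun h0 => by rw [Finsupp.notMem_support_iff.1 h0, map_zero])] at h2
      exact h2
    have hmem : ∀ α, A.pr (f α) ∈ A.wt 𝔪 α := by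
      intro α
      rw [mem_wt]
      intro z
      have h2 := A.pr_lie_eq z (f α)
      have h3 : A.dc (f α) = 0 := by
        by_cases hα : α = 0
        · rw [hα, hdc0]
        · exact hdc α hα
      rw [mem_adWeightSpace.1 (hf α) z, h3, zero_smul, sub_zero, map_smul] at h2
      exact h2.symm
    rw [← A.pr_ι l, ← hl, Finsupp.sum, map_sum]
    exact Submodule.sum_mem _ fun α _ => Submodule.mem_iSup_of_mem α (hmem α)

variable [Module.Finite k[T;T⁻¹] L]

theorem exists_finset_weights (h : IsDiagonalizableSubalgebra 𝔪) :
    ∃ F : Finset (Module.Dual k 𝔪), ∀ α, ∀ v ∈ A.wt 𝔪 α, v ≠ 0 →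
      ∃ φ ∈ F, ∃ n : ℤ, α = φ + n • A.wtT 𝔪 := by
  classical
  have hD := A.isDec_wt h
  obtain ⟨s, hs⟩ := (inferInstance : Module.Finite k[T;T⁻¹] L).fg_top
  choose t _ ht using exists_sum_decProj hD
  refine ⟨s.biUnion t, fun α v hv hv0 => ?_⟩
  by_contra! hcon
  let K : Submodule k[T;T⁻¹] L :=
    { carrier := {x | ∀ n : ℤ, decProj (A.wt 𝔪) α ((T n : k[T;T⁻¹]) • x) = 0}
      add_mem' := fun {x y} hx hy n => by rw [smul_add, map_add, hx, hy, add_zero]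
      zero_mem' := fun n => by rw [smul_zero, map_zero]
      smul_mem' := fun r x hx => by
        induction r using LaurentPolynomial.induction_on' with
        | add p q hp hq => intro n; rw [add_smul, smul_add, map_add, hp, hq, add_zero]
        | C_mul_T l a =>
          intro n
          rw [mul_smul, C_smul_eq, T_smul_comm, map_smul, T_smul_T_smul, hx, smul_zero] }
  have hK : K = ⊤ := by
    refine eq_top_iff.2 (hs ▸ Submodule.span_le.2 fun x hx n => ?_)
    rw [ht x, Finset.smul_sum, map_sum]
    refine Finset.sum_eq_zero fun β hβ => decProj_ne hD (fun h0 => ?_)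
      (A.T_smul_mem_wt (decProj_mem hD β x) n)
    exact hcon β (Finset.mem_biUnion.2 ⟨x, hx, hβ⟩) n h0.symm
  have h1 : v ∈ K := hK ▸ Submodule.mem_top
  have h2 := h1 0
  rw [T_zero_smul, decProj_same hD hv] at h2
  exact hv0 h2

variable [CharZero k]

/-- A diagonalizable subalgebra is contained in the kernel of a grading whose zero component
is the zero weight space. -/
theorem exists_grading (h : IsDiagonalizableSubalgebra 𝔪) :
    ∃ (D : Module.End k L) (M' : ℤ), TwDer (M' : k) D ∧ IntDiag D ∧ (A.wtT 𝔪 ≠ 0 → 0 < M') ∧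
      (∀ w, (∀ z ∈ 𝔪, ⁅z, w⁆ = 0) → ∀ x, D (A.op w x) = A.op w (D x)) ∧ (∀ x, D x = 0 → x ∈ A.wt 𝔪 0) ∧
      (A.wtT 𝔪 = 0 → M' = 0) := by
  have hA := A.isDec_wt h
  obtain ⟨F, hF⟩ := A.exists_finset_weights h
  obtain ⟨S, f, hS, he, hadd, hpos, hzero⟩ := exists_degree (k := k) F (A.wtT 𝔪)
  have hmemS : ∀ α, ∀ v ∈ A.wt 𝔪 α, v ≠ 0 → α ∈ S := fun α v hv hv0 => by
    obtain ⟨φ, hφ, n, rfl⟩ := hF α v hv hv0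
    exact hS φ hφ n
  have hf0 : f 0 = 0 := by simpa using hadd 0 (zero_mem _) 0 (zero_mem _)
  obtain ⟨D, hD⟩ := hA.exists_glue fun α => (f α : k) • LinearMap.id
  replace hD : ∀ α, ∀ v ∈ A.wt 𝔪 α, D v = (f α : k) • v := hD
  refine ⟨D, f (A.wtT 𝔪), ⟨fun x => ?_, leibniz_of_iSup hA.2 fun α β v hv w hw => ?_⟩, ?_, hpos,
    fun w hw x => ?_, fun x hx => ?_, fun h0 => by rw [h0, hf0]⟩
  · have : D ∘ₗ tsm k L 1 = tsm k L 1 ∘ₗ D + (f (A.wtT 𝔪) : k) • tsm k L 1 :=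
      ext_of_iSup hA.2 fun α v hv => by
        change D ((T 1 : k[T;T⁻¹]) • v) = (T 1 : k[T;T⁻¹]) • D v +
          (f (A.wtT 𝔪) : k) • (T 1 : k[T;T⁻¹]) • v
        by_cases hv0 : v = 0
        · simp [hv0]
        · have h1 := A.T_smul_mem_wt hv 1
          rw [one_smul] at h1
          rw [hD _ _ h1, hD _ _ hv, hadd _ (hmemS α v hv hv0) _ he, T_smul_comm]
          push_cast
          module
    exact LinearMap.congr_fun this x
  · by_cases hv0 : v = 0
    · simp [hv0]
    by_cases hw0 : w = 0
    · simp [hw0]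
    rw [hD _ _ (A.lie_mem_wt hv hw), hD _ _ hv, hD _ _ hw,
      hadd _ (hmemS α v hv hv0) _ (hmemS β w hw hw0), smul_lie, lie_smul]
    push_cast
    module
  · refine eq_top_iff.2 (hA.2 ▸ iSup_le fun α v hv => Submodule.mem_iSup_of_mem (f α) ?_)
    exact mem_zEig.2 (hD α v hv)
  · have : D ∘ₗ A.op w = A.op w ∘ₗ D := ext_of_iSup hA.2 fun α v hv => by
      have h1 : A.op w v ∈ A.wt 𝔪 α := A.mem_wt.2 fun z => by
        rw [A.op_commute_of_lie (hw z z.2), A.mem_wt.1 hv z, map_smul]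
      rw [LinearMap.comp_apply, LinearMap.comp_apply, hD α v hv, map_smul, hD α _ h1]
    exact LinearMap.congr_fun this x
  · obtain ⟨s, -, hs⟩ := exists_sum_decProj hA x
    rw [hs]
    refine Submodule.sum_mem _ fun α _ => ?_
    have h1 := decProj_map hA hA D id Function.injective_id (fun β v hv => by
      rw [hD β v hv]; exact Submodule.smul_mem _ _ hv) α x
    have h2 := decProj_mem hA α x
    rw [id, hx, map_zero, hD α _ h2] at h1
    by_cases hz : decProj (A.wt 𝔪) α x = 0
    · rw [hz]; exact zero_mem _
    · obtain ⟨φ, hφ, n, rfl⟩ := hF α _ h2 hz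
      have h3 : f (φ + n • A.wtT 𝔪) = 0 := by
        have := (smul_eq_zero.1 h1.symm).resolve_right hz
        exact_mod_cast this
      rw [hzero φ hφ n h3] at h2 ⊢
      exact h2

variable [Nontrivial L]

theorem eq_zero_of_lie (A : AffineRealization k L H) {p : L} (h : ∀ x : L, ⁅p, x⁆ = 0) : p = 0 := by
  have h1 : A.op (A.ι p) = 0 := by
    rw [op_ι]; ext x; exact h x
  have h2 := congrArg A.pr (A.op_eq_zero h1)
  rwa [pr_ι, map_smul, show A.c = A.elt 0 1 0 by simp [elt], pr_elt, smul_zero] at h2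

theorem wtT_ne_zero (h : IsMAD 𝔪) : A.wtT 𝔪 ≠ 0 := by
  intro h0
  obtain ⟨D, M', hD, hi, -, hcomm, hker, hM'⟩ := A.exists_grading h.1
  rw [hM' h0, Int.cast_zero] at hD
  obtain ⟨E, hE, hiE, hDE⟩ := exists_commuting_grading A.killing A.M_pos hD hi A.twDer A.intDiag
  obtain ⟨e, rfl, he⟩ := A.exists_op_eq (b := 1) (by rwa [mul_one])
  have hdc : ∀ z ∈ 𝔪, A.dc z = 0 := fun z hz => by
    have := LinearMap.congr_fun h0 ⟨z, hz⟩
    rw [wtT_apply, LinearMap.zero_apply] at this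
    exact (mul_eq_zero.1 this).resolve_left (by exact_mod_cast A.M_pos.ne')
  have hsplit : ∀ v : H, v ∈ adWeightSpace 𝔪 0 ⊔ LinearMap.ker A.dc := fun v => by
    have hv : v ∈ ⨆ α, adWeightSpace 𝔪 α := by
      rw [show (⨆ α, adWeightSpace 𝔪 α) = ⊤ from h.1]; trivial
    refine (iSup_le fun α => ?_ : (⨆ α, adWeightSpace 𝔪 α) ≤ _) hv
    by_cases hα : α = 0
    · rw [hα]; exact le_sup_left
    · refine le_trans (fun w hw => ?_) le_sup_right
      obtain ⟨z, hz⟩ : ∃ z, α z ≠ 0 := by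
        by_contra! h0; exact hα (LinearMap.ext h0)
      have := A.dc_lie z w
      rw [mem_adWeightSpace.1 hw z, map_smul, smul_eq_mul] at this
      exact (mul_eq_zero.1 this).resolve_left hz
  obtain ⟨e₀, he₀, e', he', hee⟩ := Submodule.mem_sup.1 (hsplit e)
  have hc0 : ∀ z ∈ 𝔪, ⁅z, e₀⁆ = 0 := fun z hz => by
    have := mem_adWeightSpace.1 he₀ ⟨z, hz⟩
    rwa [LinearMap.zero_apply, zero_smul] at this
  have hop : ∀ x, A.op e' x = ⁅A.pr e', x⁆ := fun x => by
    rw [op_apply, show A.dc e' = 0 from he', zero_smul, add_zero]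
  have hDp : D (A.pr e') = 0 := A.eq_zero_of_lie fun x => by
    have h1 := hDE x
    have h2 := hcomm e₀ hc0 x
    rw [← hee, op_add, LinearMap.add_apply, LinearMap.add_apply, map_add, h2, hop, hop,
      hD.leibniz] at h1
    rw [← sub_eq_zero.2 h1.symm]
    abel
  have hp := A.mem_wt.1 (hker _ hDp)
  have hez : ∀ z ∈ 𝔪, ⁅z, e⁆ = 0 := fun z hz => A.lie_eq_zero_of_op (h.1.adDiag hz) fun x => by
    have h2 := A.op_commute_of_lie (hc0 z hz) x
    have h3 := hp ⟨z, hz⟩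
    rw [LinearMap.zero_apply, zero_smul] at h3
    rw [← hee, op_add, LinearMap.add_apply, LinearMap.add_apply, map_add, h2, hop, hop,
      (A.twDer_op z).leibniz, h3, zero_lie, zero_add]
  have hmem := h.mem_of_commute (A.adDiag_of_intDiag (by rw [he]; exact one_ne_zero) hiE) hez
  exact one_ne_zero (he.symm.trans (hdc e hmem))

/-- A maximal diagonalizable subalgebra has a regular element acting as a grading. -/
theorem exists_regular (h : IsMAD 𝔪) : ∃ z, IsRegularIn 𝔪 z ∧
    ∃ M' : ℤ, 0 < M' ∧ TwDer (M' : k) (A.op z) ∧ IntDiag (A.op z) := by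
  obtain ⟨D, M', hD, hi, hpos, hcomm, hker, -⟩ := A.exists_grading h.1
  replace hpos := hpos (A.wtT_ne_zero h)
  have hM : (A.M : k) ≠ 0 := by exact_mod_cast A.M_pos.ne'
  have hM' : (M' : k) ≠ 0 := by exact_mod_cast hpos.ne'
  obtain ⟨z, rfl, hz⟩ := A.exists_op_eq (b := (M' : k) / A.M) (by rwa [mul_div_cancel₀ _ hM])
  have hb : A.dc z ≠ 0 := by rw [hz]; exact div_ne_zero hM' hM
  have hzd := A.adDiag_of_intDiag hb hi
  have hcz : ∀ y ∈ 𝔪, ⁅y, z⁆ = 0 := fun y hy => A.lie_eq_zero_of_op (h.1.adDiag hy) fun x =>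
    (hcomm y (fun w hw => h.1.lie_eq_zero hw hy) x).symm
  refine ⟨z, ⟨h.mem_of_commute hzd hcz, fun v hv y hy => ?_⟩, M', hpos, hD, hi⟩
  set v' := v - (A.dc v / A.dc z) • z with hv'
  have hdc : A.dc v' = 0 := by
    rw [hv', map_sub, map_smul, smul_eq_mul, div_mul_cancel₀ _ hb, sub_self]
  have h1 := A.pr_lie_eq z v'
  rw [hv', lie_sub, lie_smul, lie_self, smul_zero, sub_zero, hv, map_zero, ← hv', hdc, zero_smul,
    sub_zero] at h1
  have hp := A.mem_wt.1 (hker _ h1.symm)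
  have h2 : ⁅y, v'⁆ = 0 := A.lie_eq_zero_of_op (h.1.adDiag hy) fun x => by
    have h3 := hp ⟨y, hy⟩
    rw [LinearMap.zero_apply, zero_smul] at h3
    rw [op_apply A v', op_apply A v', hdc, zero_smul, zero_smul, add_zero, add_zero,
      (A.twDer_op y).leibniz, h3, zero_lie, zero_add]
  rwa [hv', lie_sub, lie_smul, hcz y hy, smul_zero, sub_zero] at h2

end AffineRealization

end

section

section Conjugacy

variable {k L H : Type} [Field k] [LieRing L] [LieAlgebra k[T;T⁻¹] L]
    [LieAlgebra k L] [IsScalarTower k k[T;T⁻¹] L] [LieRing H] [LieAlgebra k H]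

/-- Any two maximal diagonalizable subalgebras of an affine algebra are conjugate. -/
theorem AffineRealization.exists_conj [CharZero k] [Module.Finite k[T;T⁻¹] L] [Nontrivial L]
    (A : AffineRealization k L H) {𝔪 𝔪' : LieSubalgebra k H} (h : IsMAD 𝔪) (h' : IsMAD 𝔪') :
    ∃ φ : H ≃ₗ⁅k⁆ H, ⇑φ '' (𝔪 : Set H) = (𝔪' : Set H) := by
  obtain ⟨z, hz, M, hM, hD, hi⟩ := A.exists_regular h
  obtain ⟨z', hz', M', hM', hD', hi'⟩ := A.exists_regular h'
  obtain ⟨g, g', E, E', hE, hE', hc⟩ := exists_commuting_conj A.killing hM hM' hD hi hD' hi'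
  obtain ⟨φ, hφ⟩ := A.exists_lift g
  obtain ⟨φ', hφ'⟩ := A.exists_lift g'
  have hop : ∀ x, A.op (φ z) x = E x := fun x => by
    have := hφ z (g.symm x)
    rwa [hE, LieEquiv.apply_symm_apply] at this
  have hop' : ∀ x, A.op (φ' z') x = E' x := fun x => by
    have := hφ' z' (g'.symm x)
    rwa [hE', LieEquiv.apply_symm_apply] at this
  have key : 𝔪.map φ.toLieHom = 𝔪'.map φ'.toLieHom :=
    (h.map φ).eq_of_regular (h'.map φ') (hz.map φ) (hz'.map φ')
      (A.lie_eq_zero_of_op ((h.map φ).1.adDiag (hz.map φ).1) fun x => by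
        rw [hop', hop, hop, hop', hc])
  refine ⟨φ.trans φ'.symm, Set.Subset.antisymm ?_ fun y hy => ?_⟩
  · rintro _ ⟨x, hx, rfl⟩
    obtain ⟨y, hy, hyx⟩ : φ x ∈ 𝔪'.map φ'.toLieHom := key ▸ ⟨x, hx, rfl⟩
    change φ' y = φ x at hyx
    change φ'.symm (φ x) ∈ _
    rw [← hyx, LieEquiv.symm_apply_apply]
    exact hy
  · obtain ⟨x, hx, hxy⟩ : φ' y ∈ 𝔪.map φ.toLieHom := key ▸ ⟨y, hy, rfl⟩
    change φ x = φ' y at hxy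
    refine ⟨x, hx, ?_⟩
    change φ'.symm (φ x) = y
    rw [hxy, LieEquiv.symm_apply_apply]

end Conjugacy

end

section

/-- The elements of degree `p` modulo the order of `σ`. -/
def homComp {k 𝔤 : Type} [Field k] [LieRing 𝔤] [LieAlgebra k 𝔤] (σ : 𝔤 ≃ₗ⁅k⁆ 𝔤) (ζ : k) (p : ℤ) :
    Submodule k 𝔤 :=
  LinearMap.eqLocus (σ : 𝔤 →ₗ[k] 𝔤) (ζ ^ p • LinearMap.id)

/-- `Lg` is the twisted loop algebra of `σ`, where `u p y` represents `y ⊗ sᵖ`. -/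
structure IsTwistedLoop {k 𝔤 Lg : Type} [Field k] [LieRing 𝔤] [LieAlgebra k 𝔤] [LieRing Lg]
    [LieAlgebra k[T;T⁻¹] Lg] [LieAlgebra k Lg] (m : ℕ) (σ : 𝔤 ≃ₗ⁅k⁆ 𝔤) (ζ : k)
    (u : ℤ → 𝔤 →ₗ[k] Lg) : Prop where
  m_pos : 0 < m
  iterate_eq : ∀ y : 𝔤, (⇑σ)^[m] y = y
  primitive : IsPrimitiveRoot ζ m
  lie : ∀ (p q : ℤ), ∀ y ∈ homComp σ ζ p, ∀ z ∈ homComp σ ζ q, ⁅u p y, u q z⁆ = u (p + q) ⁅y, z⁆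
  T_smul : ∀ (p : ℤ), ∀ y ∈ homComp σ ζ p, (T 1 : k[T;T⁻¹]) • u p y = u (p + m) y
  span : ∀ l : Lg, ∃ f : ℤ →₀ 𝔤, (∀ i, f i ∈ homComp σ ζ i) ∧ l = f.sum fun i yi => u i yi
  ind : ∀ f : ℤ →₀ 𝔤, (∀ i, f i ∈ homComp σ ζ i) → (f.sum fun i yi => u i yi) = 0 → f = 0

section HomogeneousComponents

variable {k 𝔤 : Type} [Field k] [LieRing 𝔤] [LieAlgebra k 𝔤] {σ : 𝔤 ≃ₗ⁅k⁆ 𝔤} {ζ : k} {m : ℕ}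

theorem mem_homComp {p : ℤ} {y : 𝔤} : y ∈ homComp σ ζ p ↔ σ y = ζ ^ p • y := Iff.rfl

theorem lie_mem_homComp (h0 : ζ ≠ 0) {p q : ℤ} {y z : 𝔤} (hy : y ∈ homComp σ ζ p)
    (hz : z ∈ homComp σ ζ q) : ⁅y, z⁆ ∈ homComp σ ζ (p + q) := by
  rw [mem_homComp] at *
  rw [LieEquiv.map_lie, hy, hz, smul_lie, lie_smul, smul_smul, zpow_add₀ h0]

theorem homComp_congr (hζ : IsPrimitiveRoot ζ m) (hm : 0 < m) {p q : ℤ} (h : (m : ℤ) ∣ p - q) :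
    homComp σ ζ p = homComp σ ζ q := by
  have h0 : ζ ≠ 0 := hζ.ne_zero hm.ne'
  have h1 : ζ ^ (p - q) = 1 := (hζ.zpow_eq_one_iff_dvd _).2 h
  have h2 : ζ ^ p = ζ ^ q := by
    rw [← sub_add_cancel p q, zpow_add₀ h0, h1, one_mul]
  rw [homComp, homComp, h2]

variable [IsAlgClosed k] [CharZero k] [FiniteDimensional k 𝔤]

theorem isSemisimple_of_iterate_eq (hm : 0 < m) (hσ : ∀ y : 𝔤, (⇑σ)^[m] y = y) :
    Module.End.IsSemisimple (σ : 𝔤 →ₗ[k] 𝔤) := by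
  have hpow : (σ : 𝔤 →ₗ[k] 𝔤) ^ m = 1 := by
    ext y
    rw [Module.End.pow_apply]
    exact hσ y
  refine Module.End.isSemisimple_of_squarefree_aeval_eq_zero
    (Polynomial.separable_X_pow_sub_C (n := m) (1 : k) (by exact_mod_cast hm.ne')
      one_ne_zero).squarefree ?_
  simp [hpow]

omit [IsAlgClosed k] [CharZero k] [FiniteDimensional k 𝔤] in
theorem exists_mem_homComp (hm : 0 < m) (hσ : ∀ y : 𝔤, (⇑σ)^[m] y = y) (hζ : IsPrimitiveRoot ζ m)
    {a : k} {v : 𝔤} (hv : σ v = a • v) : ∃ p : ℤ, v ∈ homComp σ ζ p ∧ 0 ≤ p ∧ p < m := by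
  by_cases hv0 : v = 0
  · exact ⟨0, hv0 ▸ zero_mem _, le_rfl, by exact_mod_cast hm⟩
  have : NeZero m := ⟨hm.ne'⟩
  have h1 : ∀ n : ℕ, (⇑σ)^[n] v = (a ^ n) • v := fun n => by
    induction n with
    | zero => simp
    | succ n ih =>
      rw [Function.iterate_succ_apply', ih, pow_succ, mul_smul, ← hv]
      exact σ.toLieHom.map_smul (a ^ n) v
  have h2 : a ^ m = 1 := smul_left_injective k hv0 (((h1 m).symm.trans (hσ v)).trans
    (one_smul k _).symm)
  obtain ⟨i, hi, rfl⟩ := hζ.eq_pow_of_pow_eq_one h2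
  exact ⟨i, by rw [mem_homComp, zpow_natCast]; exact hv, by positivity, Int.ofNat_lt.2 hi⟩

/-- A spanning set of homogeneous vectors contains a basis. -/
theorem exists_homogeneous_basis {P : 𝔤 → Prop}
    (h : Submodule.span k {v : 𝔤 | (∃ p : ℤ, v ∈ homComp σ ζ p ∧ 0 ≤ p ∧ p < m) ∧ P v} = ⊤) :
    ∃ (N : ℕ) (b : Module.Basis (Fin N) k 𝔤) (p : Fin N → ℤ), ∀ l, (b l ∈ homComp σ ζ (p l) ∧
      0 ≤ p l ∧ p l < m) ∧ P (b l) := by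
  let b := Module.Basis.ofSpan h.ge
  have hb : ∀ l, b l ∈ {v : 𝔤 | (∃ p : ℤ, v ∈ homComp σ ζ p ∧ 0 ≤ p ∧ p < m) ∧ P v} := fun l =>
    Module.Basis.ofSpan_subset h.ge ⟨l, rfl⟩
  have := Module.Finite.finite_basis b
  obtain ⟨N, ⟨e⟩⟩ := Finite.exists_equiv_fin
    ((linearIndepOn_empty k (id : 𝔤 → 𝔤)).extend (Set.empty_subset
      {v : 𝔤 | (∃ p : ℤ, v ∈ homComp σ ζ p ∧ 0 ≤ p ∧ p < m) ∧ P v}))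
  choose p hp using fun l => (hb l).1
  refine ⟨N, b.reindex e, fun l => p (e.symm l), fun l => ?_⟩
  rw [Module.Basis.reindex_apply]
  exact ⟨hp _, (hb _).2⟩

/-- An automorphism of finite order has a basis of eigenvectors. -/
theorem exists_eigenbasis (hm : 0 < m) (hσ : ∀ y : 𝔤, (⇑σ)^[m] y = y) (hζ : IsPrimitiveRoot ζ m) :
    ∃ (N : ℕ) (b : Module.Basis (Fin N) k 𝔤) (p : Fin N → ℤ), ∀ l, b l ∈ homComp σ ζ (p l) ∧
      0 ≤ p l ∧ p l < m := by
  obtain ⟨N, b, p, hb⟩ := exists_homogeneous_basis (σ := σ) (ζ := ζ) (m := m)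
    (P := fun _ => True) <| by
    refine eq_top_iff.2 (Module.End.iSup_maxGenEigenspace_eq_top (σ : 𝔤 →ₗ[k] 𝔤) ▸
      iSup_le fun a v hv => Submodule.subset_span ⟨?_, trivial⟩)
    rw [(isSemisimple_of_iterate_eq hm hσ).isFinitelySemisimple.maxGenEigenspace_eq_eigenspace,
      Module.End.mem_eigenspace_iff] at hv
    exact exists_mem_homComp hm hσ hζ hv
  exact ⟨N, b, p, fun l => (hb l).1⟩

end HomogeneousComponents

namespace IsTwistedLoop

variable {k 𝔤 Lg : Type} [Field k] [LieRing 𝔤] [LieAlgebra k 𝔤] [LieRing Lg]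
    [LieAlgebra k[T;T⁻¹] Lg] [LieAlgebra k Lg] [IsScalarTower k k[T;T⁻¹] Lg]
    {m : ℕ} {σ : 𝔤 ≃ₗ⁅k⁆ 𝔤} {ζ : k} {u : ℤ → 𝔤 →ₗ[k] Lg} (hL : IsTwistedLoop m σ ζ u)

include hL

theorem ne_zero : ζ ≠ 0 := hL.primitive.ne_zero hL.m_pos.ne'

theorem isDec : IsDec fun p => (homComp σ ζ p).map (u p) := by
  classical
  constructor
  · rw [iSupIndep_iff_finsetSum_eq_zero_imp_eq_zero]
    intro s v hv hsum
    choose! y hy hyv using hv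
    let f : ℤ →₀ 𝔤 := Finsupp.onFinset s (fun i => if i ∈ s then y i else 0) (by
      intro i hi; by_contra h; simp [h] at hi)
    have hf : f = 0 := by
      refine hL.ind f (fun i => ?_) ?_
      · change (if i ∈ s then y i else 0) ∈ _
        split_ifs with h
        · exact hy i h
        · exact zero_mem _
      · rw [Finsupp.onFinset_sum _ fun i => map_zero _, ← hsum]
        exact Finset.sum_congr rfl fun i hi => by rw [if_pos hi, hyv i hi]
    intro i hi
    have := DFunLike.congr_fun hf i
    change (if i ∈ s then y i else 0) = 0 at this
    rw [if_pos hi] at this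
    rw [← hyv i hi, this, map_zero]
  · refine eq_top_iff.2 fun l _ => ?_
    obtain ⟨f, hf, rfl⟩ := hL.span l
    exact Submodule.sum_mem _ fun i _ => Submodule.mem_iSup_of_mem i ⟨f i, hf i, rfl⟩

theorem injOn {p : ℤ} {y : 𝔤} (hy : y ∈ homComp σ ζ p) (h : u p y = 0) : y = 0 := by
  classical
  have := hL.ind (Finsupp.single p y) (fun i => by
    rw [Finsupp.single_apply]
    split_ifs with h
    · exact h ▸ hy
    · exact zero_mem _) (by
    rw [Finsupp.sum_single_index (h := fun i (yi : 𝔤) => u i yi) (map_zero _), h])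
  simpa using this

theorem exists_eval : ∃ ev : Lg →ₗ[k] 𝔤, ∀ p, ∀ y ∈ homComp σ ζ p, ev (u p y) = y := by
  have h1 : ∀ p, ∃ g : Lg →ₗ[k] 𝔤, ∀ y ∈ homComp σ ζ p, g (u p y) = y := fun p => by
    obtain ⟨g, hg⟩ := LinearMap.exists_leftInverse_of_injective
      ((u p) ∘ₗ (homComp σ ζ p).subtype) (by
        rw [LinearMap.ker_eq_bot']
        exact fun y hy => Subtype.ext (hL.injOn y.2 hy))
    refine ⟨(homComp σ ζ p).subtype ∘ₗ g, fun y hy => ?_⟩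
    exact congrArg Subtype.val (LinearMap.congr_fun hg ⟨y, hy⟩)
  choose g hg using h1
  obtain ⟨ev, hev⟩ := hL.isDec.exists_glue g
  exact ⟨ev, fun p y hy => by rw [hev p _ ⟨y, hy, rfl⟩, hg p y hy]⟩

theorem exists_degree_derivation : ∃ D : Module.End k Lg, TwDer ((m : ℤ) : k) D ∧ IntDiag D ∧
    ∀ p, ∀ y ∈ homComp σ ζ p, D (u p y) = (p : k) • u p y := by
  obtain ⟨D, hD⟩ := hL.isDec.exists_glue fun p => (p : k) • LinearMap.id
  replace hD : ∀ p, ∀ y ∈ homComp σ ζ p, D (u p y) = (p : k) • u p y := fun p y hy =>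
    hD p _ ⟨y, hy, rfl⟩
  refine ⟨D, ⟨fun x => ?_, leibniz_of_iSup hL.isDec.2 ?_⟩, ?_, hD⟩
  · have : D ∘ₗ tsm k Lg 1 = tsm k Lg 1 ∘ₗ D + ((m : ℤ) : k) • tsm k Lg 1 :=
      ext_of_iSup hL.isDec.2 fun p v hv => by
        obtain ⟨y, hy, rfl⟩ := hv
        change D ((T 1 : k[T;T⁻¹]) • u p y) = (T 1 : k[T;T⁻¹]) • D (u p y) +
          ((m : ℤ) : k) • (T 1 : k[T;T⁻¹]) • u p y
        have hy' : y ∈ homComp σ ζ (p + m) := by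
          rwa [homComp_congr hL.primitive hL.m_pos (q := p) (by simp)]
        rw [hL.T_smul p y hy, hD _ _ hy', hD _ _ hy, T_smul_comm, hL.T_smul p y hy]
        push_cast
        module
    exact LinearMap.congr_fun this x
  · rintro p q _ ⟨y, hy, rfl⟩ _ ⟨z, hz, rfl⟩
    rw [hL.lie p q y hy z hz, hD _ _ (lie_mem_homComp hL.ne_zero hy hz), hD p y hy, hD q z hz,
      smul_lie, lie_smul, hL.lie p q y hy z hz]
    push_cast
    module
  · refine eq_top_iff.2 (hL.isDec.2 ▸ iSup_le fun p v hv => Submodule.mem_iSup_of_mem p ?_)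
    obtain ⟨y, hy, rfl⟩ := hv
    exact mem_zEig.2 (hD p y hy)

theorem T_smul_eq {p : ℤ} {y : 𝔤} (hy : y ∈ homComp σ ζ p) (n : ℤ) :
    (T n : k[T;T⁻¹]) • u p y = u (p + n * m) y := by
  have step : ∀ n : ℤ, (T (n + 1) : k[T;T⁻¹]) • u p y = (T 1 : k[T;T⁻¹]) • (T n : k[T;T⁻¹]) • u p y :=
    fun n => by rw [T_smul_T_smul, add_comm]
  have hcong : ∀ n : ℤ, y ∈ homComp σ ζ (p + n * m) := fun n => by
    rwa [homComp_congr hL.primitive hL.m_pos (q := p) (by simp)]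
  induction n using Int.induction_on with
  | zero => rw [T_zero_smul, zero_mul, add_zero]
  | succ n ih => rw [step, ih, hL.T_smul _ _ (hcong _)]; congr 2; ring
  | pred n ih =>
    have h1 := hL.T_smul _ y (hcong (-n - 1))
    rw [show p + (-(n : ℤ) - 1) * m + m = p + -(n : ℤ) * m by ring, ← ih] at h1
    have h2 := congrArg (fun x => (T (-1) : k[T;T⁻¹]) • x) h1
    simp only [T_smul_T_smul, neg_add_cancel, T_zero_smul] at h2
    rw [h2]
    congr 2
    ring

end IsTwistedLoop

end

section

theorem trace_eq_sum_repr {R M ι : Type*} [CommRing R] [AddCommGroup M] [Module R M] [Fintype ι]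
    (b : Module.Basis ι R M) (f : M →ₗ[R] M) : LinearMap.trace R M f = ∑ i, b.repr (f (b i)) i := by
  classical
  rw [LinearMap.trace_eq_matrix_trace R b, Matrix.trace]
  exact Finset.sum_congr rfl fun i _ => by rw [Matrix.diag_apply, LinearMap.toMatrix_apply]

theorem dvd_of_repr_ne_zero {k 𝔤 : Type} [Field k] [LieRing 𝔤] [LieAlgebra k 𝔤] {σ : 𝔤 ≃ₗ⁅k⁆ 𝔤}
    {ζ : k} {m : ℕ} (hζ : IsPrimitiveRoot ζ m) (hm : 0 < m) {N : ℕ} (b : Module.Basis (Fin N) k 𝔤)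
    {p : Fin N → ℤ} (hb : ∀ l, b l ∈ homComp σ ζ (p l)) {r : ℤ} {w : 𝔤} (hw : w ∈ homComp σ ζ r)
    {l : Fin N} (h : b.repr w l ≠ 0) : (m : ℤ) ∣ r - p l := by
  have h1 : (b.coord l) ∘ₗ (σ : 𝔤 →ₗ[k] 𝔤) = ζ ^ p l • b.coord l := b.ext fun j => by
    have := mem_homComp.1 (hb j)
    change b.coord l (σ (b j)) = ζ ^ p l • b.coord l (b j)
    rw [this, map_smul, b.coord_apply, b.repr_self, Finsupp.single_apply]
    split_ifs with hjl
    · rw [hjl]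
    · simp
  have h2 := LinearMap.congr_fun h1 w
  change b.repr (σ w) l = ζ ^ p l • b.repr w l at h2
  rw [mem_homComp.1 hw, map_smul, Finsupp.smul_apply] at h2
  have h0 : ζ ≠ 0 := hζ.ne_zero hm.ne'
  rw [← hζ.zpow_eq_one_iff_dvd, zpow_sub₀ h0, smul_left_injective k h h2,
    div_self (zpow_ne_zero _ h0)]

namespace IsTwistedLoop

variable {k 𝔤 Lg : Type} [Field k] [CharZero k] [LieRing 𝔤]
    [LieAlgebra k 𝔤] [FiniteDimensional k 𝔤] [LieRing Lg]
    [LieAlgebra k[T;T⁻¹] Lg] [LieAlgebra k Lg] [IsScalarTower k k[T;T⁻¹] Lg]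
    {m : ℕ} {σ : 𝔤 ≃ₗ⁅k⁆ 𝔤} {ζ : k} {u : ℤ → 𝔤 →ₗ[k] Lg} (hL : IsTwistedLoop m σ ζ u)

include hL

theorem exists_basis {N : ℕ} (b : Module.Basis (Fin N) k 𝔤) {p : Fin N → ℤ}
    (hb : ∀ l, b l ∈ homComp σ ζ (p l)) (hp : ∀ l, 0 ≤ p l ∧ p l < m) :
    ∃ e : Module.Basis (Fin N) k[T;T⁻¹] Lg, (∀ l, e l = u (p l) (b l)) ∧
      ∀ r, ∀ w ∈ homComp σ ζ r, ∀ l, e.repr (u r w) l = C (b.repr w l) * T ((r - p l) / m) := by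
  obtain ⟨D, hD, hi, hDu⟩ := hL.exists_degree_derivation
  obtain ⟨ev, hev⟩ := hL.exists_eval
  have hm : (m : ℤ) ≠ 0 := by exact_mod_cast hL.m_pos.ne'
  have hli : LinearIndependent k[T;T⁻¹] fun l => u (p l) (b l) := by
    refine linearIndependent_of_hom hD.twLin hi hm _ p (fun l => mem_zEig.2 (hDu _ _ (hb l)))
      (fun l => by rw [Nat.abs_cast]; exact hp l) ?_
    refine LinearIndependent.of_comp ev ?_
    have hcomp : ⇑ev ∘ (fun l => u (p l) (b l)) = b := funext fun l => hev _ _ (hb l)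
    rw [hcomp]
    exact b.linearIndependent
  have hsum : ∀ r, ∀ w ∈ homComp σ ζ r,
      u r w = ∑ l, (C (b.repr w l) * T ((r - p l) / m) : k[T;T⁻¹]) • u (p l) (b l) := by
    intro r w hw
    conv_lhs => rw [← b.sum_repr w, map_sum]
    refine Finset.sum_congr rfl fun l _ => ?_
    rw [map_smul, mul_smul, C_smul_eq]
    by_cases h : b.repr w l = 0
    · rw [h, zero_smul, zero_smul]
    · rw [hL.T_smul_eq (hb l), Int.ediv_mul_cancel (dvd_of_repr_ne_zero hL.primitive hL.m_pos b hb hw h),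
        add_sub_cancel]
  have hspan : ⊤ ≤ Submodule.span k[T;T⁻¹] (Set.range fun l => u (p l) (b l)) := by
    rintro x -
    obtain ⟨f, hf, rfl⟩ := hL.span x
    refine Submodule.sum_mem _ fun i _ => ?_
    change u i (f i) ∈ _
    rw [hsum i _ (hf i)]
    exact Submodule.sum_mem _ fun l _ => Submodule.smul_mem _ _ (Submodule.subset_span ⟨l, rfl⟩)
  have he : ∀ l, Module.Basis.mk hli hspan l = u (p l) (b l) := Module.Basis.mk_apply hli hspan
  refine ⟨Module.Basis.mk hli hspan, he, fun r w hw l => ?_⟩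
  conv_lhs => rw [hsum r w hw]
  have hmk : ∑ l, (C (b.repr w l) * T ((r - p l) / m) : k[T;T⁻¹]) • u (p l) (b l) =
      ∑ l, (C (b.repr w l) * T ((r - p l) / m) : k[T;T⁻¹]) • Module.Basis.mk hli hspan l :=
    Finset.sum_congr rfl fun l _ => by rw [he]
  rw [hmk, Module.Basis.repr_sum_self]

variable [IsAlgClosed k]

theorem killingForm_apply {p q : ℤ} {y z : 𝔤} (hy : y ∈ homComp σ ζ p) (hz : z ∈ homComp σ ζ q) :
    killingForm k[T;T⁻¹] Lg (u p y) (u q z) = C (killingForm k 𝔤 y z) * T ((p + q) / m) := by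
  obtain ⟨N, b, d, hbd⟩ := exists_eigenbasis hL.m_pos hL.iterate_eq hL.primitive
  obtain ⟨e, he, hrepr⟩ := hL.exists_basis b (fun l => (hbd l).1) fun l => (hbd l).2
  rw [killingForm_apply_apply, killingForm_apply_apply, trace_eq_sum_repr e, trace_eq_sum_repr b,
    map_sum, Finset.sum_mul]
  refine Finset.sum_congr rfl fun l _ => ?_
  have h1 : ⁅z, b l⁆ ∈ homComp σ ζ (q + d l) := lie_mem_homComp hL.ne_zero hz (hbd l).1
  have h2 : ⁅y, ⁅z, b l⁆⁆ ∈ homComp σ ζ (p + (q + d l)) := lie_mem_homComp hL.ne_zero hy h1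
  simp only [LinearMap.comp_apply, LieAlgebra.ad_apply]
  rw [he, hL.lie _ _ _ hz _ (hbd l).1, hL.lie _ _ _ hy _ h1, hrepr _ _ h2]
  congr 3
  ring

theorem dvd_of_killingForm_ne_zero {p q : ℤ} {y z : 𝔤} (hy : y ∈ homComp σ ζ p)
    (hz : z ∈ homComp σ ζ q) (h : killingForm k 𝔤 y z ≠ 0) : (m : ℤ) ∣ p + q := by
  have h1 := LieAlgebra.killingForm_of_equiv_apply σ y z
  rw [mem_homComp.1 hy, mem_homComp.1 hz, map_smul, map_smul, LinearMap.smul_apply, smul_smul,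
    ← zpow_add₀ hL.ne_zero] at h1
  rw [← hL.primitive.zpow_eq_one_iff_dvd, add_comm]
  exact smul_left_injective k h (h1.trans (one_smul k _).symm)

theorem ctKilling_apply {p q : ℤ} {y z : 𝔤} (hy : y ∈ homComp σ ζ p) (hz : z ∈ homComp σ ζ q) :
    ctKilling k Lg (u p y) (u q z) = if p + q = 0 then killingForm k 𝔤 y z else 0 := by
  rw [_root_.ctKilling_apply, hL.killingForm_apply hy hz, ← LaurentPolynomial.smul_eq_C_mul,
    map_smul, ct_T, smul_eq_mul]
  by_cases h : killingForm k 𝔤 y z = 0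
  · rw [h]; simp
  · obtain ⟨n, hn⟩ := hL.dvd_of_killingForm_ne_zero hy hz h
    have hm : (m : ℤ) ≠ 0 := by exact_mod_cast hL.m_pos.ne'
    rw [hn, Int.mul_ediv_cancel_left _ hm]
    simp [hL.m_pos.ne']

theorem finite : Module.Finite k[T;T⁻¹] Lg := by
  obtain ⟨N, b, d, hbd⟩ := exists_eigenbasis hL.m_pos hL.iterate_eq hL.primitive
  obtain ⟨e, -, -⟩ := hL.exists_basis b (fun l => (hbd l).1) fun l => (hbd l).2
  exact Module.Finite.of_basis e

theorem nontrivial [Nontrivial 𝔤] : Nontrivial Lg := by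
  obtain ⟨N, b, d, hbd⟩ := exists_eigenbasis hL.m_pos hL.iterate_eq hL.primitive
  obtain ⟨l⟩ := b.index_nonempty
  exact ⟨u (d l) (b l), 0, fun h => b.ne_zero l (hL.injOn (hbd l).1 h)⟩

theorem killingForm_bijective [LieAlgebra.IsKilling k 𝔤] :
    Function.Bijective (killingForm k[T;T⁻¹] Lg) := by
  classical
  obtain ⟨N, b, d, hbd⟩ := exists_eigenbasis hL.m_pos hL.iterate_eq hL.primitive
  obtain ⟨e, he, -⟩ := hL.exists_basis b (fun l => (hbd l).1) fun l => (hbd l).2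
  have := Module.Finite.of_basis e
  have hnd := LieAlgebra.IsKilling.killingForm_nondegenerate k 𝔤
  let b' := LinearMap.BilinForm.dualBasis (killingForm k 𝔤) hnd b
  have hb'b : ∀ i j, killingForm k 𝔤 (b' i) (b j) = if j = i then 1 else 0 :=
    LinearMap.BilinForm.apply_dualBasis_left hnd b
  have hb' : ∀ i, b' i ∈ homComp σ ζ (-d i) := by
    intro i
    rw [mem_homComp]
    have h1 : killingForm k 𝔤 (σ (b' i)) = killingForm k 𝔤 (ζ ^ (-d i) • b' i) := b.ext fun j => by
      have h2 : b j = σ (ζ ^ (-d j) • b j) := by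
        have := σ.toLieHom.map_smul (ζ ^ (-d j)) (b j)
        change σ (ζ ^ (-d j) • b j) = _ • σ (b j) at this
        rw [this, mem_homComp.1 (hbd j).1, smul_smul, ← zpow_add₀ hL.ne_zero, neg_add_cancel,
          zpow_zero, one_smul]
      conv_lhs => rw [h2, LieAlgebra.killingForm_of_equiv_apply]
      rw [map_smul, map_smul, LinearMap.smul_apply, hb'b]
      split_ifs with h
      · rw [h]
      · simp
    exact sub_eq_zero.1 (hnd.1 _ fun y => by rw [map_sub, LinearMap.sub_apply, h1, sub_self])
  have hdual : ∀ i j, killingForm k[T;T⁻¹] Lg (u (-d i) (b' i)) (e j) = if j = i then 1 else 0 := by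
    intro i j
    rw [he, hL.killingForm_apply (hb' i) (hbd j).1, hb'b]
    split_ifs with h
    · rw [h]; simp
    · simp
  have hsurj : Function.Surjective (killingForm k[T;T⁻¹] Lg) := fun φ => by
    refine ⟨∑ i, φ (e i) • u (-d i) (b' i), e.ext fun j => ?_⟩
    rw [map_sum, LinearMap.sum_apply]
    simp [map_smul, hdual]
  refine ⟨?_, hsurj⟩
  have := OrzechProperty.injective_of_surjective_endomorphism
    (e.toDualEquiv.symm.toLinearMap ∘ₗ killingForm k[T;T⁻¹] Lg)
    (e.toDualEquiv.symm.surjective.comp hsurj)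
  exact Function.Injective.of_comp this

end IsTwistedLoop

end

section

namespace IsTwistedLoop

variable {k 𝔤 Lg Lhat : Type} [Field k] [CharZero k] [IsAlgClosed k] [LieRing 𝔤]
    [LieAlgebra k 𝔤] [FiniteDimensional k 𝔤] [LieRing Lg]
    [LieAlgebra k[T;T⁻¹] Lg] [LieAlgebra k Lg] [IsScalarTower k k[T;T⁻¹] Lg]
    [LieRing Lhat] [LieAlgebra k Lhat]
    {m : ℕ} {σ : 𝔤 ≃ₗ⁅k⁆ 𝔤} {ζ : k} {u : ℤ → 𝔤 →ₗ[k] Lg} (hL : IsTwistedLoop m σ ζ u)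

include hL

theorem exists_affineRealization [LieAlgebra.IsKilling k 𝔤] (c d : Lhat) (ι : Lg →ₗ[k] Lhat)
    (hc : ∀ z : Lhat, ⁅c, z⁆ = 0)
    (hd : ∀ (p : ℤ), ∀ y ∈ homComp σ ζ p, ⁅d, ι (u p y)⁆ = (p : k) • ι (u p y))
    (hbr : ∀ (p q : ℤ), ∀ y ∈ homComp σ ζ p, ∀ z ∈ homComp σ ζ q,
      ⁅ι (u p y), ι (u q z)⁆ =
        ι (u (p + q) ⁅y, z⁆) +
          (if p + q = 0 then (p : k) * killingForm k 𝔤 y z else 0) • c)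
    (hdec : ∀ z : Lhat, ∃ (l : Lg) (a b : k), z = ι l + a • c + b • d)
    (huniq : ∀ (l : Lg) (a b : k), ι l + a • c + b • d = 0 → l = 0 ∧ a = 0 ∧ b = 0) :
    ∃ A : AffineRealization k Lg Lhat, A.c = c ∧ A.d = d ∧ A.ι = ι ∧
      ∀ p, ∀ y ∈ homComp σ ζ p, A.D (u p y) = (p : k) • u p y := by
  obtain ⟨D, hD, hi, hDu⟩ := hL.exists_degree_derivation
  refine ⟨⟨m, by exact_mod_cast hL.m_pos, D, hD, hi, hL.killingForm_bijective, c, d, ι, hc, ?_, ?_,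
    hdec, huniq⟩, rfl, rfl, rfl, hDu⟩
  · have : (LieAlgebra.ad k Lhat d).comp ι = ι ∘ₗ D := ext_of_iSup hL.isDec.2 fun p v hv => by
      obtain ⟨y, hy, rfl⟩ := hv
      change ⁅d, ι (u p y)⁆ = ι (D (u p y))
      rw [hd p y hy, hDu p y hy, map_smul]
    exact LinearMap.congr_fun this
  · have : (LieModule.toEnd k Lhat Lhat : Lhat →ₗ[k] Module.End k Lhat).compl₁₂ ι ι =
        (LieModule.toEnd k Lg Lg : Lg →ₗ[k] Module.End k Lg).compr₂ ι +
          (ctKilling k Lg ∘ₗ D).compr₂ (LinearMap.toSpanSingleton k Lhat c) :=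
      ext_of_iSup hL.isDec.2 fun p v hv => ext_of_iSup hL.isDec.2 fun q w hw => by
        obtain ⟨y, hy, rfl⟩ := hv
        obtain ⟨z, hz, rfl⟩ := hw
        change ⁅ι (u p y), ι (u q z)⁆ = ι ⁅u p y, u q z⁆ + ctKilling k Lg (D (u p y)) (u q z) • c
        rw [hbr p q y hy z hz, hL.lie p q y hy z hz, hDu p y hy, map_smul, LinearMap.smul_apply,
          hL.ctKilling_apply hy hz, smul_eq_mul, mul_ite, mul_zero]
    exact fun x y => LinearMap.congr_fun (LinearMap.congr_fun this x) y

end IsTwistedLoop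

end

section

section CartanFixedPoints

variable {k 𝔤 : Type} [Field k] [IsAlgClosed k] [CharZero k] [LieRing 𝔤] [LieAlgebra k 𝔤]
  [FiniteDimensional k 𝔤]

theorem iSup_maxGenEigenspace_ad (x : 𝔤) :
    ⨆ a : k, (LieAlgebra.ad k 𝔤 x).maxGenEigenspace a = ⊤ :=
  Module.End.iSup_maxGenEigenspace_eq_top _

theorem isDec_maxGenEigenspace_ad (x : 𝔤) :
    IsDec fun a : k => (LieAlgebra.ad k 𝔤 x).maxGenEigenspace a :=
  ⟨Module.End.independent_maxGenEigenspace _, iSup_maxGenEigenspace_ad x⟩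

/-- The semisimple part of an element, through its adjoint action. -/
def IsSemisimplePart (k : Type) {𝔤 : Type} [Field k] [LieRing 𝔤] [LieAlgebra k 𝔤] (x s : 𝔤) :
    Prop :=
  ∀ a : k, ∀ v ∈ (LieAlgebra.ad k 𝔤 x).maxGenEigenspace a, ⁅s, v⁆ = a • v

variable [LieAlgebra.IsKilling k 𝔤]

theorem exists_isSemisimplePart (x : 𝔤) : ∃ s, IsSemisimplePart k x s := by
  obtain ⟨g, hg⟩ := (isDec_maxGenEigenspace_ad (k := k) x).exists_glue fun a => a • LinearMap.id
  have hleib := leibniz_of_iSup (iSup_maxGenEigenspace_ad (k := k) x) (g := g)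
    fun a b v hv w hw => by
      rw [hg (a + b) _ (LieModule.lie_mem_maxGenEigenspace_toEnd hv hw), hg a v hv, hg b w hw]
      simp [add_smul]
  obtain ⟨s, hs⟩ := LieDerivation.IsKilling.exists_eq_ad (R := k) (L := 𝔤)
    ⟨g, fun a b => by rw [hleib, ← lie_skew b (g a)]; abel⟩
  refine ⟨s, fun a v hv => ?_⟩
  have h1 : ⁅s, v⁆ = g v := by
    rw [← LieDerivation.ad_apply_apply k 𝔤, hs]
    rfl
  exact h1.trans (hg a v hv)

theorem eq_of_lie_eq (k : Type) {𝔤 : Type} [Field k] [LieRing 𝔤] [LieAlgebra k 𝔤]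
    [FiniteDimensional k 𝔤] [LieAlgebra.IsKilling k 𝔤] {x y : 𝔤} (h : ∀ v : 𝔤, ⁅x, v⁆ = ⁅y, v⁆) : x = y := by
  rw [← sub_eq_zero, ← LieDerivation.IsKilling.ad_apply_eq_zero_iff k 𝔤]
  ext v
  simp [h]

theorem IsSemisimplePart.eq_of_ext {x s t : 𝔤} (h : IsSemisimplePart k x s)
    (h' : IsSemisimplePart k x t) : s = t :=
  eq_of_lie_eq k fun v => LinearMap.congr_fun (ext_of_iSup (f := LieAlgebra.ad k 𝔤 s)
    (g := LieAlgebra.ad k 𝔤 t) (iSup_maxGenEigenspace_ad (k := k) x)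
    fun a w hw => (h a w hw).trans (h' a w hw).symm) v

theorem IsSemisimplePart.map {x s : 𝔤} (h : IsSemisimplePart k x s) (σ : 𝔤 ≃ₗ⁅k⁆ 𝔤)
    (hx : σ x = x) : σ s = s := by
  have hcomm : Commute (LieAlgebra.ad k 𝔤 x) (σ.symm.toLieHom : 𝔤 →ₗ[k] 𝔤) := by
    ext v
    change ⁅x, σ.symm v⁆ = σ.symm ⁅x, v⁆
    rw [LieEquiv.map_lie]
    nth_rw 2 [← hx]
    rw [LieEquiv.symm_apply_apply]
  refine IsSemisimplePart.eq_of_ext (k := k) (x := x) (fun a v hv => ?_) h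
  have h1 := h a _ (Module.End.mapsTo_maxGenEigenspace_of_comm hcomm a hv)
  have h2 := congrArg σ h1
  rw [LieEquiv.map_lie] at h2
  replace h2 : ⁅σ s, σ (σ.symm v)⁆ = a • σ (σ.symm v) :=
    h2.trans (σ.toLieHom.map_smul a (σ.symm v))
  rwa [LieEquiv.apply_symm_apply] at h2

theorem IsSemisimplePart.isNilpotent_sub {x s : 𝔤} (h : IsSemisimplePart k x s) :
    IsNilpotent (LieAlgebra.ad k 𝔤 (x - s)) := by
  refine ⟨Module.finrank k 𝔤, ext_of_iSup (iSup_maxGenEigenspace_ad (k := k) x) fun a v hv => ?_⟩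
  have hmaps : ∀ n : ℕ, ((LieAlgebra.ad k 𝔤 (x - s)) ^ n) v =
        ((LieAlgebra.ad k 𝔤 x - algebraMap k _ a) ^ n) v ∧
      ((LieAlgebra.ad k 𝔤 (x - s)) ^ n) v ∈ (LieAlgebra.ad k 𝔤 x).maxGenEigenspace a := fun n => by
    induction n with
    | zero => exact ⟨rfl, hv⟩
    | succ n ih =>
      have h1 : ∀ w ∈ (LieAlgebra.ad k 𝔤 x).maxGenEigenspace a, ⁅x - s, w⁆ =
          (LieAlgebra.ad k 𝔤 x - algebraMap k _ a) w := fun w hw => by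
        rw [sub_lie, h a w hw]
        simp
      rw [pow_succ', pow_succ', Module.End.mul_apply, Module.End.mul_apply, ← ih.1,
        LieAlgebra.ad_apply, h1 _ ih.2]
      refine ⟨rfl, ?_⟩
      rw [LinearMap.sub_apply, Module.algebraMap_end_apply]
      exact Submodule.sub_mem _ (Module.End.mapsTo_maxGenEigenspace_of_comm (Commute.refl _) a ih.2)
        (Submodule.smul_mem _ _ ih.2)
  rw [(hmaps _).1]
  rw [Module.End.maxGenEigenspace_eq_genEigenspace_finrank, Module.End.mem_genEigenspace_nat] at hv
  exact hv

variable {σ : 𝔤 ≃ₗ⁅k⁆ 𝔤} (hh : LieSubalgebra k (gZero k 𝔤 σ)) [hh.IsCartanSubalgebra]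

theorem mem_of_lie_cartan_eq_zero {R L : Type} [CommRing R] [LieRing L] [LieAlgebra R L]
    {H : LieSubalgebra R L} [H.IsCartanSubalgebra] {x : L} (h : ∀ y ∈ H, ⁅x, y⁆ = 0) : x ∈ H := by
  rw [← LieSubalgebra.IsCartanSubalgebra.self_normalizing (H := H), LieSubalgebra.mem_normalizer_iff]
  exact fun y hy => by rw [h y hy]; exact H.zero_mem

variable {hh}

theorem mem_maxGenEigenspace_zero_of_mem_cartan {x y : gZero k 𝔤 σ} (hx : x ∈ hh) (hy : y ∈ hh) :
    (y : 𝔤) ∈ (LieAlgebra.ad k 𝔤 (x : 𝔤)).maxGenEigenspace (0 : k) := by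
  obtain ⟨n, hn⟩ := LieModule.isNilpotent_toEnd_of_isNilpotent k hh hh ⟨x, hx⟩
  rw [Module.End.mem_maxGenEigenspace]
  refine ⟨n, ?_⟩
  have : ∀ j : ℕ, ((LieAlgebra.ad k 𝔤 (x : 𝔤)) ^ j) (y : 𝔤) =
      ((((LieModule.toEnd k hh hh ⟨x, hx⟩) ^ j) ⟨y, hy⟩ : hh) : gZero k 𝔤 σ) := fun j => by
    induction j with
    | zero => rfl
    | succ j ih => rw [pow_succ', pow_succ', Module.End.mul_apply, Module.End.mul_apply, ih]; rfl
  rw [zero_smul, sub_zero, this, hn]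
  rfl

theorem IsSemisimplePart.lie_cartan {x y : gZero k 𝔤 σ} {s : 𝔤} (h : IsSemisimplePart k (x : 𝔤) s)
    (hx : x ∈ hh) (hy : y ∈ hh) : ⁅s, (y : 𝔤)⁆ = 0 := by
  rw [h 0 _ (mem_maxGenEigenspace_zero_of_mem_cartan hx hy), zero_smul]

theorem killingForm_eq_zero_of_isNilpotent {x y : gZero k 𝔤 σ} (hx : x ∈ hh) (hy : y ∈ hh)
    (hn : IsNilpotent (LieAlgebra.ad k 𝔤 (x : 𝔤))) : killingForm k 𝔤 (x : 𝔤) y = 0 := by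
  have h := LieModule.traceForm_eq_sum_finrank_nsmul_mul k hh 𝔤 ⟨x, hx⟩ ⟨y, hy⟩
  refine Eq.trans (b := LieModule.traceForm k hh 𝔤 ⟨x, hx⟩ ⟨y, hy⟩) rfl (h.trans ?_)
  refine Finset.sum_eq_zero fun χ _ => ?_
  have h1 := χ.hasEigenvalueAt (⟨x, hx⟩ : hh)
  have h2 : IsNilpotent (χ (⟨x, hx⟩ : hh)) :=
    h1.isNilpotent_of_isNilpotent hn
  rw [h2.eq_zero, zero_mul, smul_zero]

theorem killingForm_gZero_eq_zero {x : gZero k 𝔤 σ} (hx : x ∈ hh)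
    (h : ∀ y ∈ hh, killingForm k 𝔤 (x : 𝔤) y = 0) (y : gZero k 𝔤 σ) :
    killingForm k 𝔤 (x : 𝔤) y = 0 := by
  let B : LinearMap.BilinForm k (gZero k 𝔤 σ) :=
    (killingForm k 𝔤).compl₁₂ (gZero k 𝔤 σ).toSubmodule.subtype (gZero k 𝔤 σ).toSubmodule.subtype
  have hB : ∀ (z : hh) (v w : gZero k 𝔤 σ), B ⁅z, v⁆ w = - B v ⁅z, w⁆ := fun z v w => by
    change killingForm k 𝔤 ⁅((z : gZero k 𝔤 σ) : 𝔤), (v : 𝔤)⁆ w =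
      - killingForm k 𝔤 v ⁅((z : gZero k 𝔤 σ) : 𝔤), (w : 𝔤)⁆
    rw [← LieModule.traceForm_apply_lie_apply, ← lie_skew, map_neg, LinearMap.neg_apply]
  have hiff : ∀ z, z ∈ LieModule.genWeightSpace (gZero k 𝔤 σ) (0 : hh → k) ↔ z ∈ hh := fun z => by
    have := LieAlgebra.rootSpace_zero_eq k (gZero k 𝔤 σ) hh
    exact (SetLike.ext_iff.1 this z)
  have hcompl := LieModule.isCompl_genWeightSpace_zero_posFittingComp k hh (gZero k 𝔤 σ)
  have hy : y ∈ LieModule.genWeightSpace (gZero k 𝔤 σ) (0 : hh → k) ⊔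
      LieModule.posFittingComp k hh (gZero k 𝔤 σ) := by
    rw [hcompl.sup_eq_top]; trivial
  obtain ⟨y₀, hy₀, y₁, hy₁, rfl⟩ := (LieSubmodule.mem_sup _ _ _).1 hy
  have h1 : B x y₁ = 0 := LieModule.eq_zero_of_mem_genWeightSpace_mem_posFitting k hh _ hB ((hiff x).2 hx) hy₁
  change B x (y₀ + y₁) = 0
  rw [map_add, h1, add_zero]
  exact h y₀ ((hiff y₀).1 hy₀)

end CartanFixedPoints

end

section

namespace IsTwistedLoop

variable {k 𝔤 Lg Lhat : Type} [Field k] [CharZero k] [IsAlgClosed k] [LieRing 𝔤]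
    [LieAlgebra k 𝔤] [FiniteDimensional k 𝔤] [LieAlgebra.IsKilling k 𝔤] [LieRing Lg]
    [LieAlgebra k[T;T⁻¹] Lg] [LieAlgebra k Lg] [IsScalarTower k k[T;T⁻¹] Lg]
    [LieRing Lhat] [LieAlgebra k Lhat]
    {m : ℕ} {σ : 𝔤 ≃ₗ⁅k⁆ 𝔤} {ζ : k} {u : ℤ → 𝔤 →ₗ[k] Lg} (hL : IsTwistedLoop m σ ζ u)

theorem mem_gZero_iff {k 𝔤 : Type} [Field k] [LieRing 𝔤] [LieAlgebra k 𝔤] {σ : 𝔤 ≃ₗ⁅k⁆ 𝔤} {ζ : k}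
    {y : 𝔤} : y ∈ gZero k 𝔤 σ ↔ y ∈ homComp σ ζ 0 := by
  rw [mem_homComp, zpow_zero, one_smul]
  rfl

include hL

theorem eq_zero_of_killingForm_gZero {x : 𝔤} (hx : x ∈ gZero k 𝔤 σ)
    (h : ∀ y ∈ gZero k 𝔤 σ, killingForm k 𝔤 x y = 0) : x = 0 := by
  obtain ⟨N, b, p, hb⟩ := exists_eigenbasis hL.m_pos hL.iterate_eq hL.primitive
  refine (LieAlgebra.IsKilling.killingForm_nondegenerate k 𝔤).1 _ fun y => ?_
  refine LinearMap.congr_fun (b.ext (f₁ := killingForm k 𝔤 x) (f₂ := 0) fun l => ?_) y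
  by_contra hne
  have h1 := hL.dvd_of_killingForm_ne_zero (mem_gZero_iff.1 hx) (hb l).1 hne
  have h2 := Int.eq_zero_of_dvd_of_nonneg_of_lt (hb l).2.1 (hb l).2.2 (by simpa using h1)
  exact hne (h _ (mem_gZero_iff.2 (h2 ▸ (hb l).1)))

variable {hh : LieSubalgebra k (gZero k 𝔤 σ)} [hh.IsCartanSubalgebra]

theorem isSemisimplePart_self {x : gZero k 𝔤 σ} (hx : x ∈ hh) :
    IsSemisimplePart k (x : 𝔤) (x : 𝔤) := by
  obtain ⟨s, hs⟩ := exists_isSemisimplePart (k := k) (x : 𝔤)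
  have hs0 : s ∈ gZero k 𝔤 σ := hs.map σ x.2
  have hsh : (⟨s, hs0⟩ : gZero k 𝔤 σ) ∈ hh := mem_of_lie_cartan_eq_zero fun y hy =>
    Subtype.ext (hs.lie_cartan hx hy)
  have hn : x - ⟨s, hs0⟩ ∈ hh := hh.sub_mem hx hsh
  have h0 : (x : 𝔤) - s = 0 := hL.eq_zero_of_killingForm_gZero (x - ⟨s, hs0⟩ : gZero k 𝔤 σ).2
    fun y hy => killingForm_gZero_eq_zero hn
      (fun z hz => killingForm_eq_zero_of_isNilpotent hn hz hs.isNilpotent_sub) ⟨y, hy⟩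
  rwa [← sub_eq_zero.1 h0] at hs

theorem lie_eq_zero_of_mem_cartan {x y : gZero k 𝔤 σ} (hx : x ∈ hh) (hy : y ∈ hh) :
    ⁅(x : 𝔤), (y : 𝔤)⁆ = 0 :=
  (hL.isSemisimplePart_self hx).lie_cartan hx hy

end IsTwistedLoop

end

section

namespace IsTwistedLoop

variable {k 𝔤 Lg Lhat : Type} [Field k] [CharZero k] [IsAlgClosed k] [LieRing 𝔤]
    [LieAlgebra k 𝔤] [FiniteDimensional k 𝔤] [LieAlgebra.IsKilling k 𝔤] [LieRing Lg]
    [LieAlgebra k[T;T⁻¹] Lg] [LieAlgebra k Lg] [IsScalarTower k k[T;T⁻¹] Lg]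
    [LieRing Lhat] [LieAlgebra k Lhat]
    {m : ℕ} {σ : 𝔤 ≃ₗ⁅k⁆ 𝔤} {ζ : k} {u : ℤ → 𝔤 →ₗ[k] Lg} (hL : IsTwistedLoop m σ ζ u)
    {hh : LieSubalgebra k (gZero k 𝔤 σ)} [hh.IsCartanSubalgebra]

include hL

theorem exists_weight_basis : ∃ (N : ℕ) (b : Module.Basis (Fin N) k 𝔤) (p : Fin N → ℤ), ∀ l,
    (b l ∈ homComp σ ζ (p l) ∧ 0 ≤ p l ∧ p l < m) ∧
      ∀ x ∈ hh, ∃ a : k, ⁅(x : 𝔤), b l⁆ = a • b l := by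
  refine exists_homogeneous_basis (P := fun v => ∀ x ∈ hh, ∃ a : k, ⁅(x : 𝔤), v⁆ = a • v) ?_
  let f : Option hh → Module.End k 𝔤 := fun o =>
    o.elim (σ : 𝔤 →ₗ[k] 𝔤) fun x => LieAlgebra.ad k 𝔤 ((x : gZero k 𝔤 σ) : 𝔤)
  have hσx : ∀ x : hh, Commute (σ : 𝔤 →ₗ[k] 𝔤) (LieAlgebra.ad k 𝔤 ((x : gZero k 𝔤 σ) : 𝔤)) :=
    fun x => by
      ext v
      change σ ⁅((x : gZero k 𝔤 σ) : 𝔤), v⁆ = ⁅((x : gZero k 𝔤 σ) : 𝔤), σ v⁆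
      rw [LieEquiv.map_lie, show σ ((x : gZero k 𝔤 σ) : 𝔤) = _ from x.1.2]
  have hxy : ∀ x y : hh, Commute (LieAlgebra.ad k 𝔤 ((x : gZero k 𝔤 σ) : 𝔤))
      (LieAlgebra.ad k 𝔤 ((y : gZero k 𝔤 σ) : 𝔤)) := fun x y => by
    ext v
    change ⁅((x : gZero k 𝔤 σ) : 𝔤), ⁅((y : gZero k 𝔤 σ) : 𝔤), v⁆⁆ =
      ⁅((y : gZero k 𝔤 σ) : 𝔤), ⁅((x : gZero k 𝔤 σ) : 𝔤), v⁆⁆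
    rw [leibniz_lie, hL.lie_eq_zero_of_mem_cartan x.2 y.2, zero_lie, zero_add]
  have hcomm : Pairwise fun i j => Commute (f i) (f j) := by
    rintro (_ | x) (_ | y) -
    · exact Commute.refl _
    · exact hσx y
    · exact (hσx x).symm
    · exact hxy x y
  have h := Module.End.iSup_iInf_maxGenEigenspace_eq_top_of_iSup_maxGenEigenspace_eq_top_of_commute
    f hcomm fun i => Module.End.iSup_maxGenEigenspace_eq_top (f i)
  refine eq_top_iff.2 (h ▸ iSup_le fun χ v hv => Submodule.subset_span ?_)
  rw [Submodule.mem_iInf] at hv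
  refine ⟨?_, fun x hx => ⟨χ (some ⟨x, hx⟩), ?_⟩⟩
  · have h1 : v ∈ Module.End.maxGenEigenspace (σ : 𝔤 →ₗ[k] 𝔤) (χ none) := hv none
    rw [(isSemisimple_of_iterate_eq hL.m_pos
        hL.iterate_eq).isFinitelySemisimple.maxGenEigenspace_eq_eigenspace,
      Module.End.mem_eigenspace_iff] at h1
    exact exists_mem_homComp hL.m_pos hL.iterate_eq hL.primitive h1
  · exact hL.isSemisimplePart_self hx _ _ (hv (some ⟨x, hx⟩))

theorem exists_eq_of_degree_zero {D : Module.End k Lg}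
    (hDu : ∀ p, ∀ y ∈ homComp σ ζ p, D (u p y) = (p : k) • u p y) {l : Lg} (hl : D l = 0) :
    ∃ y ∈ homComp σ ζ 0, l = u 0 y := by
  classical
  obtain ⟨f, hf, rfl⟩ := hL.span l
  refine ⟨f 0, hf 0, ?_⟩
  let g : ℤ →₀ 𝔤 := Finsupp.onFinset f.support (fun i => (i : k) • f i) fun i hi =>
    Finsupp.mem_support_iff.2 fun h => hi (by simp [h])
  have hg : g = 0 := by
    refine hL.ind g (fun i => Submodule.smul_mem _ _ (hf i)) ?_
    rw [Finsupp.onFinset_sum _ fun i => map_zero _, ← hl, Finsupp.sum, map_sum]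
    exact Finset.sum_congr rfl fun i _ => by rw [hDu i _ (hf i), map_smul]
  have h0 : ∀ i, i ≠ 0 → f i = 0 := fun i hi =>
    (smul_eq_zero.1 (DFunLike.congr_fun hg i)).resolve_left (Int.cast_ne_zero.2 hi)
  rw [Finsupp.sum]
  refine Finset.sum_eq_single 0 (fun i _ hi => by rw [h0 i hi, map_zero]) fun h => ?_
  rw [Finsupp.notMem_support_iff.1 h, map_zero]

variable (A : AffineRealization k Lg Lhat)
  (hDu : ∀ p, ∀ y ∈ homComp σ ζ p, A.D (u p y) = (p : k) • u p y)

include hDu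

theorem elt_lie_elt_of_mem_cartan {x : gZero k 𝔤 σ} (a b : k) {q : ℤ} {v : 𝔤}
    (hv : v ∈ homComp σ ζ q) :
    ⁅A.elt (u 0 (x : 𝔤)) a b, A.ι (u q v)⁆ = A.ι (u q ⁅(x : 𝔤), v⁆ + (b * q) • u q v) := by
  have hx0 := mem_gZero_iff (ζ := ζ).1 x.2
  rw [A.ι_eq (u q v), A.lie_elt, hL.lie 0 q _ hx0 v hv, hDu q v hv, hDu 0 _ hx0, A.ι_eq]
  simp [mul_smul]

/-- The standard diagonalizable subalgebra. -/
theorem exists_isMAD : ∃ 𝔪 : LieSubalgebra k Lhat, IsMAD 𝔪 ∧ 𝔪.toSubmodule =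
    Submodule.span k ((fun y : gZero k 𝔤 σ => A.ι (u 0 (y : 𝔤))) '' (hh : Set (gZero k 𝔤 σ))) ⊔
      Submodule.span k {A.c} ⊔ Submodule.span k {A.d} := by
  set S : Submodule k Lhat :=
    Submodule.span k ((fun y : gZero k 𝔤 σ => A.ι (u 0 (y : 𝔤))) '' (hh : Set (gZero k 𝔤 σ))) ⊔
      Submodule.span k {A.c} ⊔ Submodule.span k {A.d} with hSdef
  let j : gZero k 𝔤 σ →ₗ[k] Lhat := A.ι ∘ₗ u 0 ∘ₗ (gZero k 𝔤 σ).toSubmodule.subtype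
  have hspan : Submodule.span k
      ((fun y : gZero k 𝔤 σ => A.ι (u 0 (y : 𝔤))) '' (hh : Set (gZero k 𝔤 σ))) =
      hh.toSubmodule.map j := by
    rw [← Submodule.span_eq (hh.toSubmodule.map j)]
    rfl
  have hS : ∀ {z : Lhat}, z ∈ S ↔ ∃ x ∈ hh, ∃ a b : k, z = A.elt (u 0 (x : 𝔤)) a b := fun {z} => by
    simp only [hSdef, hspan, Submodule.mem_sup, Submodule.mem_span_singleton]
    constructor
    · rintro ⟨_, ⟨_, ⟨x, hx, rfl⟩, _, ⟨a, rfl⟩, rfl⟩, _, ⟨b, rfl⟩, rfl⟩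
      exact ⟨x, hx, a, b, rfl⟩
    · rintro ⟨x, hx, a, b, rfl⟩
      exact ⟨_, ⟨_, ⟨x, hx, rfl⟩, _, ⟨a, rfl⟩, rfl⟩, _, ⟨b, rfl⟩, rfl⟩
  have hDx : ∀ x : gZero k 𝔤 σ, A.D (u 0 (x : 𝔤)) = 0 := fun x => by
    rw [hDu 0 _ (mem_gZero_iff.1 x.2)]
    simp
  have hab : ∀ z ∈ S, ∀ w ∈ S, ⁅z, w⁆ = 0 := fun z hz w hw => by
    obtain ⟨x, hx, a, b, rfl⟩ := hS.1 hz
    obtain ⟨y, hy, a', b', rfl⟩ := hS.1 hw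
    rw [A.lie_elt, hDx, hDx, hL.lie 0 0 _ (mem_gZero_iff.1 x.2) _ (mem_gZero_iff.1 y.2),
      hL.lie_eq_zero_of_mem_cartan hx hy]
    simp [AffineRealization.elt]
  have hcS : A.c ∈ S := Submodule.mem_sup_left (Submodule.mem_sup_right
    (Submodule.mem_span_singleton_self _))
  have hdS : A.d ∈ S := Submodule.mem_sup_right (Submodule.mem_span_singleton_self _)
  refine ⟨LieSubalgebra.ofAbelian S hab, ⟨isDiagonalizableSubalgebra_of_span ?_, fun 𝔪' h' hle =>
    le_antisymm (fun z hz => ?_) hle⟩, rfl⟩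
  · set E : Submodule k Lhat := Submodule.span k
      {v | ∀ z ∈ LieSubalgebra.ofAbelian S hab, ∃ a : k, ⁅z, v⁆ = a • v} with hE
    have hSE : S ≤ E := fun w hw => Submodule.subset_span fun z hz =>
      ⟨0, by rw [hab z hz w hw, zero_smul]⟩
    obtain ⟨N, b, p, hb⟩ := hL.exists_weight_basis (hh := hh)
    obtain ⟨e, he, -⟩ := hL.exists_basis b (fun l => (hb l).1.1) fun l => (hb l).1.2
    have hT : ∀ (l : Fin N) (n : ℤ), A.ι ((T n : k[T;T⁻¹]) • u (p l) (b l)) ∈ E := fun l n => by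
      rw [hL.T_smul_eq (hb l).1.1]
      refine Submodule.subset_span fun z hz => ?_
      obtain ⟨x, hx, a, c, rfl⟩ := hS.1 hz
      obtain ⟨t, ht⟩ := (hb l).2 x hx
      have hbl : b l ∈ homComp σ ζ (p l + n * m) := by
        rw [homComp_congr hL.primitive hL.m_pos (q := p l) (by simp)]
        exact (hb l).1.1
      refine ⟨t + c * ((p l + n * m : ℤ) : k), ?_⟩
      rw [hL.elt_lie_elt_of_mem_cartan A hDu a c hbl, ht, map_smul, ← add_smul, map_smul]
    have hR : ∀ (l : Fin N) (r : k[T;T⁻¹]), A.ι (r • u (p l) (b l)) ∈ E := fun l r => by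
      induction r using LaurentPolynomial.induction_on' with
      | add r s hr hs => rw [add_smul, map_add]; exact E.add_mem hr hs
      | C_mul_T n a => rw [mul_smul, C_smul_eq, map_smul]; exact E.smul_mem _ (hT l n)
    refine eq_top_iff.2 fun z _ => ?_
    obtain ⟨l, a, c, rfl⟩ := A.exists_eq z
    refine E.add_mem (E.add_mem ?_ (E.smul_mem _ (hSE hcS))) (E.smul_mem _ (hSE hdS))
    rw [← e.sum_repr l, map_sum]
    exact E.sum_mem fun i _ => by rw [he]; exact hR _ _
  · obtain ⟨l, a, b, rfl⟩ := A.exists_eq z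
    have h1 : A.pr ⁅A.d, A.elt l a b⁆ = 0 := by
      rw [show ⁅A.d, A.elt l a b⁆ = 0 from h'.lie_eq_zero (hle hdS) hz, map_zero]
    have hd : A.d = A.elt 0 0 1 := by simp [AffineRealization.elt]
    have hDl : A.D l = 0 := by
      rw [hd, A.lie_elt, A.pr_elt] at h1
      simpa using h1
    obtain ⟨y, hy, rfl⟩ := hL.exists_eq_of_degree_zero hDu hDl
    have hy0 : y ∈ gZero k 𝔤 σ := mem_gZero_iff.2 hy
    refine hS.2 ⟨⟨y, hy0⟩, mem_of_lie_cartan_eq_zero fun x hx => ?_, a, b, rfl⟩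
    have hxS : A.elt (u 0 (x : 𝔤)) 0 0 ∈ S := hS.2 ⟨x, hx, 0, 0, rfl⟩
    have h2 : A.pr ⁅A.elt (u 0 y) a b, A.elt (u 0 (x : 𝔤)) 0 0⁆ = 0 := by
      rw [show ⁅A.elt (u 0 y) a b, A.elt (u 0 (x : 𝔤)) 0 0⁆ = 0 from h'.lie_eq_zero hz (hle hxS),
        map_zero]
    have hx0 := mem_gZero_iff (ζ := ζ).1 x.2
    rw [A.lie_elt, A.pr_elt, hDx, hDl, hL.lie 0 0 _ hy _ hx0] at h2
    refine Subtype.ext (hL.injOn (p := 0) ?_ (by simpa using h2))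
    exact lie_mem_homComp hL.ne_zero hy hx0

end IsTwistedLoop

end

/-- conjugacy theorem. Every MAD `𝔪` of `L̂(𝔤,σ)` is conjugate, under
an automorphism of the `k`-Lie algebra `L̂(𝔤,σ)`, to `ℋ = 𝔥₀ ⊕ kc ⊕ kd`, where `𝔥₀` is a
fixed Cartan subalgebra of the fixed point algebra `𝔤₀` of `σ`, viewed in `L(𝔤,σ)` as
`𝔥₀ ⊗ 1`.  In particular any two MADs of `L̂(𝔤,σ)` are conjugate. -/
theorem mad_conjugacy
    -- the base field
    (k : Type) [Field k] [IsAlgClosed k] [CharZero k]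
    -- the simple finite-dimensional Lie algebra 𝔤
    (𝔤 : Type) [LieRing 𝔤] [LieAlgebra k 𝔤] [FiniteDimensional k 𝔤]
    [LieAlgebra.IsSimple k 𝔤]
    -- the order m of σ and a primitive m-th root of unity ζ
    (m : ℕ) (hm : 0 < m)
    (σ : 𝔤 ≃ₗ⁅k⁆ 𝔤) (hσ : ∀ y : 𝔤, (⇑σ)^[m] y = y)
    (ζ : k) (hζ : IsPrimitiveRoot ζ m)
    -- the twisted loop algebra L(𝔤,σ) = ⊕_{i∈ℤ} 𝔤_ī ⊗ sⁱ, an R-Lie algebra for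
    -- R = k[t^{±1}] = LaurentPolynomial k (with t = sᵐ);
    -- `u p y` represents `y ⊗ sᵖ` for `y ∈ 𝔤_p̄`, i.e. `σ y = ζ^p • y`
    (Lg : Type) [LieRing Lg] [LieAlgebra (LaurentPolynomial k) Lg]
    [LieAlgebra k Lg] [IsScalarTower k (LaurentPolynomial k) Lg]
    (u : ℤ → 𝔤 →ₗ[k] Lg)
    (hu_bracket : ∀ (p q : ℤ) (y z : 𝔤), σ y = ζ ^ p • y → σ z = ζ ^ q • z →
      ⁅u p y, u q z⁆ = u (p + q) ⁅y, z⁆)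
    (hu_t : ∀ (p : ℤ) (y : 𝔤), σ y = ζ ^ p • y →
      (T 1 : LaurentPolynomial k) • u p y = u (p + (m : ℤ)) y)
    (hu_span : ∀ l : Lg, ∃ f : ℤ →₀ 𝔤, (∀ i, σ (f i) = ζ ^ i • f i) ∧
      l = f.sum fun i yi => u i yi)
    (hu_ind : ∀ f : ℤ →₀ 𝔤, (∀ i, σ (f i) = ζ ^ i • f i) →
      (f.sum fun i yi => u i yi) = 0 → f = 0)
    -- the twisted affine Kac–Moody algebra L̂(𝔤,σ) = L(𝔤,σ) ⊕ kc ⊕ kd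
    (Lhat : Type) [LieRing Lhat] [LieAlgebra k Lhat]
    (c d : Lhat) (ι : Lg →ₗ[k] Lhat)
    (hc : ∀ z : Lhat, ⁅c, z⁆ = 0)
    (hd : ∀ (p : ℤ) (y : 𝔤), σ y = ζ ^ p • y →
      ⁅d, ι (u p y)⁆ = (p : k) • ι (u p y))
    (hbr : ∀ (p q : ℤ) (y z : 𝔤), σ y = ζ ^ p • y → σ z = ζ ^ q • z →
      ⁅ι (u p y), ι (u q z)⁆ =
        ι (u (p + q) ⁅y, z⁆) +
          (if p + q = 0 then (p : k) * killingForm k 𝔤 y z else 0) • c)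
    (hdec : ∀ z : Lhat, ∃ (l : Lg) (a b : k), z = ι l + a • c + b • d)
    (huniq : ∀ (l : Lg) (a b : k), ι l + a • c + b • d = 0 → l = 0 ∧ a = 0 ∧ b = 0)
    -- a Cartan subalgebra 𝔥₀ of the fixed point algebra 𝔤₀ = 𝔤^σ
    (hh : LieSubalgebra k ↥(gZero k 𝔤 σ)) (hhC : hh.IsCartanSubalgebra) :
    (∀ 𝔪 : LieSubalgebra k Lhat, IsMAD 𝔪 →
      ∃ φ : Lhat ≃ₗ⁅k⁆ Lhat,
        ⇑φ '' (𝔪 : Set Lhat) =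
          ((Submodule.span k
              ((fun y : ↥(gZero k 𝔤 σ) => ι (u 0 (y : 𝔤))) ''
                (hh : Set ↥(gZero k 𝔤 σ))) ⊔
            Submodule.span k {c} ⊔ Submodule.span k {d} : Submodule k Lhat) :
            Set Lhat)) ∧
    (∀ 𝔪₁ 𝔪₂ : LieSubalgebra k Lhat, IsMAD 𝔪₁ → IsMAD 𝔪₂ →
      ∃ φ : Lhat ≃ₗ⁅k⁆ Lhat, ⇑φ '' (𝔪₁ : Set Lhat) = (𝔪₂ : Set Lhat)) := by
  have hL : IsTwistedLoop m σ ζ u := ⟨hm, hσ, hζ, fun p q y hy z hz => hu_bracket p q y z hy hz,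
    hu_t, hu_span, hu_ind⟩
  obtain ⟨A, rfl, rfl, rfl, hDu⟩ := hL.exists_affineRealization c d ι hc hd
    (fun p q y hy z hz => hbr p q y z hy hz) hdec huniq
  have : Nontrivial 𝔤 := by
    by_contra h
    rw [not_nontrivial_iff_subsingleton] at h
    exact LieAlgebra.IsSimple.non_abelian k (L := 𝔤) ⟨fun _ _ => Subsingleton.elim _ _⟩
  have := hL.finite
  have := hL.nontrivial
  refine ⟨fun 𝔪 h => ?_, fun 𝔪₁ 𝔪₂ h₁ h₂ => A.exists_conj h₁ h₂⟩
  obtain ⟨𝔫, h𝔫, heq⟩ := hL.exists_isMAD (hh := hh) A hDu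
  obtain ⟨φ, hφ⟩ := A.exists_conj h h𝔫
  exact ⟨φ, by rw [hφ, ← heq]; rfl⟩
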